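/- Limits of the asymptotic MMSE in the low- and high-signal regimes: Let D = {λ > 0 : 𝓕(λ,·,·) has a unique maximizer over Γ(λ)}. Then lim_{n→∞} MMSE_n(λ) → E[U²]·E[V²] − (E[U])²·(E[V])² as λ → 0 along D, and lim_{n→∞} MMSE_n(λ) → 0 as λ → +∞ along D, where U ∼ P_U and V ∼ P_V. -/

import Mathlib

open MeasureTheory ProbabilityTheory Filter Real
open scoped Topology

noncomputable section

/-- Standard Gaussian measure on `ℝ`. -/
def stdG : Measure ℝ := gaussianReal 0 1

/-- The weight `exp(√γ·x·z + γ·x·x₀ − γ·x²/2)` appearing in the scalar Gaussian channel. -/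
def scalarWeight (γ x₀ z x : ℝ) : ℝ :=
  Real.exp (Real.sqrt γ * x * z + γ * x * x₀ - γ * x ^ 2 / 2)

/-- Free energy `ψ_P(γ)` of the scalar Gaussian channel with prior `P`. -/
def psiF (P : Measure ℝ) [IsProbabilityMeasure P] (γ : ℝ) : ℝ :=
  ∫ p : ℝ × ℝ, Real.log (∫ x, scalarWeight γ p.1 p.2 x ∂P) ∂(P.prod stdG)

/-- Posterior mean `⟨x⟩_γ` in the scalar Gaussian channel (`x₀` is the signal, `z` the noise). -/
def postMean (P : Measure ℝ) (γ x₀ z : ℝ) : ℝ :=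
  (∫ x, x * scalarWeight γ x₀ z x ∂P) / (∫ x, scalarWeight γ x₀ z x ∂P)

/-- Overlap `F_P(γ) = E[X₀·⟨x⟩_γ]` of the scalar Gaussian channel. -/
def Fov (P : Measure ℝ) [IsProbabilityMeasure P] (γ : ℝ) : ℝ :=
  ∫ p : ℝ × ℝ, p.1 * postMean P γ p.1 p.2 ∂(P.prod stdG)

/-- The set `Γ(λ)` of fixed points of the state evolution equations. -/
def Gam (PU PV : Measure ℝ) [IsProbabilityMeasure PU] [IsProbabilityMeasure PV]
    (lam : ℝ) : Set (ℝ × ℝ) :=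
  {q | 0 ≤ q.1 ∧ 0 ≤ q.2 ∧ q.2 = Fov PU (lam * q.1) ∧ q.1 = Fov PV (lam * q.2)}

/-- The replica-symmetric potential `𝓕(λ,q₁,q₂)`. -/
def rsF (PU PV : Measure ℝ) [IsProbabilityMeasure PU] [IsProbabilityMeasure PV]
    (lam q₁ q₂ : ℝ) : ℝ :=
  psiF PU (lam * q₁) + psiF PV (lam * q₂) - lam / 2 * q₁ * q₂

/-- Prior distribution of the pair of vectors `(u,v)`. -/
def prior (PU PV : Measure ℝ) [IsProbabilityMeasure PU] [IsProbabilityMeasure PV]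
    (n : ℕ) : Measure ((Fin n → ℝ) × (Fin n → ℝ)) :=
  (Measure.pi fun _ => PU).prod (Measure.pi fun _ => PV)

/-- Law of the Gaussian noise matrix `Z`. -/
def noiseM (n : ℕ) : Measure (Fin n → Fin n → ℝ) :=
  Measure.pi fun _ => Measure.pi fun _ => stdG

/-- Joint law of `((U,V),Z)`. -/
def sampleM (PU PV : Measure ℝ) [IsProbabilityMeasure PU] [IsProbabilityMeasure PV]
    (n : ℕ) : Measure (((Fin n → ℝ) × (Fin n → ℝ)) × (Fin n → Fin n → ℝ)) :=
  (prior PU PV n).prod (noiseM n)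

/-- Hamiltonian `H_n(u,v)` of the planted bipartite model. -/
def Ham (lam : ℝ) (n : ℕ) (U V : Fin n → ℝ) (Z : Fin n → Fin n → ℝ)
    (u v : Fin n → ℝ) : ℝ :=
  ∑ i : Fin n, ∑ j : Fin n,
    (Real.sqrt (lam / n) * u i * v j * Z i j
      + lam / n * (u i * U i * v j * V j)
      - lam / (2 * n) * (u i ^ 2 * v j ^ 2))

/-- Partition function `Z_n = ∫ e^{H_n(u,v)} dP₀ⁿ(u,v)`. -/
def partFun (PU PV : Measure ℝ) [IsProbabilityMeasure PU] [IsProbabilityMeasure PV]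
    (lam : ℝ) (n : ℕ)
    (ω : ((Fin n → ℝ) × (Fin n → ℝ)) × (Fin n → Fin n → ℝ)) : ℝ :=
  ∫ uv, Real.exp (Ham lam n ω.1.1 ω.1.2 ω.2 uv.1 uv.2) ∂(prior PU PV n)

/-- Free energy `F_n(λ) = (1/n)·E[log Z_n]`. -/
def freeEnergy (PU PV : Measure ℝ) [IsProbabilityMeasure PU] [IsProbabilityMeasure PV]
    (n : ℕ) (lam : ℝ) : ℝ :=
  (1 / (n : ℝ)) * ∫ ω, Real.log (partFun PU PV lam n ω) ∂(sampleM PU PV n)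

/-- Gibbs (posterior) expectation `⟨f(u,v)⟩` given the realization `ω = ((U,V),Z)`. -/
def gibbs (PU PV : Measure ℝ) [IsProbabilityMeasure PU] [IsProbabilityMeasure PV]
    (lam : ℝ) (n : ℕ)
    (ω : ((Fin n → ℝ) × (Fin n → ℝ)) × (Fin n → Fin n → ℝ))
    (f : (Fin n → ℝ) × (Fin n → ℝ) → ℝ) : ℝ :=
  (∫ uv, f uv * Real.exp (Ham lam n ω.1.1 ω.1.2 ω.2 uv.1 uv.2) ∂(prior PU PV n))
    / partFun PU PV lam n ω

/-- Rescaled scalar product `x·y = (1/n)·Σᵢ xᵢyᵢ`. -/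
def ovDot (n : ℕ) (x y : Fin n → ℝ) : ℝ := (1 / (n : ℝ)) * ∑ i, x i * y i

/-- Matrix minimum mean square error `MMSE_n(λ)`, with `E[U_iV_j | Y] = ⟨u_i v_j⟩` written
as the Gibbs (posterior) mean. -/
def MMSEn (PU PV : Measure ℝ) [IsProbabilityMeasure PU] [IsProbabilityMeasure PV]
    (n : ℕ) (lam : ℝ) : ℝ :=
  (1 / (n : ℝ) ^ 2) * ∑ i : Fin n, ∑ j : Fin n,
    ∫ ω, (ω.1.1 i * ω.1.2 j - gibbs PU PV lam n ω fun uv => uv.1 i * uv.2 j) ^ 2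
      ∂(sampleM PU PV n)

/-- The quantity `E⟨(u·U)(v·V)⟩`. -/
def overlapExp (PU PV : Measure ℝ) [IsProbabilityMeasure PU] [IsProbabilityMeasure PV]
    (n : ℕ) (lam : ℝ) : ℝ :=
  ∫ ω, gibbs PU PV lam n ω (fun uv => ovDot n uv.1 ω.1.1 * ovDot n uv.2 ω.1.2)
    ∂(sampleM PU PV n)

/-- `q` maximizes `𝓕(λ,·,·)` over `Γ(λ)`. -/
def isMaximizer (PU PV : Measure ℝ) [IsProbabilityMeasure PU] [IsProbabilityMeasure PV]
    (lam : ℝ) (q : ℝ × ℝ) : Prop :=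
  q ∈ Gam PU PV lam ∧ ∀ q' ∈ Gam PU PV lam, rsF PU PV lam q'.1 q'.2 ≤ rsF PU PV lam q.1 q.2

/-- The set `D` of `λ > 0` where `𝓕(λ,·,·)` has a unique maximizer over `Γ(λ)`. -/
def Dset (PU PV : Measure ℝ) [IsProbabilityMeasure PU] [IsProbabilityMeasure PV] :
    Set ℝ :=
  {lam | 0 < lam ∧ ∃! q : ℝ × ℝ, isMaximizer PU PV lam q}

noncomputable section
set_option linter.unusedSectionVars false
set_option linter.unusedVariables false
namespace BM

/-- Standard Gaussian measure on `A → ℝ`. -/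
def gam (A : Type) [Fintype A] : Measure (A → ℝ) := Measure.pi fun _ => gaussianReal 0 1

instance (A : Type) [Fintype A] : IsProbabilityMeasure (gam A) := by
  unfold gam; infer_instance

section
variable {A B : Type} [Fintype A] [Fintype B]

/-- Measurable functions of at most exponential growth. -/
def Tame (F : (A → ℝ) → ℝ) : Prop :=
  Measurable F ∧ ∃ C k : ℝ, 0 ≤ C ∧ 0 ≤ k ∧ ∀ Y, |F Y| ≤ C * Real.exp (k * ∑ a, |Y a|)

lemma integrable_expAbs (k : ℝ) :
    Integrable (fun Y : A → ℝ => Real.exp (k * ∑ a, |Y a|)) (gam A) := by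
  have h : ∀ Y : A → ℝ, Real.exp (k * ∑ a, |Y a|) = ∏ a, Real.exp (k * |Y a|) := by
    intro Y; rw [← Real.exp_sum, Finset.mul_sum]
  simp_rw [h]
  refine Integrable.fintype_prod (f := fun (_ : A) (y : ℝ) => Real.exp (k * |y|)) (fun a => ?_)
  exact integrable_exp_mul_abs (X := id) (integrable_exp_mul_gaussianReal k)
    (integrable_exp_mul_gaussianReal (-k))

lemma Tame.integrable {F : (A → ℝ) → ℝ} (h : Tame F) : Integrable F (gam A) := by
  obtain ⟨hm, C, k, _, _, hb⟩ := h
  refine Integrable.mono' ((integrable_expAbs k).const_mul C) hm.aestronglyMeasurable ?_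
  exact Eventually.of_forall fun Y => by simpa using hb Y

lemma Tame.meas {F : (A → ℝ) → ℝ} (h : Tame F) : Measurable F := h.1

lemma sumabs_nonneg (Y : A → ℝ) : 0 ≤ ∑ a, |Y a| := Finset.sum_nonneg fun _ _ => abs_nonneg _

lemma Tame.of_le {F G : (A → ℝ) → ℝ} (hG : Tame G) (hF : Measurable F)
    (h : ∀ Y, |F Y| ≤ |G Y|) : Tame F := by
  obtain ⟨_, C, k, h1, h2, hb⟩ := hG
  exact ⟨hF, C, k, h1, h2, fun Y => (h Y).trans (hb Y)⟩

lemma tame_const (r : ℝ) : Tame (fun _ : A → ℝ => r) :=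
  ⟨measurable_const, |r|, 0, abs_nonneg _, le_rfl, fun Y => by simp⟩

lemma Tame.add {F G : (A → ℝ) → ℝ} (hF : Tame F) (hG : Tame G) : Tame (fun Y => F Y + G Y) := by
  obtain ⟨hm, C, k, h1, h2, hb⟩ := hF
  obtain ⟨hm', C', k', h1', h2', hb'⟩ := hG
  refine ⟨hm.add hm', C + C', k + k', by positivity, by positivity, fun Y => ?_⟩
  have hs := sumabs_nonneg Y
  have e1 : Real.exp (k * ∑ a, |Y a|) ≤ Real.exp ((k + k') * ∑ a, |Y a|) :=
    Real.exp_le_exp.2 (by nlinarith)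
  have e2 : Real.exp (k' * ∑ a, |Y a|) ≤ Real.exp ((k + k') * ∑ a, |Y a|) :=
    Real.exp_le_exp.2 (by nlinarith)
  calc |F Y + G Y| ≤ |F Y| + |G Y| := abs_add_le _ _
    _ ≤ C * Real.exp (k * ∑ a, |Y a|) + C' * Real.exp (k' * ∑ a, |Y a|) := add_le_add (hb Y) (hb' Y)
    _ ≤ _ := by rw [add_mul]; gcongr

lemma Tame.mul {F G : (A → ℝ) → ℝ} (hF : Tame F) (hG : Tame G) : Tame (fun Y => F Y * G Y) := by
  obtain ⟨hm, C, k, h1, h2, hb⟩ := hF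
  obtain ⟨hm', C', k', h1', h2', hb'⟩ := hG
  refine ⟨hm.mul hm', C * C', k + k', by positivity, by positivity, fun Y => ?_⟩
  rw [abs_mul, add_mul, Real.exp_add]
  calc |F Y| * |G Y| ≤ (C * Real.exp (k * ∑ a, |Y a|)) * (C' * Real.exp (k' * ∑ a, |Y a|)) :=
        mul_le_mul (hb Y) (hb' Y) (abs_nonneg _) (by positivity)
    _ = _ := by ring

lemma Tame.const_mul {F : (A → ℝ) → ℝ} (hF : Tame F) (r : ℝ) : Tame (fun Y => r * F Y) :=
  (tame_const r).mul hF

lemma Tame.mul_const {F : (A → ℝ) → ℝ} (hF : Tame F) (r : ℝ) : Tame (fun Y => F Y * r) :=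
  hF.mul (tame_const r)

lemma Tame.neg {F : (A → ℝ) → ℝ} (hF : Tame F) : Tame (fun Y => - F Y) := by
  simpa using hF.const_mul (-1)

lemma Tame.sub {F G : (A → ℝ) → ℝ} (hF : Tame F) (hG : Tame G) : Tame (fun Y => F Y - G Y) := by
  simpa [sub_eq_add_neg] using hF.add hG.neg

lemma Tame.pow {F : (A → ℝ) → ℝ} (hF : Tame F) (n : ℕ) : Tame (fun Y => F Y ^ n) := by
  induction n with
  | zero => simpa using tame_const (A := A) 1
  | succ n ih => simpa [pow_succ] using ih.mul hF

lemma Tame.abs {F : (A → ℝ) → ℝ} (hF : Tame F) : Tame (fun Y => |F Y|) :=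
  hF.of_le (measurable_norm.comp hF.1) (by simp)

lemma tame_sum {ι : Type} (s : Finset ι) {F : ι → (A → ℝ) → ℝ} (h : ∀ i ∈ s, Tame (F i)) :
    Tame (fun Y => ∑ i ∈ s, F i Y) := by
  classical
  induction s using Finset.induction_on with
  | empty => simpa using tame_const (A := A) 0
  | insert a s ha ih =>
    simp only [Finset.sum_insert ha]
    exact (h a (by simp)).add (ih fun i hi => h i (by simp [hi]))

lemma tame_eval (a : A) : Tame (fun Y : A → ℝ => Y a) := by
  refine ⟨measurable_pi_apply a, 1, 1, by norm_num, by norm_num, fun Y => ?_⟩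
  have h1 : |Y a| ≤ ∑ a, |Y a| :=
    Finset.single_le_sum (f := fun a => |Y a|) (fun i _ => abs_nonneg _) (Finset.mem_univ a)
  have := Real.add_one_le_exp (∑ a, |Y a|)
  simp only [one_mul]; linarith

lemma tame_lin (b : A → ℝ) (r : ℝ) : Tame (fun Y : A → ℝ => ∑ a, b a * Y a + r) :=
  (tame_sum _ fun a _ => (tame_eval a).const_mul (b a)).add (tame_const r)

lemma lin_abs_le (b : A → ℝ) (Y : A → ℝ) :
    |∑ a, b a * Y a| ≤ (∑ a, |b a|) * ∑ a, |Y a| := by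
  refine (Finset.abs_sum_le_sum_abs _ _).trans ?_
  rw [Finset.sum_mul]
  refine Finset.sum_le_sum fun a _ => ?_
  rw [abs_mul]
  gcongr
  exact Finset.single_le_sum (f := fun a => |Y a|) (fun i _ => abs_nonneg _) (Finset.mem_univ a)

lemma tame_expLin (b : A → ℝ) (r : ℝ) : Tame (fun Y : A → ℝ => Real.exp (∑ a, b a * Y a + r)) := by
  refine ⟨by fun_prop, Real.exp r, ∑ a, |b a|, by positivity,
    Finset.sum_nonneg fun _ _ => abs_nonneg _, fun Y => ?_⟩
  rw [abs_of_pos (Real.exp_pos _), add_comm, Real.exp_add]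
  gcongr
  exact (le_abs_self _).trans (lin_abs_le b Y)

lemma Tame.shift {F : (A → ℝ) → ℝ} (hF : Tame F) (b : A → ℝ) : Tame (fun Y => F (Y + b)) := by
  obtain ⟨hm, C, k, h1, h2, hb⟩ := hF
  refine ⟨hm.comp (measurable_add_const b), C * Real.exp (k * ∑ a, |b a|), k, by positivity, h2,
    fun Y => (hb _).trans ?_⟩
  rw [mul_assoc, ← Real.exp_add, ← mul_add, ← Finset.sum_add_distrib]
  gcongr with a
  rw [add_comm]
  exact abs_add_le _ _

/-- Reindexed tameness: precomposition by a linear map given by a matrix. -/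
lemma Tame.comp_elim {F : (A ⊕ B → ℝ) → ℝ} (hF : Tame F) (Y : A → ℝ) :
    Tame (fun W : B → ℝ => F (Sum.elim Y W)) := by
  obtain ⟨hm, C, k, h1, h2, hb⟩ := hF
  refine ⟨hm.comp ?_, C * Real.exp (k * ∑ a, |Y a|), k, by positivity, h2,
    fun W => (hb _).trans ?_⟩
  · rw [measurable_pi_iff]; rintro (a | b)
    · simp
    · simpa using measurable_pi_apply b
  · rw [mul_assoc, ← Real.exp_add, ← mul_add]
    simp

lemma measurable_elim : Measurable (fun q : (A → ℝ) × (B → ℝ) => (Sum.elim q.1 q.2 : A ⊕ B → ℝ)) := by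
  rw [measurable_pi_iff]; rintro (a | b)
  · exact (measurable_pi_apply a).comp measurable_fst
  · exact (measurable_pi_apply b).comp measurable_snd

lemma mp_elim : MeasurePreserving (fun q : (A → ℝ) × (B → ℝ) => (Sum.elim q.1 q.2 : A ⊕ B → ℝ))
    ((gam A).prod (gam B)) (gam (A ⊕ B)) := by
  have := measurePreserving_sumPiEquivProdPi_symm (X := fun _ : A ⊕ B => ℝ)
    (fun _ => gaussianReal 0 1)
  refine ⟨measurable_elim, ?_⟩
  rw [gam, gam, gam, ← this.map_eq]
  congr 1

lemma Tame.integrable_elim {F : (A ⊕ B → ℝ) → ℝ} (hF : Tame F) :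
    Integrable (fun q : (A → ℝ) × (B → ℝ) => F (Sum.elim q.1 q.2)) ((gam A).prod (gam B)) :=
  mp_elim.integrable_comp_of_integrable hF.integrable

lemma integral_sumElim {F : (A ⊕ B → ℝ) → ℝ} (hF : Tame F) :
    ∫ Y, F Y ∂(gam (A ⊕ B)) = ∫ Y, ∫ W, F (Sum.elim Y W) ∂(gam B) ∂(gam A) := by
  rw [← mp_elim.map_eq, integral_map mp_elim.measurable.aemeasurable
    hF.1.aestronglyMeasurable, integral_prod _ hF.integrable_elim]

lemma Tame.integral_left {F : (A ⊕ B → ℝ) → ℝ} (hF : Tame F) :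
    Tame (fun Y => ∫ W, F (Sum.elim Y W) ∂(gam B)) := by
  have hm : Measurable (fun Y => ∫ W, F (Sum.elim Y W) ∂(gam B)) :=
    ((hF.1.comp measurable_elim).stronglyMeasurable.integral_prod_right').measurable
  obtain ⟨_, C, k, h1, h2, hb⟩ := hF
  refine ⟨hm, C * ∫ W, Real.exp (k * ∑ b, |W b|) ∂(gam B), k, ?_, h2, fun Y => ?_⟩
  · exact mul_nonneg h1 (integral_nonneg fun _ => (Real.exp_pos _).le)
  · refine (abs_integral_le_integral_abs).trans ?_
    calc ∫ W, |F (Sum.elim Y W)| ∂(gam B)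
        ≤ ∫ W, (C * Real.exp (k * ∑ a, |Y a|)) * Real.exp (k * ∑ b, |W b|) ∂(gam B) := by
          refine integral_mono_of_nonneg (Eventually.of_forall fun _ => abs_nonneg _)
            ((integrable_expAbs k).const_mul _) (Eventually.of_forall fun W => (hb _).trans ?_)
          simp only []
          rw [mul_assoc, ← Real.exp_add, ← mul_add]
          simp
      _ = _ := by rw [integral_const_mul]; ring

end
end BM
end

noncomputable section
set_option linter.unusedSectionVars false
set_option linter.unusedVariables false
namespace BM
section
variable {Ω A B : Type} [Fintype Ω] [Fintype A] [Fintype B]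

/-- Gaussian likelihood ratio. -/
def el (b : A → ℝ) (Y : A → ℝ) : ℝ := Real.exp (∑ a, b a * Y a - (∑ a, b a ^ 2) / 2)

lemma el_pos (b Y : A → ℝ) : 0 < el b Y := Real.exp_pos _

lemma tame_el (b : A → ℝ) : Tame (el b) := by
  have := tame_expLin b (-((∑ a, b a ^ 2) / 2))
  have e : el b = fun Y => Real.exp (∑ a, b a * Y a + -((∑ a, b a ^ 2) / 2)) := by
    funext Y; simp [el, sub_eq_add_neg]
  rwa [e]

lemma gauss_shift (t : ℝ) (f : ℝ → ℝ) :
    ∫ y, f y * Real.exp (t * y - t ^ 2 / 2) ∂(gaussianReal 0 1) = ∫ y, f y ∂(gaussianReal t 1) := by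
  rw [integral_gaussianReal_eq_integral_smul one_ne_zero,
    integral_gaussianReal_eq_integral_smul one_ne_zero]
  congr 1
  funext y
  simp only [gaussianPDFReal, smul_eq_mul]
  rw [mul_comm (f y), ← mul_assoc, mul_assoc _ (Real.exp _) (Real.exp _), ← Real.exp_add]
  congr 4
  simp; ring

lemma gam_map_shift (b : A → ℝ) :
    (gam A).map (fun Y => Y + b) = (gam A).withDensity (fun Y => ENNReal.ofReal (el b Y)) := by
  have h1 : (gam A).map (fun Y => Y + b) = Measure.pi (fun a => gaussianReal (b a) 1) := by
    have := Measure.pi_map_pi (μ := fun _ : A => gaussianReal 0 1) (f := fun a y => y + b a)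
      (fun a => (measurable_add_const (b a)).aemeasurable)
    simp only [gaussianReal_map_add_const, zero_add] at this
    exact this
  rw [h1]
  refine Measure.pi_eq fun s hs => ?_
  have hms : MeasurableSet (Set.univ.pi s) := MeasurableSet.univ_pi hs
  rw [withDensity_apply _ hms]
  have hInt : Integrable (el b) ((gam A).restrict (Set.univ.pi s)) :=
    (tame_el b).integrable.restrict
  rw [← ofReal_integral_eq_lintegral_ofReal hInt (Eventually.of_forall fun Y => (el_pos b Y).le)]
  rw [← integral_indicator hms]
  have h2 : ∀ Y : A → ℝ, (Set.univ.pi s).indicator (el b) Y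
      = ∏ a, (s a).indicator 1 (Y a) * Real.exp (b a * Y a - b a ^ 2 / 2) := by
    intro Y
    by_cases h : Y ∈ Set.univ.pi s
    · rw [Set.indicator_of_mem h, el, Finset.sum_div, ← Finset.sum_sub_distrib, Real.exp_sum]
      refine Finset.prod_congr rfl fun a _ => ?_
      rw [Set.indicator_of_mem (h a (Set.mem_univ a)), Pi.one_apply, one_mul]
    · rw [Set.indicator_of_notMem h]
      simp only [Set.mem_pi, Set.mem_univ, forall_true_left, not_forall] at h
      obtain ⟨a, ha⟩ := h
      refine (Finset.prod_eq_zero (Finset.mem_univ a) ?_).symm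
      rw [Set.indicator_of_notMem ha, zero_mul]
  simp_rw [h2]
  rw [gam, integral_fintype_prod_eq_prod (μ := fun _ : A => gaussianReal 0 1)
    (fun a y => (s a).indicator (1 : ℝ → ℝ) y * Real.exp (b a * y - b a ^ 2 / 2))]
  rw [ENNReal.ofReal_prod_of_nonneg]
  · refine Finset.prod_congr rfl fun a _ => ?_
    rw [gauss_shift, integral_indicator_one (hs a)]
    simp
  · intro a _
    rw [gauss_shift, integral_indicator_one (hs a)]
    positivity

/-- Gaussian shift (Cameron-Martin). -/
lemma integral_shift (b : A → ℝ) (H : (A → ℝ) → ℝ) (hH : Measurable H) :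
    ∫ Y, el b Y * H Y ∂(gam A) = ∫ Y, H (Y + b) ∂(gam A) := by
  have h1 : ∫ Y, H (Y + b) ∂(gam A) = ∫ Y, H Y ∂((gam A).map (fun Y => Y + b)) :=
    (integral_map (measurable_add_const b).aemeasurable hH.aestronglyMeasurable).symm
  rw [h1, gam_map_shift, integral_withDensity_eq_integral_toReal_smul
    (tame_el b).1.ennreal_ofReal (Eventually.of_forall fun _ => ENNReal.ofReal_lt_top)]
  refine integral_congr_ae (Eventually.of_forall fun Y => ?_)
  simp [ENNReal.toReal_ofReal (el_pos b Y).le]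

lemma integral_el (b : A → ℝ) : ∫ Y, el b Y ∂(gam A) = 1 := by
  have := integral_shift b (fun _ => 1) measurable_const
  simpa using this

lemma integral_expLin (b : A → ℝ) :
    ∫ Y, Real.exp (∑ a, b a * Y a) ∂(gam A) = Real.exp ((∑ a, b a ^ 2) / 2) := by
  have h : ∀ Y : A → ℝ, Real.exp (∑ a, b a * Y a) = Real.exp ((∑ a, b a ^ 2) / 2) * el b Y := by
    intro Y; rw [el, ← Real.exp_add]; congr 1; ring
  simp_rw [h]
  rw [integral_const_mul, integral_el, mul_one]

/-- The vector of linear forms. -/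
def lin (c : Ω → A → ℝ) (Y : A → ℝ) : Ω → ℝ := fun x => ∑ a, c x a * Y a

lemma measurable_lin (c : Ω → A → ℝ) : Measurable (lin c) := by
  unfold lin; fun_prop

lemma charFun_lin (c : Ω → A → ℝ) (L : StrongDual ℝ (Ω → ℝ)) :
    charFunDual ((gam A).map (lin c)) L
      = Complex.exp (-((∑ a, (L fun x => c x a) ^ 2 : ℝ) : ℂ) / 2) := by
  rw [charFunDual_apply, integral_map (measurable_lin c).aemeasurable
    (by fun_prop)]
  have h1 : ∀ Y, L (lin c Y) = ∑ a, (L fun x => c x a) * Y a := by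
    intro Y
    have : lin c Y = ∑ a, Y a • (fun x => c x a) := by
      funext x; simp [lin, mul_comm]
    rw [this, map_sum]
    simp [mul_comm]
  have h2 : ∀ Y, Complex.exp (L (lin c Y) * Complex.I)
      = ∏ a, Complex.exp (((L fun x => c x a) : ℝ) * (Y a : ℂ) * Complex.I) := by
    intro Y
    rw [h1, ← Complex.exp_sum]; push_cast; rw [Finset.sum_mul]
  simp_rw [h2]
  rw [gam, integral_fintype_prod_eq_prod (μ := fun _ : A => gaussianReal 0 1)
    (fun a (y : ℝ) => Complex.exp (((L fun x => c x a) : ℝ) * (y : ℂ) * Complex.I))]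
  simp_rw [← charFun_apply_real, charFun_gaussianReal]
  rw [← Complex.exp_sum]
  congr 1
  push_cast
  rw [neg_div, Finset.sum_div, ← Finset.sum_neg_distrib]
  refine Finset.sum_congr rfl fun a _ => ?_
  simp

/-- Gram lemma: the law of the linear forms depends on the Gram matrix only. -/
lemma gram_map (c : Ω → A → ℝ) (c' : Ω → B → ℝ)
    (h : ∀ x y, ∑ a, c x a * c y a = ∑ b, c' x b * c' y b) :
    (gam A).map (lin c) = (gam B).map (lin c') := by
  have := Measure.isProbabilityMeasure_map (μ := gam A) (measurable_lin c).aemeasurable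
  have := Measure.isProbabilityMeasure_map (μ := gam B) (measurable_lin c').aemeasurable
  refine Measure.ext_of_charFunDual (funext fun L => ?_)
  rw [charFun_lin, charFun_lin]
  congr 4
  classical
  have key : ∀ (A : Type) [Fintype A] (c : Ω → A → ℝ), ∑ a, (L fun x => c x a) ^ 2
      = ∑ x, ∑ y, L (Pi.single x 1) * L (Pi.single y 1) * ∑ a, c x a * c y a := by
    intro A _ c
    have h1 : ∀ a, (L fun x => c x a) = ∑ x, c x a * L (Pi.single x 1) := by
      intro a
      have : (fun x => c x a) = ∑ x, c x a • (Pi.single x 1 : Ω → ℝ) := by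
        funext y; simp [Finset.sum_apply, Pi.single_apply]
      rw [this, map_sum]; simp
    simp_rw [h1, sq, Finset.sum_mul_sum, Finset.mul_sum]
    rw [Finset.sum_comm]
    refine Finset.sum_congr rfl fun x _ => ?_
    rw [Finset.sum_comm]
    refine Finset.sum_congr rfl fun y _ => ?_
    refine Finset.sum_congr rfl fun a _ => ?_
    ring
  rw [key A c, key B c']
  simp_rw [h]

lemma gram_integral (c : Ω → A → ℝ) (c' : Ω → B → ℝ)
    (h : ∀ x y, ∑ a, c x a * c y a = ∑ b, c' x b * c' y b)
    (G : (Ω → ℝ) → ℝ) (hG : Measurable G) :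
    ∫ Y, G (lin c Y) ∂(gam A) = ∫ Y, G (lin c' Y) ∂(gam B) := by
  rw [← integral_map (measurable_lin c).aemeasurable hG.aestronglyMeasurable,
    ← integral_map (measurable_lin c').aemeasurable hG.aestronglyMeasurable, gram_map c c' h]

lemma integral_affine_sq (α : A → ℝ) (β : ℝ) :
    ∫ Y, (∑ a, α a * Y a + β) ^ 2 ∂(gam A) = ∑ a, α a ^ 2 + β ^ 2 := by
  have h0 : (0:ℝ) ≤ ∑ a, α a ^ 2 := Finset.sum_nonneg fun _ _ => sq_nonneg _
  have := gram_integral (Ω := Unit) (fun _ => α) (fun _ (_ : Unit) => Real.sqrt (∑ a, α a ^ 2))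
    (by intro x y; simp [← sq]; rw [Real.sq_sqrt h0]) (fun v => (v () + β) ^ 2) (by fun_prop)
  simp only [lin] at this
  rw [this]
  simp only [Finset.univ_unique, PUnit.default_eq_unit, Finset.sum_singleton]
  set σ := Real.sqrt (∑ a, α a ^ 2)
  rw [gam]
  rw [integral_comp_eval (μ := fun _ : Unit => gaussianReal 0 1) (i := ())
    (f := fun y : ℝ => (σ * y + β) ^ 2) (by fun_prop)]
  have e : ∀ y : ℝ, (σ * y + β) ^ 2 = σ ^ 2 * y ^ 2 + (2 * σ * β) * y + β ^ 2 := by intro y; ring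
  have i2 : Integrable (fun y : ℝ => y ^ 2) (gaussianReal 0 1) :=
    (memLp_id_gaussianReal 2).integrable_sq
  have i1 : Integrable (fun y : ℝ => y) (gaussianReal 0 1) :=
    (memLp_id_gaussianReal 1).integrable le_rfl
  have v2 : ∫ y : ℝ, y ^ 2 ∂(gaussianReal 0 1) = 1 := by
    have := variance_id_gaussianReal (μ := 0) (v := 1)
    rw [variance_eq_sub (memLp_id_gaussianReal 2)] at this
    simpa using this
  simp_rw [e]
  have i3 : Integrable (fun y : ℝ => σ ^ 2 * y ^ 2 + (2 * σ * β) * y) (gaussianReal 0 1) :=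
    (i2.const_mul _).add (i1.const_mul _)
  rw [integral_add i3 (integrable_const _),
    integral_add (i2.const_mul _) (i1.const_mul _), integral_const_mul, integral_const_mul, v2,
    integral_id_gaussianReal]
  simp [σ, Real.sq_sqrt h0]

end
end BM
end

noncomputable section
set_option linter.unusedSectionVars false
set_option linter.unusedVariables false
namespace BM
section
variable {Ω A B : Type} [Fintype Ω] [Fintype A] [Fintype B]

/-- Probability vectors. -/
def IsP (p : Ω → ℝ) : Prop := (∀ x, 0 ≤ p x) ∧ ∑ x, p x = 1

/-- Mean of `f` under `p`. -/
def pm (p : Ω → ℝ) (f : Ω → ℝ) : ℝ := ∑ x, p x * f x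

/-- Partition function relative to pure noise. -/
def Zc (p : Ω → ℝ) (c : Ω → A → ℝ) (Y : A → ℝ) : ℝ := ∑ x, p x * el (c x) Y

/-- Numerator of the posterior mean. -/
def Nc (p : Ω → ℝ) (c : Ω → A → ℝ) (f : Ω → ℝ) (Y : A → ℝ) : ℝ := ∑ x, p x * f x * el (c x) Y

/-- Second moment of the posterior mean. -/
def ov (p : Ω → ℝ) (c : Ω → A → ℝ) (f : Ω → ℝ) : ℝ := ∫ Y, Nc p c f Y ^ 2 / Zc p c Y ∂(gam A)

/-- Free energy (relative entropy w.r.t. pure noise). -/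
def Phi (p : Ω → ℝ) (c : Ω → A → ℝ) : ℝ := ∫ Y, Zc p c Y * Real.log (Zc p c Y) ∂(gam A)

/-- Posterior. -/
def post (p : Ω → ℝ) (c : Ω → A → ℝ) (Y : A → ℝ) (x : Ω) : ℝ := p x * el (c x) Y / Zc p c Y

lemma IsP.nn {p : Ω → ℝ} (hp : IsP p) (x : Ω) : 0 ≤ p x := hp.1 x

lemma IsP.exists_pos {p : Ω → ℝ} (hp : IsP p) : ∃ x, 0 < p x := by
  by_contra h
  push Not at h
  have : ∑ x, p x ≤ 0 := Finset.sum_nonpos fun x _ => h x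
  rw [hp.2] at this; linarith

lemma Zc_pos {p : Ω → ℝ} (hp : IsP p) (c : Ω → A → ℝ) (Y : A → ℝ) : 0 < Zc p c Y := by
  obtain ⟨x, hx⟩ := hp.exists_pos
  exact Finset.sum_pos' (fun x _ => mul_nonneg (hp.1 x) (el_pos _ _).le)
    ⟨x, Finset.mem_univ _, mul_pos hx (el_pos _ _)⟩

lemma pm_le {p : Ω → ℝ} (hp : IsP p) {f g : Ω → ℝ} (h : ∀ x, f x ≤ g x) : pm p f ≤ pm p g :=
  Finset.sum_le_sum fun x _ => mul_le_mul_of_nonneg_left (h x) (hp.1 x)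

lemma pm_const {p : Ω → ℝ} (hp : IsP p) (r : ℝ) : pm p (fun _ => r) = r := by
  simp [pm, ← Finset.sum_mul, hp.2]

lemma pm_add (p : Ω → ℝ) (f g : Ω → ℝ) : pm p (fun x => f x + g x) = pm p f + pm p g := by
  simp [pm, mul_add, Finset.sum_add_distrib]

lemma pm_sub (p : Ω → ℝ) (f g : Ω → ℝ) : pm p (fun x => f x - g x) = pm p f - pm p g := by
  simp [pm, mul_sub, Finset.sum_sub_distrib]

lemma pm_smul (p : Ω → ℝ) (r : ℝ) (f : Ω → ℝ) : pm p (fun x => r * f x) = r * pm p f := by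
  simp only [pm, Finset.mul_sum]; exact Finset.sum_congr rfl fun x _ => by ring

lemma pm_sum {ι : Type} (s : Finset ι) (p : Ω → ℝ) (f : ι → Ω → ℝ) :
    pm p (fun x => ∑ i ∈ s, f i x) = ∑ i ∈ s, pm p (f i) := by
  simp only [pm, Finset.mul_sum]; exact Finset.sum_comm

lemma pm_nonneg {p : Ω → ℝ} (hp : IsP p) {f : Ω → ℝ} (h : ∀ x, 0 ≤ f x) : 0 ≤ pm p f :=
  Finset.sum_nonneg fun x _ => mul_nonneg (hp.1 x) (h x)

lemma pm_abs_le {p : Ω → ℝ} (hp : IsP p) {f : Ω → ℝ} {K : ℝ} (h : ∀ x, |f x| ≤ K) : |pm p f| ≤ K := by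
  rw [abs_le]
  constructor
  · rw [← pm_const hp (-K)]; exact pm_le hp fun x => (abs_le.1 (h x)).1
  · rw [← pm_const hp K]; exact pm_le hp fun x => (abs_le.1 (h x)).2

lemma pm_sq_le {p : Ω → ℝ} (hp : IsP p) (f : Ω → ℝ) : pm p f ^ 2 ≤ pm p (fun x => f x ^ 2) := by
  have h : 0 ≤ pm p (fun x => (f x - pm p f) ^ 2) := pm_nonneg hp fun x => sq_nonneg _
  have e : (fun x => (f x - pm p f) ^ 2)
      = fun x => (f x ^ 2 - (2 * pm p f) * f x) + pm p f ^ 2 := by funext x; ring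
  rw [e, pm_add, pm_sub, pm_smul, pm_const hp] at h
  linarith [h, sq (pm p f)]

lemma tame_Zc (p : Ω → ℝ) (c : Ω → A → ℝ) : Tame (Zc p c) :=
  tame_sum _ fun x _ => (tame_el (c x)).const_mul (p x)

lemma tame_Nc (p : Ω → ℝ) (c : Ω → A → ℝ) (f : Ω → ℝ) : Tame (Nc p c f) :=
  tame_sum _ fun x _ => (tame_el (c x)).const_mul (p x * f x)

lemma inv_el (b Y : A → ℝ) : (el b Y)⁻¹ = Real.exp (∑ a, (-b a) * Y a + (∑ a, b a ^ 2) / 2) := by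
  rw [el, ← Real.exp_neg]; congr 1; simp; ring

lemma tame_inv_el (b : A → ℝ) : Tame (fun Y => (el b Y)⁻¹) := by
  simp_rw [inv_el]; exact tame_expLin _ _

lemma inv_Zc_le {p : Ω → ℝ} (hp : IsP p) (c : Ω → A → ℝ) (Y : A → ℝ) :
    (Zc p c Y)⁻¹ ≤ ∑ x, p x * (el (c x) Y)⁻¹ := by
  have hZ := Zc_pos hp c Y
  have key : 1 ≤ Zc p c Y * ∑ x, p x * (el (c x) Y)⁻¹ := by
    have h1 : ∀ x, p x * (2 * (Zc p c Y)⁻¹) - p x * el (c x) Y * ((Zc p c Y)⁻¹) ^ 2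
        ≤ p x * (el (c x) Y)⁻¹ := by
      intro x
      have he := el_pos (c x) Y
      have : 2 * (Zc p c Y)⁻¹ - el (c x) Y * ((Zc p c Y)⁻¹) ^ 2 ≤ (el (c x) Y)⁻¹ := by
        have : 0 ≤ el (c x) Y * ((el (c x) Y)⁻¹ - (Zc p c Y)⁻¹) ^ 2 := by positivity
        have e : el (c x) Y * ((el (c x) Y)⁻¹ - (Zc p c Y)⁻¹) ^ 2
            = (el (c x) Y)⁻¹ - 2 * (Zc p c Y)⁻¹ + el (c x) Y * ((Zc p c Y)⁻¹) ^ 2 := by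
          field_simp; ring
        linarith
      have := mul_le_mul_of_nonneg_left this (hp.1 x)
      linarith
    have h2 := Finset.sum_le_sum (s := Finset.univ) fun x _ => h1 x
    rw [Finset.sum_sub_distrib, ← Finset.sum_mul, ← Finset.sum_mul, hp.2] at h2
    change _ - Zc p c Y * _ ≤ _ at h2
    have h3 : 1 * (2 * (Zc p c Y)⁻¹) - Zc p c Y * (Zc p c Y)⁻¹ ^ 2 = (Zc p c Y)⁻¹ := by
      field_simp; ring
    rw [h3] at h2
    calc (1:ℝ) = Zc p c Y * (Zc p c Y)⁻¹ := by field_simp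
      _ ≤ _ := by gcongr
  rw [inv_le_iff_one_le_mul₀ hZ]
  linarith

lemma tame_inv_Zc {p : Ω → ℝ} (hp : IsP p) (c : Ω → A → ℝ) : Tame (fun Y => (Zc p c Y)⁻¹) := by
  have h : Tame (fun Y => ∑ x, p x * (el (c x) Y)⁻¹) :=
    tame_sum _ fun x _ => (tame_inv_el (c x)).const_mul (p x)
  refine h.of_le (tame_Zc p c).1.inv fun Y => ?_
  rw [abs_of_pos (inv_pos.2 (Zc_pos hp c Y))]
  exact (inv_Zc_le hp c Y).trans (le_abs_self _)

lemma tame_ovI {p : Ω → ℝ} (hp : IsP p) (c : Ω → A → ℝ) (f : Ω → ℝ) :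
    Tame (fun Y => Nc p c f Y ^ 2 / Zc p c Y) := by
  simp_rw [div_eq_mul_inv]
  exact ((tame_Nc p c f).pow 2).mul (tame_inv_Zc hp c)

lemma tame_logZ {p : Ω → ℝ} (hp : IsP p) (c : Ω → A → ℝ) : Tame (fun Y => Real.log (Zc p c Y)) := by
  refine ((tame_Zc p c).add (tame_inv_Zc hp c)).of_le (tame_Zc p c).1.log fun Y => ?_
  have hZ := Zc_pos hp c Y
  have h1 := Real.log_le_sub_one_of_pos hZ
  have h2 := Real.log_le_sub_one_of_pos (inv_pos.2 hZ)
  rw [Real.log_inv] at h2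
  have := inv_pos.2 hZ
  rw [abs_of_pos (by positivity : 0 < Zc p c Y + (Zc p c Y)⁻¹), abs_le]
  constructor <;> linarith

lemma tame_ZlogZ {p : Ω → ℝ} (hp : IsP p) (c : Ω → A → ℝ) :
    Tame (fun Y => Zc p c Y * Real.log (Zc p c Y)) := (tame_Zc p c).mul (tame_logZ hp c)

lemma isP_post {p : Ω → ℝ} (hp : IsP p) (c : Ω → A → ℝ) (Y : A → ℝ) : IsP (post p c Y) := by
  have hZ := Zc_pos hp c Y
  refine ⟨fun x => div_nonneg (mul_nonneg (hp.1 x) (el_pos _ _).le) hZ.le, ?_⟩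
  simp only [post]
  rw [← Finset.sum_div]
  exact div_self hZ.ne'

lemma pm_post (p : Ω → ℝ) (c : Ω → A → ℝ) (Y : A → ℝ) (f : Ω → ℝ) :
    pm (post p c Y) f = Nc p c f Y / Zc p c Y := by
  simp only [pm, post, Nc, Finset.sum_div]
  exact Finset.sum_congr rfl fun x _ => by ring

lemma Z_mul_pm_post {p : Ω → ℝ} (hp : IsP p) (c : Ω → A → ℝ) (Y : A → ℝ) (f : Ω → ℝ) :
    Zc p c Y * pm (post p c Y) f = Nc p c f Y := by
  rw [pm_post]; field_simp [(Zc_pos hp c Y).ne']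

lemma ovI_eq {p : Ω → ℝ} (hp : IsP p) (c : Ω → A → ℝ) (Y : A → ℝ) (f : Ω → ℝ) :
    Nc p c f Y ^ 2 / Zc p c Y = Zc p c Y * pm (post p c Y) f ^ 2 := by
  rw [pm_post]; field_simp [(Zc_pos hp c Y).ne']

lemma integral_Nc (p : Ω → ℝ) (c : Ω → A → ℝ) (f : Ω → ℝ) : ∫ Y, Nc p c f Y ∂(gam A) = pm p f := by
  simp only [Nc]
  rw [integral_finsetSum _ fun x _ => ((tame_el (c x)).const_mul (p x * f x)).integrable]
  simp_rw [integral_const_mul, integral_el, mul_one]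
  rfl

lemma integral_Zc {p : Ω → ℝ} (hp : IsP p) (c : Ω → A → ℝ) : ∫ Y, Zc p c Y ∂(gam A) = 1 := by
  have := integral_Nc p c (fun _ => 1)
  simpa [Nc, pm, Zc, hp.2] using this

/-- Planted representation. -/
lemma integral_planted (p : Ω → ℝ) (c : Ω → A → ℝ) {H : (A → ℝ) → ℝ} (hH : Tame H) :
    ∫ Y, Zc p c Y * H Y ∂(gam A) = ∑ x, p x * ∫ Y, H (Y + c x) ∂(gam A) := by
  have : ∀ Y, Zc p c Y * H Y = ∑ x, p x * (el (c x) Y * H Y) := by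
    intro Y; rw [Zc, Finset.sum_mul]; exact Finset.sum_congr rfl fun x _ => by ring
  simp_rw [this]
  rw [integral_finsetSum _ fun x _ => (((tame_el (c x)).mul hH).const_mul (p x)).integrable]
  refine Finset.sum_congr rfl fun x _ => ?_
  rw [integral_const_mul, integral_shift _ _ hH.1]

lemma integral_Nc_mul (p : Ω → ℝ) (c : Ω → A → ℝ) (f : Ω → ℝ) {H : (A → ℝ) → ℝ} (hH : Tame H) :
    ∫ Y, Nc p c f Y * H Y ∂(gam A) = ∑ x, p x * f x * ∫ Y, H (Y + c x) ∂(gam A) :=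
  integral_planted (fun x => p x * f x) c hH

/-- Gram lemma for likelihoods. -/
lemma gram_el (c : Ω → A → ℝ) (c' : Ω → B → ℝ)
    (h : ∀ x y, ∑ a, c x a * c y a = ∑ b, c' x b * c' y b)
    (G : (Ω → ℝ) → ℝ) (hG : Measurable G) :
    ∫ Y, G (fun x => el (c x) Y) ∂(gam A) = ∫ Y, G (fun x => el (c' x) Y) ∂(gam B) := by
  have e : ∀ x, ∑ a, c x a ^ 2 = ∑ b, c' x b ^ 2 := by intro x; simpa [sq] using h x x
  have := gram_integral c c' h (fun v => G fun x => Real.exp (v x - (∑ a, c x a ^ 2) / 2))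
    (hG.comp (by fun_prop))
  simp only [lin] at this
  simp only [el]
  rw [this]
  simp_rw [e]

lemma ov_gram (p : Ω → ℝ) (c : Ω → A → ℝ) (c' : Ω → B → ℝ)
    (h : ∀ x y, ∑ a, c x a * c y a = ∑ b, c' x b * c' y b) (f : Ω → ℝ) :
    ov p c f = ov p c' f :=
  gram_el c c' h (fun v => (∑ x, p x * f x * v x) ^ 2 / ∑ x, p x * v x) (by fun_prop)

lemma Phi_gram (p : Ω → ℝ) (c : Ω → A → ℝ) (c' : Ω → B → ℝ)
    (h : ∀ x y, ∑ a, c x a * c y a = ∑ b, c' x b * c' y b) :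
    Phi p c = Phi p c' :=
  gram_el c c' h (fun v => (∑ x, p x * v x) * Real.log (∑ x, p x * v x)) (by fun_prop)

/-- Adding a channel. -/
def cd (c : Ω → A → ℝ) (d : Ω → B → ℝ) (x : Ω) : A ⊕ B → ℝ := Sum.elim (c x) (d x)

lemma el_cd (c : Ω → A → ℝ) (d : Ω → B → ℝ) (x : Ω) (Y : A → ℝ) (W : B → ℝ) :
    el (cd c d x) (Sum.elim Y W) = el (c x) Y * el (d x) W := by
  simp only [el, cd, Fintype.sum_sum_type, Sum.elim_inl, Sum.elim_inr]
  rw [← Real.exp_add]; congr 1; ring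

lemma Zc_cd {p : Ω → ℝ} (hp : IsP p) (c : Ω → A → ℝ) (d : Ω → B → ℝ) (Y : A → ℝ) (W : B → ℝ) :
    Zc p (cd c d) (Sum.elim Y W) = Zc p c Y * Zc (post p c Y) d W := by
  have hZ := Zc_pos hp c Y
  simp only [Zc, post, Finset.mul_sum, el_cd]
  refine Finset.sum_congr rfl fun x _ => ?_
  change _ = Zc p c Y * (p x * el (c x) Y / Zc p c Y * el (d x) W)
  field_simp

lemma Nc_cd {p : Ω → ℝ} (hp : IsP p) (c : Ω → A → ℝ) (d : Ω → B → ℝ) (f : Ω → ℝ) (Y : A → ℝ)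
    (W : B → ℝ) :
    Nc p (cd c d) f (Sum.elim Y W) = Zc p c Y * Nc (post p c Y) d f W := by
  have hZ := Zc_pos hp c Y
  simp only [Nc, post, Finset.mul_sum, el_cd]
  refine Finset.sum_congr rfl fun x _ => ?_
  field_simp

lemma chain_eq {p : Ω → ℝ} (hp : IsP p) (c : Ω → A → ℝ) (d : Ω → B → ℝ) (f : Ω → ℝ) (Y : A → ℝ) :
    ∫ W, Nc p (cd c d) f (Sum.elim Y W) ^ 2 / Zc p (cd c d) (Sum.elim Y W) ∂(gam B)
      = Zc p c Y * ov (post p c Y) d f := by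
  have hZ := Zc_pos hp c Y
  rw [ov, ← integral_const_mul]
  congr 1; funext W
  rw [Zc_cd hp, Nc_cd hp]
  have := Zc_pos (isP_post hp c Y) d W
  field_simp

lemma tame_Z_ov_post {p : Ω → ℝ} (hp : IsP p) (c : Ω → A → ℝ) (d : Ω → B → ℝ) (f : Ω → ℝ) :
    Tame (fun Y => Zc p c Y * ov (post p c Y) d f) := by
  have := (tame_ovI hp (cd c d) f).integral_left
  simpa only [chain_eq hp] using this

lemma ov_chain {p : Ω → ℝ} (hp : IsP p) (c : Ω → A → ℝ) (d : Ω → B → ℝ) (f : Ω → ℝ) :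
    ov p (cd c d) f = ∫ Y, Zc p c Y * ov (post p c Y) d f ∂(gam A) := by
  rw [ov, integral_sumElim (tame_ovI hp (cd c d) f)]
  simp only [chain_eq hp]

lemma Phi_chain_eq {p : Ω → ℝ} (hp : IsP p) (c : Ω → A → ℝ) (d : Ω → B → ℝ) (Y : A → ℝ) :
    ∫ W, Zc p (cd c d) (Sum.elim Y W) * Real.log (Zc p (cd c d) (Sum.elim Y W)) ∂(gam B)
      = Zc p c Y * Real.log (Zc p c Y) + Zc p c Y * Phi (post p c Y) d := by
  have hZ := Zc_pos hp c Y
  have hq := isP_post hp c Y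
  have e : ∀ W, Zc p (cd c d) (Sum.elim Y W) * Real.log (Zc p (cd c d) (Sum.elim Y W))
      = (Zc p c Y * Real.log (Zc p c Y)) * Zc (post p c Y) d W
        + Zc p c Y * (Zc (post p c Y) d W * Real.log (Zc (post p c Y) d W)) := by
    intro W
    rw [Zc_cd hp, Real.log_mul hZ.ne' (Zc_pos hq d W).ne']
    ring
  simp_rw [e]
  rw [integral_add ((tame_Zc _ d).integrable.const_mul _) ((tame_ZlogZ hq d).integrable.const_mul _),
    integral_const_mul, integral_const_mul, integral_Zc hq, mul_one]
  rfl

lemma tame_Z_Phi_post {p : Ω → ℝ} (hp : IsP p) (c : Ω → A → ℝ) (d : Ω → B → ℝ) :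
    Tame (fun Y => Zc p c Y * Phi (post p c Y) d) := by
  have := ((tame_ZlogZ hp (cd c d)).integral_left).sub (tame_ZlogZ hp c)
  simpa only [Phi_chain_eq hp, add_sub_cancel_left] using this

lemma Phi_chain {p : Ω → ℝ} (hp : IsP p) (c : Ω → A → ℝ) (d : Ω → B → ℝ) :
    Phi p (cd c d) = Phi p c + ∫ Y, Zc p c Y * Phi (post p c Y) d ∂(gam A) := by
  rw [Phi, integral_sumElim (tame_ZlogZ hp (cd c d))]
  simp only [Phi_chain_eq hp]
  rw [integral_add (tame_ZlogZ hp c).integrable (tame_Z_Phi_post hp c d).integrable]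
  rfl

end
end BM
end

noncomputable section
set_option linter.unusedSectionVars false
set_option linter.unusedVariables false
namespace BM
section
variable {Ω A B : Type} [Fintype Ω] [Fintype A] [Fintype B]

lemma ov_nonneg {p : Ω → ℝ} (hp : IsP p) (c : Ω → A → ℝ) (f : Ω → ℝ) : 0 ≤ ov p c f :=
  integral_nonneg fun Y => div_nonneg (sq_nonneg _) (Zc_pos hp c Y).le

lemma Nc_sub_const (p : Ω → ℝ) (c : Ω → A → ℝ) (f : Ω → ℝ) (r : ℝ) (Y : A → ℝ) :
    Nc p c (fun x => f x - r) Y = Nc p c f Y - r * Zc p c Y := by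
  simp only [Nc, Zc, Finset.mul_sum]
  rw [← Finset.sum_sub_distrib]
  exact Finset.sum_congr rfl fun x _ => by ring

lemma ov_sub_const {p : Ω → ℝ} (hp : IsP p) (c : Ω → A → ℝ) (f : Ω → ℝ) (r : ℝ) :
    ov p c (fun x => f x - r) = ov p c f - 2 * r * pm p f + r ^ 2 := by
  have e : ∀ Y, Nc p c (fun x => f x - r) Y ^ 2 / Zc p c Y
      = Nc p c f Y ^ 2 / Zc p c Y - 2 * r * Nc p c f Y + r ^ 2 * Zc p c Y := by
    intro Y
    have := (Zc_pos hp c Y).ne'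
    rw [Nc_sub_const]; field_simp; ring
  rw [ov]
  simp_rw [e]
  rw [integral_add (((tame_ovI hp c f).sub ((tame_Nc p c f).const_mul (2 * r))).integrable)
    ((tame_Zc p c).const_mul (r ^ 2)).integrable,
    integral_sub (tame_ovI hp c f).integrable ((tame_Nc p c f).const_mul (2 * r)).integrable,
    integral_const_mul, integral_const_mul, integral_Nc, integral_Zc hp, mul_one]
  rfl

lemma sq_le_ov {p : Ω → ℝ} (hp : IsP p) (c : Ω → A → ℝ) (f : Ω → ℝ) : pm p f ^ 2 ≤ ov p c f := by
  have h1 := ov_sub_const hp c f (pm p f)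
  have h2 := ov_nonneg hp c (fun x => f x - pm p f)
  nlinarith

lemma ov_le {p : Ω → ℝ} (hp : IsP p) (c : Ω → A → ℝ) (f : Ω → ℝ) :
    ov p c f ≤ pm p (fun x => f x ^ 2) := by
  rw [← integral_Nc p c]
  refine integral_mono (tame_ovI hp c f).integrable (tame_Nc p c _).integrable fun Y => ?_
  simp only
  rw [ovI_eq hp, ← Z_mul_pm_post hp]
  exact mul_le_mul_of_nonneg_left (pm_sq_le (isP_post hp c Y) f) (Zc_pos hp c Y).le

lemma ov_le_sq {p : Ω → ℝ} (hp : IsP p) (c : Ω → A → ℝ) {f : Ω → ℝ} {K : ℝ} (h : ∀ x, |f x| ≤ K) :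
    ov p c f ≤ K ^ 2 := by
  refine (ov_le hp c f).trans ?_
  rw [← pm_const hp (K ^ 2)]
  exact pm_le hp fun x => sq_le_sq' (abs_le.1 (h x)).1 (abs_le.1 (h x)).2

lemma ov_le_cd {p : Ω → ℝ} (hp : IsP p) (c : Ω → A → ℝ) (d : Ω → B → ℝ) (f : Ω → ℝ) :
    ov p c f ≤ ov p (cd c d) f := by
  rw [ov_chain hp]
  refine integral_mono (tame_ovI hp c f).integrable (tame_Z_ov_post hp c d f).integrable fun Y => ?_
  simp only
  rw [ovI_eq hp]
  exact mul_le_mul_of_nonneg_left (sq_le_ov (isP_post hp c Y) d f) (Zc_pos hp c Y).le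

lemma integral_lin (α : A → ℝ) : ∫ Y, ∑ a, α a * Y a ∂(gam A) = 0 := by
  have h1 := integral_affine_sq α 1
  have h0 := integral_affine_sq α 0
  have t : Tame (fun Y : A → ℝ => ∑ a, α a * Y a) := by simpa using tame_lin α 0
  have e : ∀ Y : A → ℝ, (∑ a, α a * Y a + 1) ^ 2
      = ((∑ a, α a * Y a + 0) ^ 2 + 2 * ∑ a, α a * Y a) + 1 := by intro Y; ring
  simp_rw [e] at h1
  have t2 : Tame (fun Y : A → ℝ => (∑ a, α a * Y a + 0) ^ 2) := (tame_lin α 0).pow 2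
  rw [integral_add (t2.add (t.const_mul 2)).integrable (integrable_const _),
    integral_add t2.integrable (t.const_mul 2).integrable, h0, integral_const_mul] at h1
  simp at h1
  linarith

lemma integral_el_lin (b α : A → ℝ) (r : ℝ) :
    ∫ Y, el b Y * (∑ a, α a * Y a + r) ∂(gam A) = ∑ a, α a * b a + r := by
  rw [integral_shift b _ (tame_lin α r).1]
  have e : ∀ Y : A → ℝ, ∑ a, α a * (Y + b) a + r = ∑ a, α a * Y a + (∑ a, α a * b a + r) := by
    intro Y; simp [mul_add, Finset.sum_add_distrib]; ring
  simp_rw [e]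
  have t : Tame (fun Y : A → ℝ => ∑ a, α a * Y a) := by simpa using tame_lin α 0
  rw [integral_add t.integrable (integrable_const _), integral_lin]
  simp

lemma integral_Zc_lin {p : Ω → ℝ} (hp : IsP p) (c : Ω → A → ℝ) (α : A → ℝ) (r : ℝ) :
    ∫ Y, Zc p c Y * (∑ a, α a * Y a + r) ∂(gam A) = ∑ a, α a * pm p (fun x => c x a) + r := by
  have : ∀ Y : A → ℝ, Zc p c Y * (∑ a, α a * Y a + r)
      = ∑ x, p x * (el (c x) Y * (∑ a, α a * Y a + r)) := by
    intro Y; rw [Zc, Finset.sum_mul]; exact Finset.sum_congr rfl fun x _ => by ring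
  simp_rw [this]
  rw [integral_finsetSum _ fun x _ => (((tame_el (c x)).mul (tame_lin α r)).const_mul (p x)).integrable]
  simp_rw [integral_const_mul, integral_el_lin, mul_add, Finset.sum_add_distrib, ← Finset.sum_mul,
    hp.2, one_mul]
  congr 1
  simp only [pm, Finset.mul_sum]
  rw [Finset.sum_comm]
  exact Finset.sum_congr rfl fun a _ => Finset.sum_congr rfl fun x _ => by ring

lemma log_el (b Y : A → ℝ) : Real.log (el b Y) = ∑ a, b a * Y a + -((∑ a, b a ^ 2) / 2) := by
  rw [el, Real.log_exp]; ring

/-- Lower bound on the free energy. -/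
lemma Phi_ge {p : Ω → ℝ} (hp : IsP p) (c : Ω → A → ℝ) :
    (∑ a, pm p (fun x => c x a) ^ 2) / 2 ≤ Phi p c := by
  set m : A → ℝ := fun a => pm p (fun x => c x a) with hm
  have h1 : ∀ Y, Zc p c Y * (∑ a, m a * Y a + -((∑ a, m a ^ 2) / 2)) + (Zc p c Y - el m Y)
      ≤ Zc p c Y * Real.log (Zc p c Y) := by
    intro Y
    have hZ := Zc_pos hp c Y
    have hl := el_pos m Y
    rw [← log_el]
    have h := Real.log_le_sub_one_of_pos (div_pos hl hZ)
    rw [Real.log_div hl.ne' hZ.ne'] at h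
    have := mul_le_mul_of_nonneg_left h hZ.le
    have e : Zc p c Y * (el m Y / Zc p c Y - 1) = el m Y - Zc p c Y := by field_simp
    rw [e] at this
    linarith
  have t1 : Tame (fun Y => Zc p c Y * (∑ a, m a * Y a + -((∑ a, m a ^ 2) / 2))) :=
    (tame_Zc p c).mul (tame_lin _ _)
  have t2 : Tame (fun Y => Zc p c Y - el m Y) := (tame_Zc p c).sub (tame_el m)
  have h2 := integral_mono (t1.add t2).integrable (tame_ZlogZ hp c).integrable h1
  rw [integral_add t1.integrable t2.integrable, integral_Zc_lin hp,
    integral_sub (tame_Zc p c).integrable (tame_el m).integrable, integral_Zc hp, integral_el] at h2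
  have e : ∑ a, m a * pm p (fun x => c x a) = ∑ a, m a ^ 2 :=
    Finset.sum_congr rfl fun a _ => by rw [sq]
  rw [e] at h2
  change _ ≤ Phi p c at h2
  linarith

lemma Phi_nonneg {p : Ω → ℝ} (hp : IsP p) (c : Ω → A → ℝ) : 0 ≤ Phi p c :=
  le_trans (div_nonneg (Finset.sum_nonneg fun _ _ => sq_nonneg _) (by norm_num)) (Phi_ge hp c)

lemma integral_el_el_div (a b m : A → ℝ) :
    ∫ Y, el a Y * el b Y * (el m Y)⁻¹ ∂(gam A) = Real.exp (∑ i, (a i - m i) * (b i - m i)) := by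
  have e : ∀ Y, el a Y * el b Y * (el m Y)⁻¹
      = Real.exp (∑ i, (a i - m i) * (b i - m i)) * el (fun i => a i + b i - m i) Y := by
    intro Y
    rw [inv_el, el, el, el, ← Real.exp_add, ← Real.exp_add, ← Real.exp_add]
    congr 1
    simp only [Finset.sum_div, ← Finset.sum_add_distrib, ← Finset.sum_sub_distrib]
    refine Finset.sum_congr rfl fun i _ => ?_
    ring
  simp_rw [e]
  rw [integral_const_mul, integral_el, mul_one]

lemma integral_el_el (a b : A → ℝ) :
    ∫ Y, el a Y * el b Y ∂(gam A) = Real.exp (∑ i, a i * b i) := by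
  have := integral_el_el_div a b 0
  simpa [el] using this

/-- Chi-square upper bound on the free energy. -/
lemma Phi_le_chi {p : Ω → ℝ} (hp : IsP p) (c : Ω → A → ℝ) (m : A → ℝ)
    (hm : ∀ a, m a = pm p (fun x => c x a)) :
    Phi p c ≤ (∑ a, m a ^ 2) / 2
      + (∑ x, ∑ y, p x * p y * Real.exp (∑ a, (c x a - m a) * (c y a - m a)) - 1) := by
  have h1 : ∀ Y, Zc p c Y * Real.log (Zc p c Y)
      ≤ Zc p c Y * (∑ a, m a * Y a + -((∑ a, m a ^ 2) / 2))
        + (Zc p c Y * Zc p c Y * (el m Y)⁻¹ - Zc p c Y) := by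
    intro Y
    have hZ := Zc_pos hp c Y
    have hl := el_pos m Y
    rw [← log_el]
    have h := Real.log_le_sub_one_of_pos (div_pos hZ hl)
    rw [Real.log_div hZ.ne' hl.ne'] at h
    have := mul_le_mul_of_nonneg_left h hZ.le
    have e : Zc p c Y * (Zc p c Y / el m Y - 1) = Zc p c Y * Zc p c Y * (el m Y)⁻¹ - Zc p c Y := by
      field_simp
    rw [e] at this
    linarith
  have t1 : Tame (fun Y => Zc p c Y * (∑ a, m a * Y a + -((∑ a, m a ^ 2) / 2))) :=
    (tame_Zc p c).mul (tame_lin _ _)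
  have t2 : Tame (fun Y => Zc p c Y * Zc p c Y * (el m Y)⁻¹) :=
    ((tame_Zc p c).mul (tame_Zc p c)).mul (tame_inv_el m)
  have h2 := integral_mono (tame_ZlogZ hp c).integrable (t1.add (t2.sub (tame_Zc p c))).integrable h1
  rw [integral_add t1.integrable (t2.sub (tame_Zc p c)).integrable, integral_Zc_lin hp,
    integral_sub t2.integrable (tame_Zc p c).integrable, integral_Zc hp] at h2
  have e : ∑ a, m a * pm p (fun x => c x a) = ∑ a, m a ^ 2 :=
    Finset.sum_congr rfl fun a _ => by rw [sq, ← hm a]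
  have e2 : ∫ Y, Zc p c Y * Zc p c Y * (el m Y)⁻¹ ∂(gam A)
      = ∑ x, ∑ y, p x * p y * Real.exp (∑ a, (c x a - m a) * (c y a - m a)) := by
    have : ∀ Y, Zc p c Y * Zc p c Y * (el m Y)⁻¹
        = ∑ x, ∑ y, p x * p y * (el (c x) Y * el (c y) Y * (el m Y)⁻¹) := by
      intro Y
      rw [Zc, Finset.sum_mul_sum, Finset.sum_mul]
      refine Finset.sum_congr rfl fun x _ => ?_
      rw [Finset.sum_mul]
      exact Finset.sum_congr rfl fun y _ => by ring
    simp_rw [this]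
    have t : ∀ x y, Tame (fun Y => p x * p y * (el (c x) Y * el (c y) Y * (el m Y)⁻¹)) := fun x y =>
      (((tame_el _).mul (tame_el _)).mul (tame_inv_el m)).const_mul _
    rw [integral_finsetSum _ fun x _ => (tame_sum _ fun y _ => t x y).integrable]
    refine Finset.sum_congr rfl fun x _ => ?_
    rw [integral_finsetSum _ fun y _ => (t x y).integrable]
    refine Finset.sum_congr rfl fun y _ => ?_
    rw [integral_const_mul, integral_el_el_div]
  rw [e, e2] at h2
  change Phi p c ≤ _ at h2
  linarith

/-- Entropy lower bound. -/
lemma Phi_ge_entropy {p : Ω → ℝ} (hp : IsP p) (c : Ω → A → ℝ) :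
    ∑ x, p x * Real.log (p x) + pm p (fun x => ∑ a, c x a ^ 2) / 2 ≤ Phi p c := by
  have h1 : ∀ Y, ∑ x, p x * (el (c x) Y * (∑ a, c x a * Y a + (Real.log (p x) - (∑ a, c x a ^ 2) / 2)))
      ≤ Zc p c Y * Real.log (Zc p c Y) := by
    intro Y
    have hZ := Zc_pos hp c Y
    conv_rhs => rw [Zc, Finset.sum_mul]
    refine Finset.sum_le_sum fun x _ => ?_
    rcases (hp.1 x).eq_or_lt with h | h
    · simp [← h]
    · rw [mul_assoc]
      refine mul_le_mul_of_nonneg_left (mul_le_mul_of_nonneg_left ?_ (el_pos _ _).le) h.le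
      have h3 : p x * el (c x) Y ≤ Zc p c Y :=
        Finset.single_le_sum (f := fun x => p x * el (c x) Y)
          (fun x _ => mul_nonneg (hp.1 x) (el_pos _ _).le) (Finset.mem_univ x)
      have h4 := Real.log_le_log (mul_pos h (el_pos _ _)) h3
      rw [Real.log_mul h.ne' (el_pos _ _).ne', log_el] at h4
      change _ ≤ Real.log (Zc p c Y)
      linarith
  have t : ∀ x, Tame (fun Y => p x * (el (c x) Y * (∑ a, c x a * Y a
      + (Real.log (p x) - (∑ a, c x a ^ 2) / 2)))) := fun x =>
    ((tame_el _).mul (tame_lin _ _)).const_mul _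
  have h2 := integral_mono (tame_sum _ fun x _ => t x).integrable (tame_ZlogZ hp c).integrable h1
  rw [integral_finsetSum _ fun x _ => (t x).integrable] at h2
  simp_rw [integral_const_mul, integral_el_lin] at h2
  change _ ≤ Phi p c at h2
  refine le_trans (le_of_eq ?_) h2
  rw [pm, Finset.sum_div, ← Finset.sum_add_distrib]
  refine Finset.sum_congr rfl fun x _ => ?_
  simp_rw [← sq]
  ring

end
end BM
end

noncomputable section
set_option linter.unusedSectionVars false
set_option linter.unusedVariables false
namespace BM
section
variable {Ω A B : Type} [Fintype Ω] [Fintype A] [Fintype B]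

/-- Mesh lemma. -/
lemma mesh_le {g : ℝ → ℝ} {a b M C η₀ : ℝ} (hab : a ≤ b) (hη₀ : 0 < η₀) (hC : 0 ≤ C)
    (h : ∀ t η, a ≤ t → 0 < η → η ≤ η₀ → t + η ≤ b → g (t + η) - g t ≤ η * M + C * η ^ 2) :
    g b - g a ≤ (b - a) * M := by
  rcases hab.eq_or_lt with rfl | hab'
  · simp
  have hL : 0 < b - a := by linarith
  have key : ∀ N : ℕ, 0 < N → (b - a) / N ≤ η₀ → g b - g a ≤ (b - a) * M + C * (b - a) ^ 2 / N := by
    intro N hN hNη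
    have hNr : (0:ℝ) < N := by exact_mod_cast hN
    set η := (b - a) / N with hη
    have hηp : 0 < η := div_pos hL hNr
    have hstep : ∀ k : ℕ, k ≤ N → g (a + k * η) - g a ≤ k * (η * M + C * η ^ 2) := by
      intro k
      induction k with
      | zero => intro _; simp
      | succ k ih =>
        intro hk
        have h1 := ih (by omega)
        have hkr : ((k : ℝ) + 1) ≤ N := by exact_mod_cast hk
        have hb : a + k * η + η ≤ b := by
          have : (k + 1) * η ≤ N * η := by gcongr
          have e : N * η = b - a := by rw [hη]; field_simp
          linarith
        have h2 := h (a + k * η) η (by have : (0:ℝ) ≤ k * η := by positivity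
                                       linarith) hηp hNη hb
        push_cast
        have e : a + ((k:ℝ) + 1) * η = a + k * η + η := by ring
        rw [e]; linarith
    have h3 := hstep N le_rfl
    have e : N * η = b - a := by rw [hη]; field_simp
    have e2 : N * (η * M + C * η ^ 2) = (b - a) * M + C * (b - a) ^ 2 / N := by
      rw [hη]; field_simp
    rw [e2, e] at h3
    simpa using h3
  have hlim : Tendsto (fun N : ℕ => (b - a) * M + C * (b - a) ^ 2 / N) atTop (𝓝 ((b - a) * M + 0)) :=
    tendsto_const_nhds.add (tendsto_const_div_atTop_nhds_zero_nat _)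
  rw [add_zero] at hlim
  refine ge_of_tendsto hlim ?_
  have hlim2 := (tendsto_const_div_atTop_nhds_zero_nat (b - a)).eventually (gt_mem_nhds hη₀)
  filter_upwards [hlim2, eventually_gt_atTop 0] with N h1 h2
  exact key N h2 h1.le

/-- Scaled channel. -/
def sc (t : ℝ) (d : Ω → B → ℝ) (x : Ω) (b : B) : ℝ := Real.sqrt t * d x b

lemma sc_gram {t : ℝ} (ht : 0 ≤ t) (d : Ω → B → ℝ) (x y : Ω) :
    ∑ b, sc t d x b * sc t d y b = t * ∑ b, d x b * d y b := by
  simp only [sc, Finset.mul_sum]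
  refine Finset.sum_congr rfl fun b _ => ?_
  calc _ = (Real.sqrt t * Real.sqrt t) * (d x b * d y b) := by ring
    _ = _ := by rw [Real.mul_self_sqrt ht]

lemma cd_gram (c : Ω → A → ℝ) (d : Ω → B → ℝ) (x y : Ω) :
    ∑ i, cd c d x i * cd c d y i = ∑ a, c x a * c y a + ∑ b, d x b * d y b := by
  simp [cd, Fintype.sum_sum_type]

lemma Phi_small {p : Ω → ℝ} (hp : IsP p) (d : Ω → B → ℝ) {K η : ℝ} (hK : ∀ x b, |d x b| ≤ K)
    (hη : 0 ≤ η) (hs : η * (4 * Fintype.card B * K ^ 2) ≤ 1) :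
    Phi p (sc η d) ≤ η * ((∑ b, pm p (fun x => d x b) ^ 2) / 2)
      + (4 * Fintype.card B * K ^ 2) ^ 2 * η ^ 2 := by
  set m : B → ℝ := fun b => pm p (fun x => d x b) with hm
  have h1 := Phi_le_chi hp (sc η d) (fun b => Real.sqrt η * m b) (fun b => by
    rw [hm]; simp only [sc]; rw [pm_smul])
  have e1 : ∑ b, (Real.sqrt η * m b) ^ 2 = η * ∑ b, m b ^ 2 := by
    rw [Finset.mul_sum]; exact Finset.sum_congr rfl fun b _ => by rw [mul_pow, Real.sq_sqrt hη]
  have e2 : ∀ x y, ∑ b, (sc η d x b - Real.sqrt η * m b) * (sc η d y b - Real.sqrt η * m b)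
      = η * ∑ b, (d x b - m b) * (d y b - m b) := by
    intro x y
    rw [Finset.mul_sum]
    refine Finset.sum_congr rfl fun b _ => ?_
    simp only [sc]
    calc _ = (Real.sqrt η * Real.sqrt η) * ((d x b - m b) * (d y b - m b)) := by ring
      _ = _ := by rw [Real.mul_self_sqrt hη]
  simp_rw [e1, e2] at h1
  set τ : Ω → Ω → ℝ := fun x y => ∑ b, (d x b - m b) * (d y b - m b) with hτ
  have hmK : ∀ b, |m b| ≤ K := fun b => pm_abs_le hp fun x => hK x b
  have hτb : ∀ x y, |τ x y| ≤ 4 * Fintype.card B * K ^ 2 := by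
    intro x y
    calc |τ x y| ≤ ∑ b, |(d x b - m b) * (d y b - m b)| := Finset.abs_sum_le_sum_abs _ _
      _ ≤ ∑ b : B, 4 * K ^ 2 := by
        refine Finset.sum_le_sum fun b _ => ?_
        rw [abs_mul]
        have a1 : |d x b - m b| ≤ 2 * K := (abs_sub _ _).trans (by linarith [hK x b, hmK b])
        have a2 : |d y b - m b| ≤ 2 * K := (abs_sub _ _).trans (by linarith [hK y b, hmK b])
        have := mul_le_mul a1 a2 (abs_nonneg _) ((abs_nonneg _).trans a1)
        linarith
      _ = _ := by simp; ring
  have hexp : ∀ x y, Real.exp (η * τ x y) ≤ 1 + η * τ x y + η ^ 2 * (4 * Fintype.card B * K ^ 2) ^ 2 := by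
    intro x y
    have hb : |η * τ x y| ≤ 1 := by
      rw [abs_mul, abs_of_nonneg hη]
      exact (mul_le_mul_of_nonneg_left (hτb x y) hη).trans hs
    have h2 := (abs_le.1 (Real.abs_exp_sub_one_sub_id_le hb)).2
    have h3 : (η * τ x y) ^ 2 ≤ η ^ 2 * (4 * Fintype.card B * K ^ 2) ^ 2 := by
      rw [mul_pow]
      exact mul_le_mul_of_nonneg_left (sq_le_sq' (abs_le.1 (hτb x y)).1 (abs_le.1 (hτb x y)).2)
        (sq_nonneg _)
    linarith
  have hsum : ∑ x, ∑ y, p x * p y * Real.exp (η * τ x y)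
      ≤ 1 + η ^ 2 * (4 * Fintype.card B * K ^ 2) ^ 2 := by
    calc ∑ x, ∑ y, p x * p y * Real.exp (η * τ x y)
        ≤ ∑ x, ∑ y, p x * p y * (1 + η * τ x y + η ^ 2 * (4 * Fintype.card B * K ^ 2) ^ 2) := by
          refine Finset.sum_le_sum fun x _ => Finset.sum_le_sum fun y _ => ?_
          exact mul_le_mul_of_nonneg_left (hexp x y) (mul_nonneg (hp.1 x) (hp.1 y))
      _ = (1 + η ^ 2 * (4 * Fintype.card B * K ^ 2) ^ 2) * ((∑ x, p x) * (∑ y, p y))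
          + η * ∑ x, ∑ y, p x * p y * τ x y := by
          rw [Finset.sum_mul_sum, Finset.mul_sum, Finset.mul_sum, ← Finset.sum_add_distrib]
          refine Finset.sum_congr rfl fun x _ => ?_
          rw [Finset.mul_sum, Finset.mul_sum, ← Finset.sum_add_distrib]
          exact Finset.sum_congr rfl fun y _ => by ring
      _ = _ := by
          have z : ∑ x, ∑ y, p x * p y * τ x y = 0 := by
            have e : ∑ x, ∑ y, p x * p y * τ x y
                = ∑ b, (∑ x, p x * (d x b - m b)) * (∑ y, p y * (d y b - m b)) := by
              simp_rw [Finset.sum_mul_sum]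
              rw [Finset.sum_comm (s := (Finset.univ : Finset B))]
              refine Finset.sum_congr rfl fun x _ => ?_
              rw [Finset.sum_comm]
              refine Finset.sum_congr rfl fun y _ => ?_
              rw [hτ, Finset.mul_sum]
              exact Finset.sum_congr rfl fun b _ => by ring
            rw [e]
            refine Finset.sum_eq_zero fun b _ => ?_
            have : ∑ x, p x * (d x b - m b) = 0 := by
              change pm p (fun x => d x b - m b) = 0
              rw [pm_sub, pm_const hp]; simp [hm]
            rw [this, zero_mul]
          rw [hp.2, z]; ring
  linarith

lemma bounded_of_fin (d : Ω → B → ℝ) : ∃ K, 0 ≤ K ∧ ∀ x b, |d x b| ≤ K := by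
  refine ⟨∑ x, ∑ b, |d x b|, by positivity, fun x b => ?_⟩
  refine le_trans ?_ (Finset.single_le_sum (f := fun x => ∑ b, |d x b|)
    (fun _ _ => by positivity) (Finset.mem_univ x))
  exact Finset.single_le_sum (f := fun b => |d x b|) (fun _ _ => abs_nonneg _) (Finset.mem_univ b)

lemma ov_sc_mono {p : Ω → ℝ} (hp : IsP p) (d : Ω → B → ℝ) (f : Ω → ℝ) {s t : ℝ} (hs : 0 ≤ s)
    (hst : s ≤ t) : ov p (sc s d) f ≤ ov p (sc t d) f := by
  rw [ov_gram p (sc t d) (cd (sc s d) (sc (t - s) d)) (fun x y => by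
    rw [cd_gram, sc_gram hs, sc_gram (by linarith), sc_gram (by linarith)]; ring)]
  exact ov_le_cd hp _ _ _

/-- Free energy is at most half the signal overlap. -/
lemma Phi_le_ov {p : Ω → ℝ} (hp : IsP p) (d : Ω → B → ℝ) :
    Phi p d ≤ (∑ b, ov p d (fun x => d x b)) / 2 := by
  obtain ⟨K, hK0, hK⟩ := bounded_of_fin d
  set C := 4 * Fintype.card B * K ^ 2 with hC
  have hC0 : 0 ≤ C := by positivity
  have main := mesh_le (g := fun t => Phi p (sc t d)) (a := 0) (b := 1)
    (M := (∑ b, ov p d (fun x => d x b)) / 2) (C := C ^ 2) (η₀ := 1 / (C + 1)) (by norm_num)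
    (by positivity) (by positivity) (by
      intro t η ht hη hη1 ht1
      have hη2 : η * C ≤ 1 := by
        calc η * C ≤ 1 / (C + 1) * (C + 1) := by gcongr; linarith
          _ = 1 := by field_simp
      have e : Phi p (sc (t + η) d) = Phi p (cd (sc t d) (sc η d)) :=
        Phi_gram p _ _ fun x y => by
          rw [cd_gram, sc_gram ht, sc_gram hη.le, sc_gram (by linarith)]; ring
      rw [e, Phi_chain hp, add_sub_cancel_left]
      have tI : ∀ b, Tame (fun Y => Nc p (sc t d) (fun x => d x b) Y ^ 2 / Zc p (sc t d) Y) :=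
        fun b => tame_ovI hp _ _
      calc ∫ Y, Zc p (sc t d) Y * Phi (post p (sc t d) Y) (sc η d) ∂(gam B)
          ≤ ∫ Y, (η / 2 * ∑ b, Nc p (sc t d) (fun x => d x b) Y ^ 2 / Zc p (sc t d) Y)
              + C ^ 2 * η ^ 2 * Zc p (sc t d) Y ∂(gam B) := by
            refine integral_mono (tame_Z_Phi_post hp _ _).integrable
              (((tame_sum _ fun b _ => tI b).const_mul _).add
                ((tame_Zc _ _).const_mul _)).integrable fun Y => ?_
            simp only
            have h := Phi_small (isP_post hp (sc t d) Y) d hK hη.le hη2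
            have hZ := Zc_pos hp (sc t d) Y
            have h2 := mul_le_mul_of_nonneg_left h hZ.le
            refine h2.trans (le_of_eq ?_)
            simp_rw [ovI_eq hp, ← Finset.mul_sum]
            ring
        _ = η / 2 * ∑ b, ov p (sc t d) (fun x => d x b) + C ^ 2 * η ^ 2 := by
            rw [integral_add ((tame_sum _ fun b _ => tI b).const_mul _).integrable
              ((tame_Zc _ _).const_mul _).integrable, integral_const_mul, integral_const_mul,
              integral_Zc hp, integral_finsetSum _ fun b _ => (tI b).integrable]
            simp [ov]
        _ ≤ _ := by
            have : ∑ b, ov p (sc t d) (fun x => d x b) ≤ ∑ b, ov p d (fun x => d x b) := by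
              refine Finset.sum_le_sum fun b _ => ?_
              have e1 : ov p d (fun x => d x b) = ov p (sc 1 d) (fun x => d x b) := by
                congr 1; funext x b; simp [sc]
              rw [e1]
              exact ov_sc_mono hp _ _ ht (by linarith)
            nlinarith)
  have e0 : Phi p (sc 0 d) = 0 := by
    have : ∀ Y, Zc p (sc 0 d) Y = 1 := by
      intro Y; simp [Zc, el, sc, hp.2]
    simp [Phi, this]
  have e1 : Phi p (sc 1 d) = Phi p d := by congr 1; funext x b; simp [sc]
  simp only [e0, e1] at main
  linarith

lemma Phi_cd_ge {p : Ω → ℝ} (hp : IsP p) (c : Ω → A → ℝ) (d : Ω → B → ℝ) :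
    Phi p c + (∑ b, ov p c (fun x => d x b)) / 2 ≤ Phi p (cd c d) := by
  rw [Phi_chain hp]
  have : (∑ b, ov p c (fun x => d x b)) / 2
      = ∫ Y, (1/2) * ∑ b, Nc p c (fun x => d x b) Y ^ 2 / Zc p c Y ∂(gam A) := by
    rw [integral_const_mul, integral_finsetSum _ fun (b : B) _ => (tame_ovI hp c (fun x => d x b)).integrable]
    simp only [ov]; ring
  rw [this]
  refine add_le_add_right ?_ _
  refine integral_mono ((tame_sum Finset.univ fun (b : B) _ => tame_ovI hp c (fun x => d x b)).const_mul _).integrable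
    (tame_Z_Phi_post hp c d).integrable fun Y => ?_
  simp only
  simp_rw [ovI_eq hp, ← Finset.mul_sum]
  have := mul_le_mul_of_nonneg_left (Phi_ge (isP_post hp c Y) d) (Zc_pos hp c Y).le
  linarith

lemma Phi_cd_le {p : Ω → ℝ} (hp : IsP p) (c : Ω → A → ℝ) (d : Ω → B → ℝ) :
    Phi p (cd c d) ≤ Phi p c + (∑ b, ov p (cd c d) (fun x => d x b)) / 2 := by
  rw [Phi_chain hp]
  have : (∑ b, ov p (cd c d) (fun x => d x b)) / 2
      = ∫ Y, (1/2) * ∑ b, Zc p c Y * ov (post p c Y) d (fun x => d x b) ∂(gam A) := by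
    rw [integral_const_mul, integral_finsetSum _ fun (b : B) _ => (tame_Z_ov_post hp c d (fun x => d x b)).integrable]
    simp only [ov_chain hp]; ring
  rw [this]
  refine add_le_add_right ?_ _
  refine integral_mono (tame_Z_Phi_post hp c d).integrable
    ((tame_sum Finset.univ fun (b : B) _ => tame_Z_ov_post hp c d (fun x => d x b)).const_mul _).integrable fun Y => ?_
  simp only
  simp_rw [← Finset.mul_sum]
  have := mul_le_mul_of_nonneg_left (Phi_le_ov (isP_post hp c Y) d) (Zc_pos hp c Y).le
  linarith

end
end BM
end

noncomputable section
set_option linter.unusedSectionVars false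
set_option linter.unusedVariables false
namespace BM
section
variable {Ω A B I : Type} [Fintype Ω] [Fintype A] [Fintype B] [Fintype I]

/-- Covariance of two observables. -/
def cov (p : Ω → ℝ) (f g : Ω → ℝ) : ℝ := pm p (fun x => (f x - pm p f) * (g x - pm p g))

lemma cov_eq {p : Ω → ℝ} (hp : IsP p) (f g : Ω → ℝ) :
    cov p f g = pm p (fun x => f x * g x) - pm p f * pm p g := by
  have e : (fun x => (f x - pm p f) * (g x - pm p g))
      = fun x => (f x * g x - pm p f * g x) - (pm p g * f x - pm p f * pm p g) := by
    funext x; ring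
  rw [cov, e, pm_sub, pm_sub, pm_sub, pm_smul, pm_smul, pm_const hp]; ring

/-- Thermal lemma. -/
lemma thermal {p : Ω → ℝ} (hp : IsP p) (F : Ω → I → ℝ) {K δ : ℝ} (hδ : 0 ≤ δ)
    (hK : ∀ x i, |F x i| ≤ K) :
    δ * ∑ i, ∑ j, cov p (fun x => F x i) (fun x => F x j) ^ 2
      ≤ (1 + δ * (Fintype.card I * K ^ 2))
        * ∑ i, (ov p (sc δ F) (fun x => F x i) - pm p (fun x => F x i) ^ 2) := by
  set m : I → ℝ := fun i => pm p (fun x => F x i) with hm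
  set C : I → I → ℝ := fun i j => cov p (fun x => F x i) (fun x => F x j) with hC
  set d := sc δ F with hd
  set T : ℝ := ∑ i, ∑ j, C i j ^ 2 with hT
  set V : ℝ := ∑ i, (ov p d (fun x => F x i) - m i ^ 2) with hV
  set s := Real.sqrt δ with hs
  have hss : s * s = δ := Real.mul_self_sqrt hδ
  have hT0 : 0 ≤ T := Finset.sum_nonneg fun _ _ => Finset.sum_nonneg fun _ _ => sq_nonneg _
  have hVi : ∀ i, ov p d (fun x => F x i) - m i ^ 2 = ov p d (fun x => F x i - m i) := by
    intro i; rw [ov_sub_const hp]; simp only [hm]; ring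
  -- the linear statistic
  set r : I → ℝ := fun i => - ∑ j, C i j * (s * m j) with hr
  set ξ : I → (I → ℝ) → ℝ := fun i Y => ∑ j, C i j * Y j + r i with hξ
  have tξ : ∀ i, Tame (ξ i) := fun i => tame_lin _ _
  have hshift : ∀ i x Y, ξ i (Y + d x) = ∑ j, C i j * Y j + s * ∑ j, C i j * (F x j - m j) := by
    intro i x Y
    simp only [hξ, hr, hd, sc, Pi.add_apply, mul_add, Finset.sum_add_distrib, mul_sub,
      Finset.sum_sub_distrib, Finset.mul_sum]
    have e1 : ∑ j, C i j * (Real.sqrt δ * F x j) = ∑ j, s * (C i j * F x j) :=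
      Finset.sum_congr rfl fun j _ => by ring
    have e2 : ∑ j, C i j * (s * m j) = ∑ j, s * (C i j * m j) :=
      Finset.sum_congr rfl fun j _ => by ring
    rw [e1, e2]; ring
  have hcross : ∀ i, ∫ Y, Nc p d (fun x => F x i - m i) Y * ξ i Y ∂(gam I) = s * ∑ j, C i j ^ 2 := by
    intro i
    rw [integral_Nc_mul p d _ (tξ i)]
    have e : ∀ x, ∫ Y, ξ i (Y + d x) ∂(gam I) = s * ∑ j, C i j * (F x j - m j) := by
      intro x
      simp_rw [hshift]
      have t : Tame (fun Y : I → ℝ => ∑ j, C i j * Y j) := by simpa using tame_lin (C i) 0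
      rw [integral_add t.integrable (integrable_const _), integral_lin]; simp
    simp_rw [e]
    simp_rw [Finset.mul_sum]
    rw [Finset.sum_comm]
    refine Finset.sum_congr rfl fun j _ => ?_
    have : C i j ^ 2 = C i j * ∑ x, p x * ((F x i - m i) * (F x j - m j)) := by
      rw [sq]; rfl
    rw [this, Finset.mul_sum, Finset.mul_sum]
    exact Finset.sum_congr rfl fun x _ => by ring
  have hsq : ∀ i, ∫ Y, Zc p d Y * ξ i Y ^ 2 ∂(gam I)
      = ∑ j, C i j ^ 2 + δ * pm p (fun x => (∑ j, C i j * (F x j - m j)) ^ 2) := by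
    intro i
    rw [integral_planted p d ((tξ i).pow 2)]
    simp_rw [hshift, integral_affine_sq]
    simp_rw [mul_add, Finset.sum_add_distrib, ← Finset.sum_mul, hp.2, one_mul]
    congr 1
    rw [pm, Finset.mul_sum]
    refine Finset.sum_congr rfl fun x _ => ?_
    rw [mul_pow, ← hss]; ring
  have hcs : ∑ i, pm p (fun x => (∑ j, C i j * (F x j - m j)) ^ 2) ≤ T * (Fintype.card I * K ^ 2) := by
    have hv : ∑ j, pm p (fun x => (F x j - m j) ^ 2) ≤ Fintype.card I * K ^ 2 := by
      calc ∑ j, pm p (fun x => (F x j - m j) ^ 2) ≤ ∑ j : I, K ^ 2 := by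
            refine Finset.sum_le_sum fun j _ => ?_
            have e : (fun x => (F x j - m j) ^ 2)
                = fun x => F x j ^ 2 - (2 * m j) * F x j + m j ^ 2 := by funext x; ring
            rw [e, pm_add, pm_sub, pm_smul, pm_const hp]
            have h1 : pm p (fun x => F x j ^ 2) ≤ K ^ 2 := by
              rw [← pm_const hp (K ^ 2)]
              exact pm_le hp fun x => sq_le_sq' (abs_le.1 (hK x j)).1 (abs_le.1 (hK x j)).2
            change _ - 2 * m j * m j + _ ≤ _
            nlinarith [sq_nonneg (m j)]
        _ = _ := by simp
    calc ∑ i, pm p (fun x => (∑ j, C i j * (F x j - m j)) ^ 2)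
        ≤ ∑ i, (∑ j, C i j ^ 2) * ∑ j, pm p (fun x => (F x j - m j) ^ 2) := by
          refine Finset.sum_le_sum fun i _ => ?_
          rw [← pm_sum, ← pm_smul]
          exact pm_le hp fun x => Finset.sum_mul_sq_le_sq_mul_sq _ _ _
      _ = T * ∑ j, pm p (fun x => (F x j - m j) ^ 2) := by rw [← Finset.sum_mul]
      _ ≤ _ := by gcongr
  have main : ∀ a : ℝ, 0 ≤ V - 2 * a * (s * T) + a ^ 2 * (T * (1 + δ * (Fintype.card I * K ^ 2))) := by
    intro a
    have h1 : ∀ i, 0 ≤ ov p d (fun x => F x i - m i) - 2 * a * (s * ∑ j, C i j ^ 2)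
        + a ^ 2 * (∑ j, C i j ^ 2 + δ * pm p (fun x => (∑ j, C i j * (F x j - m j)) ^ 2)) := by
      intro i
      have hpos : 0 ≤ ∫ Y, (Nc p d (fun x => F x i - m i) Y ^ 2 / Zc p d Y
          - 2 * a * (Nc p d (fun x => F x i - m i) Y * ξ i Y)) + a ^ 2 * (Zc p d Y * ξ i Y ^ 2)
          ∂(gam I) := by
        refine integral_nonneg fun Y => ?_
        have hZ := Zc_pos hp d Y
        have e : (Nc p d (fun x => F x i - m i) Y ^ 2 / Zc p d Y
          - 2 * a * (Nc p d (fun x => F x i - m i) Y * ξ i Y)) + a ^ 2 * (Zc p d Y * ξ i Y ^ 2)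
          = (Nc p d (fun x => F x i - m i) Y - a * Zc p d Y * ξ i Y) ^ 2 / Zc p d Y := by
          field_simp; ring
        simp only [Pi.zero_apply]
        rw [e]; positivity
      have t1 := tame_ovI hp d (fun x => F x i - m i)
      have t2 := ((tame_Nc p d (fun x => F x i - m i)).mul (tξ i)).const_mul (2 * a)
      have t3 := ((tame_Zc p d).mul ((tξ i).pow 2)).const_mul (a ^ 2)
      rw [integral_add (t1.sub t2).integrable t3.integrable, integral_sub t1.integrable t2.integrable,
        integral_const_mul, integral_const_mul, hcross, hsq] at hpos
      exact hpos
    have h2 := Finset.sum_nonneg (s := Finset.univ) fun i _ => h1 i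
    rw [Finset.sum_add_distrib, Finset.sum_sub_distrib, ← Finset.mul_sum, ← Finset.mul_sum,
      ← Finset.mul_sum, Finset.sum_add_distrib, ← Finset.mul_sum] at h2
    have e : ∑ i, ov p d (fun x => F x i - m i) = V := Finset.sum_congr rfl fun i _ => (hVi i).symm
    rw [e] at h2
    refine h2.trans ?_
    have : a ^ 2 * (T + δ * ∑ i, pm p (fun x => (∑ j, C i j * (F x j - m j)) ^ 2))
        ≤ a ^ 2 * (T + δ * (T * (Fintype.card I * K ^ 2))) := by gcongr
    have e3 : T * (1 + δ * (Fintype.card I * K ^ 2)) = T + δ * (T * (Fintype.card I * K ^ 2)) := by ring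
    rw [e3]; linarith
  set L : ℝ := 1 + δ * (Fintype.card I * K ^ 2) with hL
  have hLp : 0 < L := by positivity
  have h := main (s / L)
  have e : V - 2 * (s / L) * (s * T) + (s / L) ^ 2 * (T * L) = V - δ * T / L := by
    rw [← hss]; field_simp; ring
  rw [e] at h
  have : δ * T / L ≤ V := by linarith
  rw [div_le_iff₀ hLp] at this
  linarith

/-- Fluctuation of the free energy. -/
def fl (p : Ω → ℝ) (c : Ω → A → ℝ) : ℝ := ∫ Y, Zc p c Y * |Real.log (Zc p c Y) - Phi p c| ∂(gam A)

lemma tame_fl {p : Ω → ℝ} (hp : IsP p) (c : Ω → A → ℝ) (r : ℝ) :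
    Tame (fun Y => Zc p c Y * |Real.log (Zc p c Y) - r|) :=
  (tame_Zc p c).mul ((tame_logZ hp c).sub (tame_const r)).abs

lemma integral_Zc_cd {p : Ω → ℝ} (hp : IsP p) (c : Ω → A → ℝ) (d : Ω → B → ℝ) (Y : A → ℝ) :
    ∫ W, Zc p (cd c d) (Sum.elim Y W) ∂(gam B) = Zc p c Y := by
  simp_rw [Zc_cd hp]
  rw [integral_const_mul, integral_Zc (isP_post hp c Y), mul_one]

/-- Quenched lemma. -/
lemma quenched {p : Ω → ℝ} (hp : IsP p) (c : Ω → A → ℝ) (d : Ω → B → ℝ) :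
    ∫ Y, Zc p c Y * |∑ b, pm (post p c Y) (fun x => d x b) ^ 2 - ∑ b, ov p c (fun x => d x b)| ∂(gam A)
      ≤ 2 * (fl p c + fl p (cd c d))
        + 2 * (∑ b, ov p (cd c d) (fun x => d x b) - ∑ b, ov p c (fun x => d x b)) := by
  set q := ∑ b, ov p c (fun x => d x b) with hq
  set q' := ∑ b, ov p (cd c d) (fun x => d x b) with hq'
  set Δ := Phi p (cd c d) - Phi p c with hΔ
  have hΔ1 : q / 2 ≤ Δ := by have := Phi_cd_ge hp c d; linarith
  have hΔ2 : Δ ≤ q' / 2 := by have := Phi_cd_le hp c d; linarith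
  set M : (A → ℝ) → ℝ := fun Y => ∑ b, pm (post p c Y) (fun x => d x b) ^ 2 with hM
  set D : (A → ℝ) → ℝ := fun Y => Phi (post p c Y) d with hD
  have tZM : Tame (fun Y => Zc p c Y * M Y) := by
    have : Tame (fun Y => ∑ b, Nc p c (fun x => d x b) Y ^ 2 / Zc p c Y) :=
      tame_sum _ fun (b : B) _ => tame_ovI hp c (fun x => d x b)
    simpa only [ovI_eq hp, ← Finset.mul_sum] using this
  have iZM : ∫ Y, Zc p c Y * M Y ∂(gam A) = q := by
    simp only [hM, Finset.mul_sum, ← ovI_eq hp]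
    rw [integral_finsetSum _ fun (b : B) _ => (tame_ovI hp c (fun x => d x b)).integrable]
    rfl
  have tZD : Tame (fun Y => Zc p c Y * D Y) := tame_Z_Phi_post hp c d
  have iZD : ∫ Y, Zc p c Y * D Y ∂(gam A) = Δ := by
    have := Phi_chain hp c d; simp only [hD, hΔ]; linarith
  have tF := tame_fl hp c (Phi p c)
  have tG := tame_fl hp (cd c d) (Phi p (cd c d))
  have hG : ∫ Y, ∫ W, Zc p (cd c d) (Sum.elim Y W) *
      |Real.log (Zc p (cd c d) (Sum.elim Y W)) - Phi p (cd c d)| ∂(gam B) ∂(gam A) = fl p (cd c d) :=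
    (integral_sumElim tG).symm
  have hpt : ∀ Y, Zc p c Y * |M Y - q| ≤
      (2 * (Zc p c Y * |Real.log (Zc p c Y) - Phi p c|
        + ∫ W, Zc p (cd c d) (Sum.elim Y W) *
          |Real.log (Zc p (cd c d) (Sum.elim Y W)) - Phi p (cd c d)| ∂(gam B)))
      + (2 * (Zc p c Y * D Y) - Zc p c Y * M Y + (2 * Δ - q) * Zc p c Y) := by
    intro Y
    have hZ := Zc_pos hp c Y
    have h1 : M Y ≤ 2 * D Y := by
      have := Phi_ge (isP_post hp c Y) d
      simp only [hM, hD]; linarith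
    have h2 : Zc p c Y * |D Y - Δ| ≤ Zc p c Y * |Real.log (Zc p c Y) - Phi p c|
        + ∫ W, Zc p (cd c d) (Sum.elim Y W) *
          |Real.log (Zc p (cd c d) (Sum.elim Y W)) - Phi p (cd c d)| ∂(gam B) := by
      have e : ∫ W, Zc p (cd c d) (Sum.elim Y W) *
          (Real.log (Zc p (cd c d) (Sum.elim Y W)) - Phi p (cd c d)) ∂(gam B)
          = Zc p c Y * (D Y - Δ) + Zc p c Y * (Real.log (Zc p c Y) - Phi p c) := by
        simp_rw [mul_sub]
        rw [integral_sub ((tame_ZlogZ hp (cd c d)).comp_elim Y).integrable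
          (((tame_Zc p (cd c d)).mul_const _).comp_elim Y).integrable, Phi_chain_eq hp,
          integral_mul_const, integral_Zc_cd hp]
        simp only [hD, hΔ]; ring
      have h3 := abs_integral_le_integral_abs (μ := gam B) (f := fun W =>
        Zc p (cd c d) (Sum.elim Y W) * (Real.log (Zc p (cd c d) (Sum.elim Y W)) - Phi p (cd c d)))
      simp_rw [abs_mul, abs_of_pos (Zc_pos hp (cd c d) _)] at h3
      rw [e] at h3
      have h4 : Zc p c Y * |D Y - Δ| = |Zc p c Y * (D Y - Δ)| := by rw [abs_mul, abs_of_pos hZ]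
      have h5 : Zc p c Y * |Real.log (Zc p c Y) - Phi p c|
          = |Zc p c Y * (Real.log (Zc p c Y) - Phi p c)| := by rw [abs_mul, abs_of_pos hZ]
      rw [h4, h5]
      have h6 := abs_sub (Zc p c Y * (D Y - Δ) + Zc p c Y * (Real.log (Zc p c Y) - Phi p c))
        (Zc p c Y * (Real.log (Zc p c Y) - Phi p c))
      rw [add_sub_cancel_right] at h6
      linarith
    have h7 : |M Y - q| ≤ 2 * |D Y - Δ| + (2 * D Y - M Y) + (2 * Δ - q) := by
      rcases abs_cases (M Y - q) with ⟨h, _⟩ | ⟨h, _⟩ <;> rcases abs_cases (D Y - Δ) with ⟨h', _⟩ | ⟨h', _⟩ <;>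
        rw [h, h'] <;> linarith
    have h8 := mul_le_mul_of_nonneg_left h7 hZ.le
    linarith
  have tZMq : Tame (fun Y => Zc p c Y * |M Y - q|) := by
    have : Tame (fun Y => |Zc p c Y * M Y - q * Zc p c Y|) := (tZM.sub ((tame_Zc p c).const_mul q)).abs
    convert! this using 2 with Y
    rw [mul_comm q, ← mul_sub, abs_mul, abs_of_pos (Zc_pos hp c Y)]
  have tR1 := (tF.add tG.integral_left).const_mul 2
  have tR2 := ((tZD.const_mul 2).sub tZM).add ((tame_Zc p c).const_mul (2 * Δ - q))
  refine (integral_mono tZMq.integrable (tR1.add tR2).integrable hpt).trans ?_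
  rw [integral_add tR1.integrable tR2.integrable, integral_const_mul,
    integral_add tF.integrable tG.integral_left.integrable, hG,
    integral_add ((tZD.const_mul 2).sub tZM).integrable ((tame_Zc p c).const_mul (2 * Δ - q)).integrable,
    integral_sub (tZD.const_mul 2).integrable tZM.integrable, integral_const_mul, integral_const_mul,
    iZD, iZM, integral_Zc hp]
  change 2 * (fl p c + fl p (cd c d)) + _ ≤ _
  linarith

end
end BM
end

noncomputable section
set_option linter.unusedSectionVars false
set_option linter.unusedVariables false
namespace BM

lemma es_two {E X : Type} [MeasurableSpace E] [MeasurableSpace X] (μ : Measure E) (ν : Measure X)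
    [IsProbabilityMeasure μ] [IsProbabilityMeasure ν] (f : E × X → ℝ) (hf : Measurable f)
    (hf2 : Integrable (fun q => f q ^ 2) (μ.prod ν)) (r : E → ℝ) (hr0 : ∀ e, 0 ≤ r e) (hr : Measurable r)
    (hr2 : Integrable (fun e => r e ^ 2) μ) (hr1 : ∫ e, r e ^ 2 ∂μ ≤ 1) {l V : ℝ} (hl : 0 ≤ l)
    (hd : ∀ e e' x, |f (e, x) - f (e', x)| ≤ l * (r e + r e'))
    (hV : ∀ e, Integrable (fun x => f (e, x) ^ 2) ν →
      ∫ x, (f (e, x) - ∫ y, f (e, y) ∂ν) ^ 2 ∂ν ≤ V) :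
    ∫ q, (f q - ∫ q', f q' ∂(μ.prod ν)) ^ 2 ∂(μ.prod ν) ≤ V + 4 * l ^ 2 := by
  have int1 : ∀ {Y : Type} [MeasurableSpace Y] (κ : Measure Y) [IsProbabilityMeasure κ] (g : Y → ℝ),
      Measurable g → Integrable (fun y => g y ^ 2) κ → Integrable g κ := by
    intro Y _ κ _ g hg h2
    exact ((memLp_two_iff_integrable_sq hg.aestronglyMeasurable).2 h2).integrable (by norm_num)
  have hfi : Integrable f (μ.prod ν) := int1 _ _ hf hf2
  set m := ∫ q', f q' ∂(μ.prod ν) with hm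
  set F : E → ℝ := fun e => ∫ x, f (e, x) ∂ν with hF
  have hFi : Integrable F μ := hfi.integral_prod_left
  have hFm : m = ∫ e, F e ∂μ := integral_prod _ hfi
  have hri : Integrable r μ := int1 _ _ hr hr2
  have hr1' : ∫ e, r e ∂μ ≤ 1 := by
    have : ∫ e, r e ∂μ ≤ ∫ e, (r e ^ 2 + 1) / 2 ∂μ :=
      integral_mono hri ((hr2.add (integrable_const 1)).div_const 2) fun e => by
        simp only; nlinarith [sq_nonneg (r e - 1)]
    rw [integral_div, integral_add hr2 (integrable_const 1)] at this
    simp at this; linarith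
  have hae : ∀ᵐ e ∂μ, Integrable (fun x => f (e, x) ^ 2) ν := hf2.prod_right_ae
  have hFd : ∀ᵐ e ∂μ, |F e - m| ≤ l * (r e + 1) := by
    filter_upwards [hae] with e he
    have hei := int1 ν (fun x => f (e, x)) (hf.comp measurable_prodMk_left) he
    have h1 : ∀ᵐ e' ∂μ, |F e - F e'| ≤ l * (r e + r e') := by
      filter_upwards [hae] with e' he'
      have hei' := int1 ν (fun x => f (e', x)) (hf.comp measurable_prodMk_left) he'
      rw [hF]; simp only
      rw [← integral_sub hei hei']
      have := norm_integral_le_of_norm_le_const (μ := ν) (C := l * (r e + r e'))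
        (f := fun x => f (e, x) - f (e', x)) (Eventually.of_forall fun x => hd e e' x)
      simpa using this
    have h2 : F e - m = ∫ e', (F e - F e') ∂μ := by
      rw [integral_sub (integrable_const _) hFi, hFm]; simp
    rw [h2]
    refine (abs_integral_le_integral_abs).trans ?_
    have i5 : Integrable (fun e' => r e + r e') μ := (integrable_const (r e)).add hri
    refine (integral_mono_ae ((integrable_const _).sub hFi).abs (i5.const_mul l) h1).trans ?_
    rw [integral_const_mul, integral_add (integrable_const _) hri]
    simp only [integral_const, probReal_univ, one_smul]
    exact mul_le_mul_of_nonneg_left (by linarith) hl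
  have hsq : Integrable (fun q => (f q - m) ^ 2) (μ.prod ν) := by
    have : (fun q => (f q - m) ^ 2) = fun q => f q ^ 2 - 2 * m * f q + m ^ 2 := by funext q; ring
    rw [this]
    exact (hf2.sub (hfi.const_mul (2 * m))).add (integrable_const _)
  rw [integral_prod _ hsq]
  have hb : ∀ᵐ e ∂μ, ∫ x, (f (e, x) - m) ^ 2 ∂ν ≤ V + l ^ 2 * (2 * r e ^ 2 + 2) := by
    filter_upwards [hae, hFd] with e he hFe
    have hei := int1 ν (fun x => f (e, x)) (hf.comp measurable_prodMk_left) he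
    have h1 := hV e he
    have i1 : Integrable (fun x => (f (e, x) - F e) ^ 2) ν := by
      have : (fun x => (f (e, x) - F e) ^ 2) = fun x => f (e, x) ^ 2 - 2 * F e * f (e, x) + F e ^ 2 := by
        funext q; ring
      rw [this]
      exact (he.sub (hei.const_mul _)).add (integrable_const _)
    have h2 : ∫ x, (f (e, x) - m) ^ 2 ∂ν = ∫ x, (f (e, x) - F e) ^ 2 ∂ν + (F e - m) ^ 2 := by
      have e1 : ∀ x, (f (e, x) - m) ^ 2
          = (f (e, x) - F e) ^ 2 + (2 * (F e - m) * (f (e, x) - F e) + (F e - m) ^ 2) := by intro x; ring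
      simp_rw [e1]
      have i2 : Integrable (fun x => 2 * (F e - m) * (f (e, x) - F e)) ν :=
        (hei.sub (integrable_const _)).const_mul _
      have i6 : Integrable (fun x => 2 * (F e - m) * (f (e, x) - F e) + (F e - m) ^ 2) ν :=
        i2.add (integrable_const _)
      rw [integral_add i1 i6, integral_add i2 (integrable_const _),
        integral_const_mul, integral_sub hei (integrable_const _)]
      simp [hF]
    rw [h2]
    have h3 : (F e - m) ^ 2 ≤ (l * (r e + 1)) ^ 2 := by
      rw [← sq_abs]; exact pow_le_pow_left₀ (abs_nonneg _) hFe 2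
    have h4 : (l * (r e + 1)) ^ 2 ≤ l ^ 2 * (2 * r e ^ 2 + 2) := by
      rw [mul_pow]; exact mul_le_mul_of_nonneg_left (by nlinarith [sq_nonneg (r e - 1)]) (sq_nonneg _)
    linarith
  have i3 : Integrable (fun e => 2 * r e ^ 2 + 2) μ := (hr2.const_mul 2).add (integrable_const _)
  have i4 : Integrable (fun e => V + l ^ 2 * (2 * r e ^ 2 + 2)) μ :=
    (integrable_const V).add (i3.const_mul _)
  refine (integral_mono_ae hsq.integral_prod_left i4 hb).trans ?_
  rw [integral_add (integrable_const V) (i3.const_mul _), integral_const_mul,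
    integral_add (hr2.const_mul 2) (integrable_const _), integral_const_mul]
  simp only [integral_const, probReal_univ, one_smul]
  nlinarith [sq_nonneg l]

/-- Efron-Stein, `Fin n` version. -/
lemma es_fin {E : Type} [MeasurableSpace E] (r : E → ℝ) (hr0 : ∀ e, 0 ≤ r e) (hr : Measurable r) (n : ℕ) :
    ∀ (μ : Fin n → Measure E) [∀ i, IsProbabilityMeasure (μ i)]
      (hr2 : ∀ i, Integrable (fun e => r e ^ 2) (μ i)) (hr1 : ∀ i, ∫ e, r e ^ 2 ∂(μ i) ≤ 1)
      (f : (Fin n → E) → ℝ) (hf : Measurable f) (hf2 : Integrable (fun q => f q ^ 2) (Measure.pi μ))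
      (l : Fin n → ℝ) (hl : ∀ i, 0 ≤ l i)
      (hd : ∀ i X Y, (∀ j, j ≠ i → X j = Y j) → |f X - f Y| ≤ l i * (r (X i) + r (Y i))),
      ∫ q, (f q - ∫ q', f q' ∂(Measure.pi μ)) ^ 2 ∂(Measure.pi μ) ≤ 4 * ∑ i, l i ^ 2 := by
  induction n with
  | zero =>
    intro μ _ _ _ f hf hf2 l hl hd
    have : ∀ q, f q = f default := fun q => by rw [Subsingleton.elim q default]
    simp [this]
  | succ n ih =>
    intro μ _ hr2 hr1 f hf hf2 l hl hd
    have mp := (measurePreserving_piFinSuccAbove μ 0).symm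
    set e := (MeasurableEquiv.piFinSuccAbove (fun _ : Fin (n+1) => E) 0).symm with he
    have hem : MeasurableEmbedding e := e.measurableEmbedding
    have hap : ∀ (a : E) (x : Fin n → E), e (a, x) = Fin.cons a x := by
      intro a x
      rw [he]
      simp [MeasurableEquiv.piFinSuccAbove, Fin.insertNthEquiv]
    rw [← mp.integral_comp hem, ← mp.integral_comp hem, Fin.sum_univ_succ]
    rw [← mp.integrable_comp_emb hem] at hf2
    have := es_two (μ 0) (Measure.pi fun j : Fin n => μ (Fin.succ j)) (fun q => f (e q))
      (hf.comp e.measurable) hf2 r hr0 hr (hr2 0) (hr1 0) (hl 0) (V := 4 * ∑ i : Fin n, l i.succ ^ 2)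
      (fun a a' x => by
        rw [hap, hap]
        have := hd 0 (Fin.cons a x) (Fin.cons a' x) (fun j hj => by
          obtain ⟨k, rfl⟩ := Fin.exists_succ_eq.2 hj
          simp)
        simpa using this)
      (fun a ha => by
        refine ih (fun j => μ j.succ) (fun i => hr2 _) (fun i => hr1 _) (fun x => f (e (a, x)))
          (hf.comp (e.measurable.comp measurable_prodMk_left)) ha (fun i => l i.succ) (fun i => hl _) ?_
        intro i X Y hXY
        rw [hap, hap]
        have := hd i.succ (Fin.cons a X) (Fin.cons a Y) (fun j hj => by
          induction j using Fin.cases with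
          | zero => simp
          | succ k =>
            simp only [Fin.cons_succ]
            exact hXY k fun h => hj (by rw [h]))
        simpa using this)
    rw [mul_add, add_comm (4 * l 0 ^ 2)]
    exact this

/-- Efron-Stein, general finite index. -/
lemma es_pi {E : Type} [MeasurableSpace E] (r : E → ℝ) (hr0 : ∀ e, 0 ≤ r e) (hr : Measurable r)
    {J : Type} [Fintype J] (μ : J → Measure E) [∀ i, IsProbabilityMeasure (μ i)]
    (hr2 : ∀ i, Integrable (fun e => r e ^ 2) (μ i)) (hr1 : ∀ i, ∫ e, r e ^ 2 ∂(μ i) ≤ 1)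
    (f : (J → E) → ℝ) (hf : Measurable f) (hf2 : Integrable (fun q => f q ^ 2) (Measure.pi μ))
    (l : J → ℝ) (hl : ∀ i, 0 ≤ l i)
    (hd : ∀ i X Y, (∀ j, j ≠ i → X j = Y j) → |f X - f Y| ≤ l i * (r (X i) + r (Y i))) :
    ∫ q, (f q - ∫ q', f q' ∂(Measure.pi μ)) ^ 2 ∂(Measure.pi μ) ≤ 4 * ∑ i, l i ^ 2 := by
  let e0 : Fin (Fintype.card J) ≃ J := (Fintype.equivFin J).symm
  have mp := measurePreserving_piCongrLeft μ e0
  set e := MeasurableEquiv.piCongrLeft (fun _ : J => E) e0 with he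
  have hem : MeasurableEmbedding e := e.measurableEmbedding
  have hap : ∀ x i, e x (e0 i) = x i := by
    intro x i
    rw [he, MeasurableEquiv.coe_piCongrLeft, Equiv.piCongrLeft_apply_apply]
  rw [← mp.integral_comp hem, ← mp.integral_comp hem, ← e0.sum_comp]
  rw [← mp.integrable_comp_emb hem] at hf2
  refine es_fin r hr0 hr _ (fun i => μ (e0 i)) (fun i => hr2 _) (fun i => hr1 _) (fun q => f (e q))
    (hf.comp e.measurable) hf2 (fun i => l (e0 i)) (fun i => hl _) ?_
  intro i X Y hXY
  have := hd (e0 i) (e X) (e Y) (fun j hj => by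
    obtain ⟨k, rfl⟩ := e0.surjective j
    rw [hap, hap]
    exact hXY k fun h => hj (by rw [h]))
  simpa only [hap] using this

lemma es_gam {A : Type} [Fintype A] {h : (A → ℝ) → ℝ} (hh : Tame h) (l : A → ℝ) (hl : ∀ a, 0 ≤ l a)
    (hd : ∀ i X Y, (∀ j, j ≠ i → X j = Y j) → |h X - h Y| ≤ l i * |X i - Y i|) :
    ∫ q, (h q - ∫ q', h q' ∂(gam A)) ^ 2 ∂(gam A) ≤ 4 * ∑ i, l i ^ 2 := by
  have i1 : Integrable (fun e : ℝ => |e| ^ 2) (gaussianReal 0 1) := by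
    have : MemLp (id : ℝ → ℝ) 2 (gaussianReal 0 1) := memLp_id_gaussianReal 2
    simpa using this.integrable_sq
  have i2 : ∫ e : ℝ, |e| ^ 2 ∂(gaussianReal 0 1) ≤ 1 := by
    have h1 := variance_of_integral_eq_zero (X := (id : ℝ → ℝ)) (μ := gaussianReal 0 1)
      measurable_id.aemeasurable (by simpa using integral_id_gaussianReal (μ := 0) (v := 1))
    rw [variance_id_gaussianReal] at h1
    simp only [sq_abs]
    simp only [id] at h1
    rw [← h1]; simp
  refine es_pi (fun e : ℝ => |e|) (fun _ => abs_nonneg _) (by fun_prop) (fun _ => gaussianReal 0 1)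
    (fun _ => i1) (fun _ => i2) h hh.1 (hh.pow 2).integrable l hl fun i X Y hXY => ?_
  exact (hd i X Y hXY).trans (mul_le_mul_of_nonneg_left (abs_sub _ _) (hl i))

/-- Product weights. -/
def pw {J S : Type} [Fintype J] (w : J → S → ℝ) (x : J → S) : ℝ := ∏ i, w i (x i)

/-- Measure with weights `w`. -/
def wm {S : Type} [Fintype S] [MeasurableSpace S] (w : S → ℝ) : Measure S :=
  ∑ s, ENNReal.ofReal (w s) • Measure.dirac s

lemma isP_pw {J S : Type} [Fintype J] [Fintype S] [DecidableEq J] {w : J → S → ℝ} (hw : ∀ i, IsP (w i)) :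
    IsP (pw w) := by
  refine ⟨fun x => Finset.prod_nonneg fun i _ => (hw i).1 _, ?_⟩
  unfold pw
  rw [← Fintype.prod_sum]
  exact Finset.prod_eq_one fun i _ => (hw i).2

lemma es_fin_prior {J S : Type} [Fintype J] [Fintype S] [DecidableEq J] {w : J → S → ℝ} (hw : ∀ i, IsP (w i))
    (f : (J → S) → ℝ) (l : J → ℝ) (hl : ∀ a, 0 ≤ l a)
    (hd : ∀ i X Y, (∀ j, j ≠ i → X j = Y j) → |f X - f Y| ≤ l i) :
    ∑ x, pw w x * (f x - pm (pw w) f) ^ 2 ≤ ∑ i, l i ^ 2 := by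
  classical
  letI : MeasurableSpace S := ⊤
  haveI : DiscreteMeasurableSpace S := ⟨fun _ => trivial⟩
  have hs : ∀ i s, (wm (w i)).real {s} = w i s := by
    intro i s
    simp only [wm, Measure.real, Measure.finsetSum_apply, Measure.smul_apply, smul_eq_mul]
    rw [Finset.sum_eq_single s]
    · simp [(hw i).1 s]
    · intro b _ hb; simp [hb]
    · simp
  haveI : ∀ i, IsProbabilityMeasure (wm (w i)) := by
    intro i
    refine ⟨?_⟩
    simp only [wm, Measure.finsetSum_apply, Measure.smul_apply, smul_eq_mul]
    simp only [measure_univ, mul_one]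
    rw [← ENNReal.ofReal_sum_of_nonneg fun s _ => (hw i).1 s, (hw i).2]; simp
  have hInt : ∀ g : (J → S) → ℝ, ∫ x, g x ∂(Measure.pi fun i => wm (w i)) = pm (pw w) g := by
    intro g
    rw [integral_fintype Integrable.of_finite]
    refine Finset.sum_congr rfl fun x _ => ?_
    rw [smul_eq_mul]; congr 1
    rw [Measure.real, Measure.pi_singleton, ENNReal.toReal_prod]
    exact Finset.prod_congr rfl fun i _ => hs i _
  have := es_pi (fun _ : S => (1:ℝ)) (fun _ => zero_le_one) measurable_const (fun i => wm (w i))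
    (fun i => Integrable.of_finite) (fun i => by simp) f (Measurable.of_discrete) Integrable.of_finite
    (fun i => l i / 2) (fun i => by have := hl i; positivity) (fun i X Y h => by
      have := hd i X Y h; linarith)
  rw [hInt, hInt] at this
  refine this.trans (le_of_eq ?_)
  rw [Finset.mul_sum]
  exact Finset.sum_congr rfl fun i _ => by ring

end BM
end

noncomputable section
set_option linter.unusedSectionVars false
set_option linter.unusedVariables false
namespace BM
variable {Ω A J S : Type} [Fintype Ω] [Fintype A] [Fintype J] [Fintype S]

lemma abs_le_half {g s : ℝ} (hs : 0 < s) : |g| ≤ (g ^ 2 / s + s) / 2 := by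
  rw [le_div_iff₀ (by norm_num), ← sub_nonneg]
  have : g ^ 2 / s + s - |g| * 2 = (|g| - s) ^ 2 / s := by
    rw [sub_sq, sq_abs]; field_simp; ring
  rw [this]; positivity

lemma el_lip {l : A → ℝ} {b : A → ℝ} (hb : ∀ a, |b a| ≤ l a) (Y Y' : A → ℝ) :
    el b Y ≤ el b Y' * Real.exp (∑ a, l a * |Y a - Y' a|) := by
  rw [el, el, ← Real.exp_add]
  apply Real.exp_le_exp.2
  have : ∑ a, b a * Y a ≤ ∑ a, b a * Y' a + ∑ a, l a * |Y a - Y' a| := by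
    rw [← Finset.sum_add_distrib]
    refine Finset.sum_le_sum fun a _ => ?_
    have h1 : b a * (Y a - Y' a) ≤ |b a| * |Y a - Y' a| := by rw [← abs_mul]; exact le_abs_self _
    have h2 := mul_le_mul_of_nonneg_right (hb a) (abs_nonneg (Y a - Y' a))
    linarith
  linarith

lemma logZ_lip1 {p : Ω → ℝ} (hp : IsP p) (c : Ω → A → ℝ) {l : A → ℝ} (hb : ∀ x a, |c x a| ≤ l a)
    (Y Y' : A → ℝ) :
    Real.log (Zc p c Y) - Real.log (Zc p c Y') ≤ ∑ a, l a * |Y a - Y' a| := by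
  have hZ := Zc_pos hp c Y
  have hZ' := Zc_pos hp c Y'
  have h : Zc p c Y ≤ Zc p c Y' * Real.exp (∑ a, l a * |Y a - Y' a|) := by
    rw [Zc, Zc, Finset.sum_mul]
    refine Finset.sum_le_sum fun x _ => ?_
    rw [mul_assoc]
    exact mul_le_mul_of_nonneg_left (el_lip (hb x) Y Y') (hp.1 x)
  have := Real.log_le_log hZ h
  rw [Real.log_mul hZ'.ne' (Real.exp_pos _).ne', Real.log_exp] at this
  linarith

lemma logZ_lip {p : Ω → ℝ} (hp : IsP p) (c : Ω → A → ℝ) {l : A → ℝ} (hb : ∀ x a, |c x a| ≤ l a)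
    (Y Y' : A → ℝ) :
    |Real.log (Zc p c Y) - Real.log (Zc p c Y')| ≤ ∑ a, l a * |Y a - Y' a| := by
  rw [abs_le]
  have h1 := logZ_lip1 hp c hb Y Y'
  have h2 := logZ_lip1 hp c hb Y' Y
  simp_rw [abs_sub_comm (Y' _)] at h2
  constructor <;> linarith

/-- Concentration of the free energy. -/
lemma fl_le [DecidableEq J] {w : J → S → ℝ} (hw : ∀ i, IsP (w i)) (c : (J → S) → A → ℝ) {l : A → ℝ}
    (hb : ∀ x a, |c x a| ≤ l a) {D : J → ℝ} (hD0 : ∀ i, 0 ≤ D i)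
    (hD : ∀ i X Y, (∀ j, j ≠ i → X j = Y j) → ∑ a, l a * |c X a - c Y a| ≤ D i)
    {s t : ℝ} (hs : 0 < s) (ht : 0 < t) (hls : 4 * ∑ a, l a ^ 2 ≤ s ^ 2) (hDt : ∑ i, D i ^ 2 ≤ t ^ 2) :
    fl (pw w) c ≤ s + t := by
  have hp := isP_pw hw
  set p := pw w with hpdef
  have hl : ∀ x : J → S, ∀ a, 0 ≤ l a := fun x a => (abs_nonneg _).trans (hb x a)
  have hl' : ∀ a, 0 ≤ l a := hl hp.exists_pos.choose
  have tl := tame_logZ hp c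
  set g : (J → S) → ℝ := fun x => ∫ Y, Real.log (Zc p c (Y + c x)) ∂(gam A) with hg
  have hPhi : Phi p c = pm p g := integral_planted p c tl
  have h1 : fl p c = ∑ x, p x * ∫ Y, |Real.log (Zc p c (Y + c x)) - Phi p c| ∂(gam A) :=
    integral_planted p c (tl.sub (tame_const (Phi p c))).abs
  have h2 : ∀ x, ∫ Y, |Real.log (Zc p c (Y + c x)) - Phi p c| ∂(gam A) ≤ s + |g x - pm p g| := by
    intro x
    have t1 := tl.shift (c x)
    have t2 := t1.sub (tame_const (g x))
    have : ∀ Y, |Real.log (Zc p c (Y + c x)) - Phi p c|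
        ≤ ((Real.log (Zc p c (Y + c x)) - g x) ^ 2 / s + s) / 2 + |g x - pm p g| := by
      intro Y
      rw [hPhi]
      have := abs_le_half (g := Real.log (Zc p c (Y + c x)) - g x) hs
      have := abs_sub_le (Real.log (Zc p c (Y + c x))) (g x) (pm p g)
      linarith
    have t3 : Tame (fun Y => ((Real.log (Zc p c (Y + c x)) - g x) ^ 2 / s + s) / 2) := by
      simp_rw [div_eq_mul_inv]
      exact (((t2.pow 2).mul_const _).add (tame_const s)).mul_const _
    refine (integral_mono (t1.sub (tame_const _)).abs.integrable
      (t3.add (tame_const |g x - pm p g|)).integrable this).trans ?_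
    rw [integral_add t3.integrable (integrable_const _), integral_div]
    have t4 : Tame (fun Y => (Real.log (Zc p c (Y + c x)) - g x) ^ 2 / s) := by
      simp_rw [div_eq_mul_inv]; exact (t2.pow 2).mul_const _
    rw [integral_add t4.integrable (integrable_const _), integral_div]
    simp only [integral_const, probReal_univ, one_smul]
    have es := es_gam t1 l hl' (fun i X Y hXY => by
      refine (logZ_lip hp c hb (X + c x) (Y + c x)).trans (le_of_eq ?_)
      rw [Finset.sum_eq_single i]
      · simp
      · intro j _ hj; simp [hXY j hj]
      · simp)
    have es' : (∫ Y, (Real.log (Zc p c (Y + c x)) - g x) ^ 2 ∂(gam A)) / s ≤ s := by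
      rw [div_le_iff₀ hs, ← sq]; exact es.trans hls
    linarith
  have h3 : ∑ x, p x * (g x - pm p g) ^ 2 ≤ ∑ i, D i ^ 2 := by
    refine es_fin_prior hw g D hD0 fun i X Y hXY => ?_
    rw [hg]; simp only
    rw [← integral_sub (tl.shift (c X)).integrable (tl.shift (c Y)).integrable]
    have := norm_integral_le_of_norm_le_const (μ := gam A) (C := D i)
      (f := fun W => Real.log (Zc p c (W + c X)) - Real.log (Zc p c (W + c Y)))
      (Eventually.of_forall fun W => by
        refine (logZ_lip hp c hb (W + c X) (W + c Y)).trans ?_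
        refine le_trans (le_of_eq ?_) (hD i X Y hXY)
        simp)
    simpa using this
  have h4 : pm p (fun x => |g x - pm p g|) ≤ t := by
    have : pm p (fun x => |g x - pm p g|) ≤ pm p (fun x => (1 / (2 * t)) * (g x - pm p g) ^ 2 + t / 2) :=
      pm_le hp fun x => (abs_le_half ht).trans (le_of_eq (by field_simp))
    rw [pm_add, pm_const hp, pm_smul] at this
    have h5 : pm p (fun x => (g x - pm p g) ^ 2) ≤ t ^ 2 := h3.trans hDt
    have h6 := mul_le_mul_of_nonneg_left h5 (show 0 ≤ 1 / (2 * t) by positivity)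
    have h7 : 1 / (2 * t) * t ^ 2 = t / 2 := by field_simp
    linarith
  rw [h1]
  have h8 := pm_le hp h2
  rw [pm_add, pm_const hp] at h8
  exact h8.trans (by linarith)

end BM
end

noncomputable section
set_option linter.unusedSectionVars false
set_option linter.unusedVariables false
namespace BM
variable {Ω A J S : Type} [Fintype Ω] [Fintype A] [Fintype J] [Fintype S]

/-- Product of two priors. -/
def pp (q : Ω → ℝ) (w : S → ℝ) (z : Ω × S) : ℝ := q z.1 * w z.2

lemma isP_pp {q : Ω → ℝ} {w : S → ℝ} (hq : IsP q) (hw : IsP w) : IsP (pp q w) := by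
  refine ⟨fun z => mul_nonneg (hq.1 _) (hw.1 _), ?_⟩
  simp only [pp, Fintype.sum_prod_type]
  rw [← Finset.sum_mul_sum, hq.2, hw.2, one_mul]

lemma ratio_bound1 {N Z N' Z' K : ℝ} (hZ : 0 < Z) (hZ' : 0 < Z') (hK : 0 ≤ K) (hN : |N| ≤ K * Z) :
    N ^ 2 / Z - N' ^ 2 / Z' ≤ 2 * K * |N - N'| + K ^ 2 * |Z - Z'| := by
  -- convexity: N'^2/Z' ≥ N^2/Z + 2 (N/Z) (N'-N) - (N/Z)^2 (Z'-Z)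
  set a := N / Z with ha
  have hNa : N = a * Z := by rw [ha]; field_simp
  have haK : |a| ≤ K := by rw [ha, abs_div, abs_of_pos hZ, div_le_iff₀ hZ]; exact hN
  have h1 : 2 * a * N' - a ^ 2 * Z' ≤ N' ^ 2 / Z' := by
    rw [le_div_iff₀ hZ']; nlinarith [sq_nonneg (N' - a * Z')]
  have h2 : N ^ 2 / Z = 2 * a * N - a ^ 2 * Z := by rw [hNa]; field_simp; ring
  have h3 : 2 * a * (N - N') ≤ 2 * K * |N - N'| := by
    have := le_abs_self (a * (N - N')); rw [abs_mul] at this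
    have := mul_le_mul_of_nonneg_right haK (abs_nonneg (N - N'))
    linarith
  have h4 : a ^ 2 * (Z' - Z) ≤ K ^ 2 * |Z - Z'| := by
    have h5 : a ^ 2 ≤ K ^ 2 := by rw [← sq_abs]; exact pow_le_pow_left₀ (abs_nonneg _) haK 2
    have h6 : Z' - Z ≤ |Z - Z'| := by rw [abs_sub_comm]; exact le_abs_self _
    calc a ^ 2 * (Z' - Z) ≤ a ^ 2 * |Z - Z'| := mul_le_mul_of_nonneg_left h6 (sq_nonneg _)
      _ ≤ _ := mul_le_mul_of_nonneg_right h5 (abs_nonneg _)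
  linarith

lemma ratio_bound {N Z N' Z' K : ℝ} (hZ : 0 < Z) (hZ' : 0 < Z') (hK : 0 ≤ K) (hN : |N| ≤ K * Z)
    (hN' : |N'| ≤ K * Z') :
    |N ^ 2 / Z - N' ^ 2 / Z'| ≤ 2 * K * |N - N'| + K ^ 2 * |Z - Z'| := by
  rw [abs_le]
  have h1 := ratio_bound1 (N' := N') hZ hZ' hK hN
  have h2 := ratio_bound1 (N' := N) hZ' hZ hK hN'
  rw [abs_sub_comm N', abs_sub_comm Z'] at h2
  constructor <;> linarith

lemma Nc_abs_le {p : Ω → ℝ} (hp : IsP p) (c : Ω → A → ℝ) {f : Ω → ℝ} {K : ℝ} (hf : ∀ x, |f x| ≤ K)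
    (Y : A → ℝ) : |Nc p c f Y| ≤ K * Zc p c Y := by
  rw [Nc, Zc, Finset.mul_sum]
  refine (Finset.abs_sum_le_sum_abs _ _).trans (Finset.sum_le_sum fun x _ => ?_)
  rw [abs_mul, abs_mul, abs_of_nonneg (hp.1 x), abs_of_pos (el_pos _ _)]
  have := mul_le_mul_of_nonneg_right (hf x) (mul_nonneg (hp.1 x) (el_pos (c x) Y).le)
  linarith

/-- General comparison of a system `Ω × S` with a system on `S`. -/
lemma cav_gen {q : Ω → ℝ} {w : S → ℝ} (hq : IsP q) (hw : IsP w) (d : Ω × S → A → ℝ) (e : S → A → ℝ)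
    {f : S → ℝ} {K V ε : ℝ} (hf : ∀ s, |f s| ≤ K) (hK : 0 ≤ K) (hε : 0 < ε)
    (hV : ∀ s, ∫ Y, (∑ x, q x * el (d (x, s)) Y - el (e s) Y) ^ 2 ∂(gam A) ≤ V) :
    |ov (pp q w) d (fun z => f z.2) - ov w e f| ≤ 3 * K ^ 2 * ((V / ε + ε) / 2) := by
  have hp := isP_pp hq hw
  set Δ : S → (A → ℝ) → ℝ := fun s Y => ∑ x, q x * el (d (x, s)) Y - el (e s) Y with hΔ
  have tΔ : ∀ s, Tame (Δ s) := fun s =>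
    (tame_sum _ fun x _ => (tame_el (d (x, s))).const_mul (q x)).sub (tame_el (e s))
  have hN : ∀ Y, Nc (pp q w) d (fun z => f z.2) Y - Nc w e f Y = ∑ s, w s * f s * Δ s Y := by
    intro Y
    simp only [Nc, pp, Fintype.sum_prod_type_right, hΔ]
    rw [← Finset.sum_sub_distrib]
    refine Finset.sum_congr rfl fun s _ => ?_
    rw [mul_sub, Finset.mul_sum]; congr 1
    exact Finset.sum_congr rfl fun x _ => by ring
  have hZ : ∀ Y, Zc (pp q w) d Y - Zc w e Y = ∑ s, w s * Δ s Y := by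
    intro Y
    simp only [Zc, pp, Fintype.sum_prod_type_right, hΔ]
    rw [← Finset.sum_sub_distrib]
    refine Finset.sum_congr rfl fun s _ => ?_
    rw [mul_sub, Finset.mul_sum]; congr 1
    exact Finset.sum_congr rfl fun x _ => by ring
  have key : ∀ Y, |Nc (pp q w) d (fun z => f z.2) Y ^ 2 / Zc (pp q w) d Y - Nc w e f Y ^ 2 / Zc w e Y|
      ≤ ∑ s, w s * (3 * K ^ 2 * ((1 / (2 * ε)) * Δ s Y ^ 2 + ε / 2)) := by
    intro Y
    refine (ratio_bound (Zc_pos hp d Y) (Zc_pos hw e Y) hK (Nc_abs_le hp d (fun z => hf z.2) Y)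
      (Nc_abs_le hw e hf Y)).trans ?_
    rw [hN, hZ]
    have a1 : |∑ s, w s * f s * Δ s Y| ≤ ∑ s, w s * (K * |Δ s Y|) := by
      refine (Finset.abs_sum_le_sum_abs _ _).trans (Finset.sum_le_sum fun s _ => ?_)
      rw [abs_mul, abs_mul, abs_of_nonneg (hw.1 s), mul_assoc]
      exact mul_le_mul_of_nonneg_left (mul_le_mul_of_nonneg_right (hf s) (abs_nonneg _)) (hw.1 s)
    have a2 : |∑ s, w s * Δ s Y| ≤ ∑ s, w s * |Δ s Y| := by
      refine (Finset.abs_sum_le_sum_abs _ _).trans (Finset.sum_le_sum fun s _ => ?_)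
      rw [abs_mul, abs_of_nonneg (hw.1 s)]
    have a3 : 2 * K * |∑ s, w s * f s * Δ s Y| + K ^ 2 * |∑ s, w s * Δ s Y|
        ≤ 2 * K * (∑ s, w s * (K * |Δ s Y|)) + K ^ 2 * ∑ s, w s * |Δ s Y| :=
      add_le_add (mul_le_mul_of_nonneg_left a1 (by positivity)) (mul_le_mul_of_nonneg_left a2 (by positivity))
    refine a3.trans ?_
    rw [Finset.mul_sum, Finset.mul_sum, ← Finset.sum_add_distrib]
    refine Finset.sum_le_sum fun s _ => ?_
    have h1 : |Δ s Y| ≤ (1 / (2 * ε)) * Δ s Y ^ 2 + ε / 2 :=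
      (abs_le_half hε).trans (le_of_eq (by field_simp))
    calc _ = w s * (3 * K ^ 2 * |Δ s Y|) := by ring
      _ ≤ _ := mul_le_mul_of_nonneg_left (mul_le_mul_of_nonneg_left h1 (by positivity)) (hw.1 s)
  have ti : ∀ s, Tame (fun Y => (1 / (2 * ε)) * Δ s Y ^ 2 + ε / 2) := fun s =>
    (((tΔ s).pow 2).const_mul _).add (tame_const _)
  rw [ov, ov, ← integral_sub (tame_ovI hp _ _).integrable (tame_ovI hw _ _).integrable]
  refine abs_integral_le_integral_abs.trans ?_
  refine (integral_mono ((tame_ovI hp _ _).sub (tame_ovI hw _ _)).abs.integrable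
    (tame_sum _ fun s _ => ((ti s).const_mul (3 * K ^ 2)).const_mul (w s)).integrable key).trans ?_
  rw [integral_finsetSum _ fun s _ => (((ti s).const_mul (3 * K ^ 2)).const_mul (w s)).integrable]
  have : ∀ s, ∫ Y, w s * (3 * K ^ 2 * ((1 / (2 * ε)) * Δ s Y ^ 2 + ε / 2)) ∂(gam A)
      ≤ w s * (3 * K ^ 2 * ((V / ε + ε) / 2)) := by
    intro s
    rw [integral_const_mul, integral_const_mul, integral_add (((tΔ s).pow 2).const_mul _).integrable
      (integrable_const _), integral_const_mul]
    simp only [integral_const, probReal_univ, one_smul]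
    refine mul_le_mul_of_nonneg_left (mul_le_mul_of_nonneg_left ?_ (by positivity)) (hw.1 s)
    have := mul_le_mul_of_nonneg_left (hV s) (show 0 ≤ 1 / (2 * ε) by positivity)
    have e2 : 1 / (2 * ε) * V = V / ε / 2 := by field_simp
    linarith
  refine (Finset.sum_le_sum fun s _ => this s).trans (le_of_eq ?_)
  rw [← Finset.sum_mul, hw.2, one_mul]

/-- Second moment of the discrepancy. -/
lemma disc_sq {q : Ω → ℝ} (c : Ω → A → ℝ) (b : A → ℝ) :
    ∫ Y, (∑ x, q x * el (c x) Y - el b Y) ^ 2 ∂(gam A)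
      = ∑ x, ∑ y, q x * q y * Real.exp (∑ a, c x a * c y a)
        - 2 * ∑ x, q x * Real.exp (∑ a, c x a * b a) + Real.exp (∑ a, b a * b a) := by
  have e : ∀ Y, (∑ x, q x * el (c x) Y - el b Y) ^ 2
      = (∑ x, ∑ y, q x * q y * (el (c x) Y * el (c y) Y) - 2 * ∑ x, q x * (el (c x) Y * el b Y))
        + el b Y * el b Y := by
    intro Y
    have h1 : (∑ x, q x * el (c x) Y) ^ 2 = ∑ x, ∑ y, q x * q y * (el (c x) Y * el (c y) Y) := by
      rw [sq, Finset.sum_mul_sum]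
      exact Finset.sum_congr rfl fun x _ => Finset.sum_congr rfl fun y _ => by ring
    have h2 : (∑ x, q x * el (c x) Y) * el b Y = ∑ x, q x * (el (c x) Y * el b Y) := by
      rw [Finset.sum_mul]; exact Finset.sum_congr rfl fun x _ => by ring
    rw [← h1, ← h2]; ring
  simp_rw [e]
  have t1 : ∀ x y, Tame (fun Y => q x * q y * (el (c x) Y * el (c y) Y)) := fun x y =>
    ((tame_el _).mul (tame_el _)).const_mul _
  have t1' : ∀ x, Tame (fun Y => ∑ y, q x * q y * (el (c x) Y * el (c y) Y)) := fun x =>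
    tame_sum _ fun y _ => t1 x y
  have t2 : ∀ x, Tame (fun Y => q x * (el (c x) Y * el b Y)) := fun x =>
    ((tame_el _).mul (tame_el _)).const_mul _
  have T1 : Tame (fun Y => ∑ x, ∑ y, q x * q y * (el (c x) Y * el (c y) Y)) := tame_sum _ fun x _ => t1' x
  have T2 : Tame (fun Y => 2 * ∑ x, q x * (el (c x) Y * el b Y)) := (tame_sum _ fun x _ => t2 x).const_mul 2
  rw [integral_add (T1.sub T2).integrable ((tame_el b).mul (tame_el b)).integrable,
    integral_sub T1.integrable T2.integrable, integral_const_mul,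
    integral_finsetSum _ fun x _ => (t1' x).integrable, integral_finsetSum _ fun x _ => (t2 x).integrable]
  simp_rw [fun x => integral_finsetSum (μ := gam A) Finset.univ fun y _ => (t1 x y).integrable,
    integral_const_mul, integral_el_el]

end BM
end

noncomputable section
set_option linter.unusedSectionVars false
set_option linter.unusedVariables false
namespace BM
variable {Ω A J S : Type} [Fintype Ω] [Fintype A] [Fintype J] [Fintype S]

lemma exp_diff_le {a b B : ℝ} (ha : a ≤ B) (hb : b ≤ B) : |Real.exp a - Real.exp b| ≤ Real.exp B * |a - b| := by
  wlog h : b ≤ a generalizing a b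
  · rw [abs_sub_comm, abs_sub_comm a]; exact this hb ha (le_of_not_ge h)
  rw [abs_of_nonneg (by linarith [Real.exp_le_exp.2 h]), abs_of_nonneg (by linarith)]
  have h1 : Real.exp b ≥ Real.exp a * (1 - (a - b)) := by
    have : Real.exp b = Real.exp a * Real.exp (b - a) := by rw [← Real.exp_add]; congr 1; ring
    rw [this]
    refine mul_le_mul_of_nonneg_left ?_ (Real.exp_pos _).le
    have := Real.add_one_le_exp (b - a); linarith
  have h2 : Real.exp a * (a - b) ≤ Real.exp B * (a - b) :=
    mul_le_mul_of_nonneg_right (Real.exp_le_exp.2 ha) (by linarith)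
  linarith

lemma sqdiff_le (C a : ℝ) {θ : ℝ} (hθ : 0 < θ) : |(C + a) ^ 2 - a ^ 2| ≤ C ^ 2 * (1 + 1 / θ) + θ * a ^ 2 := by
  have h : (|C| - θ * |a|) ^ 2 / θ ≥ 0 := by positivity
  have h2 : (|C| - θ * |a|) ^ 2 / θ = C ^ 2 * (1 / θ) - 2 * |C| * |a| + θ * a ^ 2 := by
    rw [sub_sq, mul_pow, sq_abs, sq_abs]; field_simp
  have h3 : (C + a) ^ 2 - a ^ 2 = C ^ 2 + 2 * (C * a) := by ring
  have h4 : |C ^ 2 + 2 * (C * a)| ≤ C ^ 2 + 2 * (|C| * |a|) := by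
    refine (abs_add_le _ _).trans ?_
    rw [abs_mul, abs_mul, abs_of_nonneg (sq_nonneg C)]; norm_num
  rw [h3]; linarith

/-- Total squared covariance. -/
def trC (q : Ω → ℝ) (v : Ω → J → ℝ) : ℝ := ∑ i, ∑ j, cov q (fun x => v x i) (fun x => v x j) ^ 2

lemma trC_nonneg (q : Ω → ℝ) (v : Ω → J → ℝ) : 0 ≤ trC q v := by unfold trC; positivity

lemma twopt_sq {q : Ω → ℝ} (hq : IsP q) (v : Ω → J → ℝ) {K θ : ℝ} (hv : ∀ x j, |v x j| ≤ K) (hθ : 0 < θ) :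
    ∑ x, ∑ y, q x * q y * (∑ j, v x j * v y j - ∑ j, pm q (fun x => v x j) ^ 2) ^ 2
      ≤ trC q v * (1 + 1 / θ) + θ * ((Fintype.card J : ℝ) ^ 2 * K ^ 4) := by
  set m : J → ℝ := fun j => pm q (fun x => v x j) with hm
  have hmK : ∀ j, |m j| ≤ K := fun j => pm_abs_le hq fun x => hv x j
  set M := ∑ j, m j ^ 2 with hM
  have e1 : ∑ x, ∑ y, q x * q y * (∑ j, v x j * v y j - M) ^ 2
      = ∑ i, ∑ j, (pm q (fun x => v x i * v x j) ^ 2 - (m i * m j) ^ 2) := by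
    have a1 : ∑ x, ∑ y, q x * q y * (∑ j, v x j * v y j) ^ 2 = ∑ i, ∑ j, pm q (fun x => v x i * v x j) ^ 2 := by
      have : ∀ x y, q x * q y * (∑ j, v x j * v y j) ^ 2
          = ∑ i, ∑ j, (q x * (v x i * v x j)) * (q y * (v y i * v y j)) := by
        intro x y
        rw [sq, Finset.sum_mul_sum, Finset.mul_sum]
        refine Finset.sum_congr rfl fun i _ => ?_
        rw [Finset.mul_sum]
        exact Finset.sum_congr rfl fun j _ => by ring
      simp_rw [this]
      have c1 : ∀ i j, pm q (fun x => v x i * v x j) ^ 2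
          = ∑ x, ∑ y, (q x * (v x i * v x j)) * (q y * (v y i * v y j)) := by
        intro i j; rw [sq, pm, Finset.sum_mul_sum]
      simp_rw [c1]
      calc _ = ∑ x, ∑ i, ∑ y, ∑ j, (q x * (v x i * v x j)) * (q y * (v y i * v y j)) :=
            Finset.sum_congr rfl fun x _ => Finset.sum_comm
        _ = ∑ x, ∑ i, ∑ j, ∑ y, (q x * (v x i * v x j)) * (q y * (v y i * v y j)) :=
            Finset.sum_congr rfl fun x _ => Finset.sum_congr rfl fun i _ => Finset.sum_comm
        _ = ∑ i, ∑ x, ∑ j, ∑ y, (q x * (v x i * v x j)) * (q y * (v y i * v y j)) := Finset.sum_comm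
        _ = _ := Finset.sum_congr rfl fun i _ => Finset.sum_comm
    have a2 : ∑ x, ∑ y, q x * q y * (∑ j, v x j * v y j) = M := by
      have : ∀ x y, q x * q y * (∑ j, v x j * v y j) = ∑ j, (q x * v x j) * (q y * v y j) := by
        intro x y; rw [Finset.mul_sum]; exact Finset.sum_congr rfl fun j _ => by ring
      simp_rw [this]
      have c1 : ∀ j, m j ^ 2 = ∑ x, ∑ y, (q x * v x j) * (q y * v y j) := by
        intro j; rw [sq, hm]; simp only; rw [pm, Finset.sum_mul_sum]
      rw [hM]; simp_rw [c1]
      calc _ = ∑ x, ∑ j, ∑ y, (q x * v x j) * (q y * v y j) :=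
            Finset.sum_congr rfl fun x _ => Finset.sum_comm
        _ = _ := Finset.sum_comm
    have a3 : ∑ x, ∑ y, q x * q y = 1 := by rw [← Finset.sum_mul_sum, hq.2, one_mul]
    have a4 : ∑ i, ∑ j, (m i * m j) ^ 2 = M ^ 2 := by
      rw [hM, sq (∑ j, m j ^ 2), Finset.sum_mul_sum]
      exact Finset.sum_congr rfl fun i _ => Finset.sum_congr rfl fun j _ => by ring
    have : ∀ x y, q x * q y * (∑ j, v x j * v y j - M) ^ 2
        = q x * q y * (∑ j, v x j * v y j) ^ 2 - 2 * M * (q x * q y * (∑ j, v x j * v y j))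
          + M ^ 2 * (q x * q y) := by intro x y; ring
    simp_rw [this, Finset.sum_add_distrib, Finset.sum_sub_distrib, ← Finset.mul_sum]
    rw [a1, a4]
    simp_rw [Finset.mul_sum] at a2 a3 ⊢
    have a2' : ∑ x, ∑ y, ∑ j, 2 * M * (q x * q y * (v x j * v y j)) = 2 * M * M := by
      rw [← a2]
      simp_rw [Finset.mul_sum]
    have a3' : ∑ x, ∑ y, M ^ 2 * (q x * q y) = M ^ 2 := by
      simp_rw [← Finset.mul_sum] at a3 ⊢
      rw [a3, mul_one]
    have a2'' := a2'
    rw [a3', a2'']; ring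
  rw [e1, trC, Finset.sum_mul]
  have e2 : θ * ((Fintype.card J : ℝ) ^ 2 * K ^ 4) = ∑ i : J, ∑ j : J, θ * K ^ 4 := by
    simp; ring
  rw [e2, ← Finset.sum_add_distrib]
  refine Finset.sum_le_sum fun i _ => ?_
  rw [Finset.sum_mul, ← Finset.sum_add_distrib]
  refine Finset.sum_le_sum fun j _ => ?_
  have h1 := sqdiff_le (cov q (fun x => v x i) (fun x => v x j)) (m i * m j) hθ
  have h2 : cov q (fun x => v x i) (fun x => v x j) + m i * m j = pm q (fun x => v x i * v x j) := by
    rw [cov_eq hq]; ring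
  rw [h2] at h1
  have h3 : (m i * m j) ^ 2 ≤ K ^ 4 := by
    have a : m i ^ 2 ≤ K ^ 2 := by rw [← sq_abs]; exact pow_le_pow_left₀ (abs_nonneg _) (hmK i) 2
    have b : m j ^ 2 ≤ K ^ 2 := by rw [← sq_abs]; exact pow_le_pow_left₀ (abs_nonneg _) (hmK j) 2
    calc _ = m i ^ 2 * m j ^ 2 := by ring
      _ ≤ K ^ 2 * K ^ 2 := mul_le_mul a b (sq_nonneg _) (sq_nonneg _)
      _ = _ := by ring
  have h4 := le_abs_self (pm q (fun x => v x i * v x j) ^ 2 - (m i * m j) ^ 2)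
  have h5 := mul_le_mul_of_nonneg_left h3 hθ.le
  linarith

end BM
end

noncomputable section
set_option linter.unusedSectionVars false
set_option linter.unusedVariables false
namespace BM
variable {Ω A J S : Type} [Fintype Ω] [Fintype A] [Fintype J] [Fintype S]

/-- Channel of an added coordinate. -/
def dcav (τ h : ℝ) (v : Ω → J → ℝ) (σ : S → ℝ) (z : Ω × S) : J ⊕ Unit → ℝ :=
  Sum.elim (fun j => Real.sqrt τ * (σ z.2 * v z.1 j)) (fun _ => Real.sqrt h * σ z.2)

/-- Scalar overlap function. -/
def Fw (w : S → ℝ) (σ : S → ℝ) (γ : ℝ) : ℝ := ov w (fun s (_ : Unit) => Real.sqrt γ * σ s) σ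

/-- Mean-field version of the added channel. -/
def ecav (τ h : ℝ) (m : J → ℝ) (σ : S → ℝ) (s : S) : J ⊕ Unit → ℝ :=
  Sum.elim (fun j => Real.sqrt τ * (σ s * m j)) (fun _ => Real.sqrt h * σ s)

lemma elim_gram {τ h : ℝ} (hτ : 0 ≤ τ) (hh : 0 ≤ h) (a b : ℝ) (u v : J → ℝ) :
    ∑ i, (Sum.elim (fun j => Real.sqrt τ * (a * u j)) (fun _ => Real.sqrt h * a) : J ⊕ Unit → ℝ) i
      * (Sum.elim (fun j => Real.sqrt τ * (b * v j)) (fun _ => Real.sqrt h * b) : J ⊕ Unit → ℝ) i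
    = a * b * (τ * ∑ j, u j * v j + h) := by
  simp only [Fintype.sum_sum_type, Sum.elim_inl, Sum.elim_inr, Finset.univ_unique, Finset.sum_singleton]
  have h1 := Real.mul_self_sqrt hτ
  have h2 := Real.mul_self_sqrt hh
  have : ∀ j, Real.sqrt τ * (a * u j) * (Real.sqrt τ * (b * v j)) = τ * (a * b) * (u j * v j) := by
    intro j; linear_combination (a * u j * b * v j) * h1
  simp_rw [this]
  rw [← Finset.mul_sum]
  linear_combination a * b * h2

lemma ecav_ov {τ h : ℝ} (hτ : 0 ≤ τ) (hh : 0 ≤ h) (w : S → ℝ) (m : J → ℝ) (σ : S → ℝ) :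
    ov w (ecav τ h m σ) σ = Fw w σ (h + τ * ∑ j, m j ^ 2) := by
  refine ov_gram w _ _ (fun x y => ?_) σ
  simp only [ecav]
  rw [elim_gram hτ hh]
  have h3 : 0 ≤ h + τ * ∑ j, m j ^ 2 := by positivity
  have h2 := Real.mul_self_sqrt h3
  simp only [Finset.univ_unique, Finset.sum_singleton]
  have : ∑ j, m j * m j = ∑ j, m j ^ 2 := Finset.sum_congr rfl fun j _ => by ring
  rw [this]
  linear_combination (-σ x * σ y) * h2

/-- Constant in the cavity estimate. -/
def Ccav (K Λ : ℝ) : ℝ :=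
  3 * K ^ 2 / 2 * (3 * (Real.exp (K ^ 2 * (Λ * K ^ 2 + 1)) * K ^ 2) * Λ * (K ^ 4 + 1) + 1)

lemma dot_abs_le {K : ℝ} (u v : J → ℝ) (hu : ∀ j, |u j| ≤ K) (hv : ∀ j, |v j| ≤ K) :
    |∑ j, u j * v j| ≤ Fintype.card J * K ^ 2 := by
  refine (Finset.abs_sum_le_sum_abs _ _).trans ?_
  have : ∀ j, |u j * v j| ≤ K ^ 2 := by
    intro j; rw [abs_mul, sq]
    exact mul_le_mul (hu j) (hv j) (abs_nonneg _) ((abs_nonneg _).trans (hu j))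
  refine (Finset.sum_le_sum fun j _ => this j).trans ?_
  simp

/-- Cavity estimate. -/
lemma cavity {q : Ω → ℝ} {w : S → ℝ} (hq : IsP q) (hw : IsP w) (v : Ω → J → ℝ) (σ : S → ℝ)
    {K Λ τ h ε N : ℝ} (hv : ∀ x j, |v x j| ≤ K) (hσ : ∀ s, |σ s| ≤ K) (hK : 0 ≤ K) (hτ : 0 ≤ τ)
    (hN : 0 < N) (hJ : (Fintype.card J : ℝ) = N)
    (hΛ : τ * N ≤ Λ) (hh : 0 ≤ h) (hh1 : h ≤ 1) (hε : 0 < ε) (hε1 : ε ≤ 1) :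
    |ov (pp q w) (dcav τ h v σ) (fun z => σ z.2) - Fw w σ (h + τ * ∑ j, pm q (fun x => v x j) ^ 2)|
      ≤ Ccav K Λ * (trC q v / N ^ 2 / ε ^ 7 + ε) := by
  set m : J → ℝ := fun j => pm q (fun x => v x j) with hm
  have hmK : ∀ j, |m j| ≤ K := fun j => pm_abs_le hq fun x => hv x j
  rw [← ecav_ov hτ hh]
  set M := ∑ j, m j ^ 2 with hM
  have hMM : ∑ j, m j * m j = M := Finset.sum_congr rfl fun j _ => by ring
  set B := K ^ 2 * (Λ * K ^ 2 + 1) with hB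
  set R1 := ∑ x, ∑ y, q x * q y * |∑ j, v x j * v y j - M| with hR1
  have hR10 : 0 ≤ R1 := Finset.sum_nonneg fun x _ => Finset.sum_nonneg fun y _ =>
    mul_nonneg (mul_nonneg (hq.1 x) (hq.1 y)) (abs_nonneg _)
  have hΛ0 : 0 ≤ Λ := le_trans (by positivity) hΛ
  have hσ2 : ∀ s, σ s * σ s ≤ K ^ 2 := fun s => by
    rw [← sq, ← sq_abs]; exact pow_le_pow_left₀ (abs_nonneg _) (hσ s) 2
  have hbd : ∀ s (u v : J → ℝ), (∀ j, |u j| ≤ K) → (∀ j, |v j| ≤ K) →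
      σ s * σ s * (τ * ∑ j, u j * v j + h) ≤ B := by
    intro s u v hu hv
    have h1 := (abs_le.1 (dot_abs_le u v hu hv)).2
    rw [hJ] at h1
    have h2 : τ * ∑ j, u j * v j + h ≤ Λ * K ^ 2 + 1 := by
      have := mul_le_mul_of_nonneg_left h1 hτ
      have := mul_le_mul_of_nonneg_right hΛ (sq_nonneg K)
      nlinarith
    calc _ ≤ σ s * σ s * (Λ * K ^ 2 + 1) := mul_le_mul_of_nonneg_left h2 (mul_self_nonneg _)
      _ ≤ B := mul_le_mul_of_nonneg_right (hσ2 s) (by positivity)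
  have hxm : ∀ x, ∑ j, v x j * m j - M = ∑ y, q y * (∑ j, v x j * v y j - M) := by
    intro x
    simp_rw [mul_sub, Finset.sum_sub_distrib, ← Finset.sum_mul, hq.2, one_mul]
    congr 1
    simp_rw [Finset.mul_sum]
    rw [Finset.sum_comm]
    refine Finset.sum_congr rfl fun j _ => ?_
    rw [hm]; simp only; rw [pm, Finset.mul_sum]
    exact Finset.sum_congr rfl fun y _ => by ring
  have hxm' : ∑ x, q x * |∑ j, v x j * m j - M| ≤ R1 := by
    refine Finset.sum_le_sum fun x _ => ?_
    rw [hxm]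
    have : |∑ y, q y * (∑ j, v x j * v y j - M)| ≤ ∑ y, q y * |∑ j, v x j * v y j - M| := by
      refine (Finset.abs_sum_le_sum_abs _ _).trans (Finset.sum_le_sum fun y _ => ?_)
      rw [abs_mul, abs_of_nonneg (hq.1 y)]
    refine (mul_le_mul_of_nonneg_left this (hq.1 x)).trans (le_of_eq ?_)
    rw [Finset.mul_sum]; exact Finset.sum_congr rfl fun y _ => by ring
  have hdiff : ∀ s (a b : ℝ), σ s * σ s * (τ * a + h) ≤ B → σ s * σ s * (τ * b + h) ≤ B →
      |Real.exp (σ s * σ s * (τ * a + h)) - Real.exp (σ s * σ s * (τ * b + h))|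
        ≤ Real.exp B * K ^ 2 * τ * |a - b| := by
    intro s a b ha hb
    refine (exp_diff_le ha hb).trans ?_
    have : σ s * σ s * (τ * a + h) - σ s * σ s * (τ * b + h) = σ s * σ s * (τ * (a - b)) := by ring
    rw [this, abs_mul, abs_of_nonneg (mul_self_nonneg _), abs_mul τ, abs_of_nonneg hτ]
    have := mul_le_mul_of_nonneg_left (mul_le_mul_of_nonneg_right (hσ2 s)
      (mul_nonneg hτ (abs_nonneg (a - b)))) (Real.exp_pos B).le
    linarith
  have hV : ∀ s, ∫ Y, (∑ x, q x * el (dcav τ h v σ (x, s)) Y - el (ecav τ h m σ s) Y) ^ 2 ∂(gam (J ⊕ Unit))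
      ≤ 3 * (Real.exp B * K ^ 2) * τ * R1 := by
    intro s
    rw [disc_sq]
    simp only [dcav, ecav]
    simp_rw [elim_gram hτ hh, hMM]
    have hMB : σ s * σ s * (τ * M + h) ≤ B := by rw [← hMM]; exact hbd s m m hmK hmK
    set eM := Real.exp (σ s * σ s * (τ * M + h)) with heM
    have a1 : ∑ x, ∑ y, q x * q y * Real.exp (σ s * σ s * (τ * ∑ j, v x j * v y j + h))
        ≤ eM + Real.exp B * K ^ 2 * τ * R1 := by
      have : eM = ∑ x, ∑ y, q x * q y * eM := by
        simp_rw [← Finset.sum_mul]; rw [← Finset.sum_mul_sum, hq.2]; ring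
      rw [this, hR1]
      simp_rw [Finset.mul_sum]
      rw [← Finset.sum_add_distrib]
      refine Finset.sum_le_sum fun x _ => ?_
      rw [← Finset.sum_add_distrib]
      refine Finset.sum_le_sum fun y _ => ?_
      have h1 := hdiff s _ M (hbd s (v x) (v y) (hv x) (hv y)) hMB
      have h2 := (abs_le.1 h1).2
      have h3 := mul_le_mul_of_nonneg_left h2 (mul_nonneg (hq.1 x) (hq.1 y))
      rw [← Finset.mul_sum] 
      linarith
    have a2 : eM - Real.exp B * K ^ 2 * τ * R1
        ≤ ∑ x, q x * Real.exp (σ s * σ s * (τ * ∑ j, v x j * m j + h)) := by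
      have h0 : eM = ∑ x, q x * eM := by rw [← Finset.sum_mul, hq.2, one_mul]
      have h4 : Real.exp B * K ^ 2 * τ * ∑ x, q x * |∑ j, v x j * m j - M| ≤ Real.exp B * K ^ 2 * τ * R1 :=
        mul_le_mul_of_nonneg_left hxm' (by positivity)
      have h5 : ∑ x, q x * eM - Real.exp B * K ^ 2 * τ * ∑ x, q x * |∑ j, v x j * m j - M|
          ≤ ∑ x, q x * Real.exp (σ s * σ s * (τ * ∑ j, v x j * m j + h)) := by
        rw [Finset.mul_sum, ← Finset.sum_sub_distrib]
        refine Finset.sum_le_sum fun x _ => ?_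
        have h1 := hdiff s _ M (hbd s (v x) m (hv x) hmK) hMB
        have h2 := (abs_le.1 h1).1
        have h3 := mul_le_mul_of_nonneg_left h2 (hq.1 x)
        linarith
      linarith
    linarith
  have main := cav_gen hq hw (dcav τ h v σ) (ecav τ h m σ) hσ hK hε hV
  refine main.trans ?_
  -- bound R1
  have hR2 := twopt_sq hq v hv (show 0 < ε ^ 4 by positivity)
  set X := trC q v / N ^ 2 with hX
  have hX0 : 0 ≤ X := div_nonneg (trC_nonneg q v) (by positivity)
  have hT : trC q v = N ^ 2 * X := by rw [hX]; field_simp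
  rw [hT, hJ] at hR2
  have hR1' : R1 ≤ 1 / (2 * (ε ^ 2 * N)) * (∑ x, ∑ y, q x * q y * (∑ j, v x j * v y j - M) ^ 2)
      + (ε ^ 2 * N) / 2 := by
    have : (ε ^ 2 * N) / 2 = ∑ x, ∑ y, q x * q y * ((ε ^ 2 * N) / 2) := by
      simp_rw [← Finset.sum_mul]; rw [← Finset.sum_mul_sum, hq.2]; ring
    rw [this, hR1]
    simp_rw [Finset.mul_sum]
    rw [← Finset.sum_add_distrib]
    refine Finset.sum_le_sum fun x _ => ?_
    rw [← Finset.sum_add_distrib]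
    refine Finset.sum_le_sum fun y _ => ?_
    have h1 : |∑ j, v x j * v y j - M| ≤ 1 / (2 * (ε ^ 2 * N)) * (∑ j, v x j * v y j - M) ^ 2 + (ε ^ 2 * N) / 2 :=
      (abs_le_half (show 0 < ε ^ 2 * N by positivity)).trans (le_of_eq (by field_simp))
    have := mul_le_mul_of_nonneg_left h1 (mul_nonneg (hq.1 x) (hq.1 y))
    linarith
  have hR1'' : R1 ≤ N * (X / ε ^ 6 + ε ^ 2 * ((K ^ 4 + 1) / 2)) := by
    have h1 := mul_le_mul_of_nonneg_left hR2 (show 0 ≤ 1 / (2 * (ε ^ 2 * N)) by positivity)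
    have h2 : 1 / (2 * (ε ^ 2 * N)) * (N ^ 2 * X * (1 + 1 / ε ^ 4) + ε ^ 4 * (N ^ 2 * K ^ 4))
        = N * (X / (2 * ε ^ 6) * (ε ^ 4 + 1) + ε ^ 2 * (K ^ 4 / 2)) := by field_simp
    have h3 : X / (2 * ε ^ 6) * (ε ^ 4 + 1) ≤ X / ε ^ 6 := by
      have : ε ^ 4 + 1 ≤ 2 := by have := pow_le_one₀ hε.le hε1 (n := 4); linarith
      calc _ ≤ X / (2 * ε ^ 6) * 2 := mul_le_mul_of_nonneg_left this (by positivity)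
        _ = _ := by field_simp
    have h4 := mul_le_mul_of_nonneg_left h3 hN.le
    linarith
  have hτR : τ * R1 ≤ Λ * (X / ε ^ 6 + ε ^ 2 * ((K ^ 4 + 1) / 2)) := by
    have h0 : 0 ≤ X / ε ^ 6 + ε ^ 2 * ((K ^ 4 + 1) / 2) := by positivity
    calc τ * R1 ≤ τ * (N * (X / ε ^ 6 + ε ^ 2 * ((K ^ 4 + 1) / 2))) := mul_le_mul_of_nonneg_left hR1'' hτ
      _ = τ * N * (X / ε ^ 6 + ε ^ 2 * ((K ^ 4 + 1) / 2)) := by ring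
      _ ≤ _ := mul_le_mul_of_nonneg_right hΛ h0
  set E := 3 * (Real.exp B * K ^ 2) with hE
  have hE0 : 0 ≤ E := by positivity
  have hVb : E * τ * R1 / ε ≤ E * Λ * (K ^ 4 + 1) * (X / ε ^ 7 + ε) := by
    have h1 := mul_le_mul_of_nonneg_left hτR hE0
    rw [div_le_iff₀ hε]
    have h2 : E * Λ * (K ^ 4 + 1) * (X / ε ^ 7 + ε) * ε = E * (Λ * ((K ^ 4 + 1) * (X / ε ^ 6) + (K ^ 4 + 1) * ε ^ 2)) := by
      field_simp
    rw [h2]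
    have h3 : X / ε ^ 6 + ε ^ 2 * ((K ^ 4 + 1) / 2) ≤ (K ^ 4 + 1) * (X / ε ^ 6) + (K ^ 4 + 1) * ε ^ 2 := by
      have a : 0 ≤ X / ε ^ 6 := by positivity
      have b : 0 ≤ K ^ 4 := by positivity
      have c : 0 ≤ ε ^ 2 := by positivity
      nlinarith [mul_nonneg a b, mul_nonneg b c]
    have := mul_le_mul_of_nonneg_left (mul_le_mul_of_nonneg_left h3 hΛ0) hE0
    linarith
  have hW0 : 0 ≤ X / ε ^ 7 := by positivity
  have : (E * τ * R1 / ε + ε) / 2 ≤ 1 / 2 * ((E * Λ * (K ^ 4 + 1) + 1) * (X / ε ^ 7 + ε)) := by nlinarith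
  calc 3 * K ^ 2 * ((E * τ * R1 / ε + ε) / 2)
      ≤ 3 * K ^ 2 * (1 / 2 * ((E * Λ * (K ^ 4 + 1) + 1) * (X / ε ^ 7 + ε))) :=
        mul_le_mul_of_nonneg_left this (by positivity)
    _ = _ := by rw [Ccav, hE, hB]; ring

end BM
end

noncomputable section
set_option linter.unusedSectionVars false
set_option linter.unusedVariables false
namespace BM
variable {Ω A J S : Type} [Fintype Ω] [Fintype A] [Fintype J] [Fintype S]

lemma el_zero (Y : A → ℝ) : el (0 : A → ℝ) Y = 1 := by simp [el]

lemma int_sq_div (a b : A → ℝ) :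
    ∫ Y, (el a Y - 1) ^ 2 * (el b Y)⁻¹ ∂(gam A) = Real.exp (∑ i, (a i - b i) ^ 2)
      - 2 * Real.exp (∑ i, (a i - b i) * (- b i)) + Real.exp (∑ i, b i ^ 2) := by
  have i1 : Integrable (fun Y => el a Y * el a Y * (el b Y)⁻¹) (gam A) :=
    (((tame_el a).mul (tame_el a)).mul (tame_inv_el b)).integrable
  have i2 : Integrable (fun Y => 2 * (el a Y * el (0 : A → ℝ) Y * (el b Y)⁻¹)) (gam A) :=
    ((((tame_el a).mul (tame_el 0)).mul (tame_inv_el b)).integrable).const_mul 2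
  have i3 : Integrable (fun Y => el (0 : A → ℝ) Y * el (0 : A → ℝ) Y * (el b Y)⁻¹) (gam A) :=
    (((tame_el 0).mul (tame_el 0)).mul (tame_inv_el b)).integrable
  have e : ∀ Y, (el a Y - 1) ^ 2 * (el b Y)⁻¹ = el a Y * el a Y * (el b Y)⁻¹
     - 2 * (el a Y * el (0 : A → ℝ) Y * (el b Y)⁻¹) + el (0 : A → ℝ) Y * el (0 : A → ℝ) Y * (el b Y)⁻¹ := by
    intro Y; rw [el_zero]; ring
  simp_rw [e]
  have i12 : Integrable (fun Y => el a Y * el a Y * (el b Y)⁻¹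
     - 2 * (el a Y * el (0 : A → ℝ) Y * (el b Y)⁻¹)) (gam A) := i1.sub i2
  rw [integral_add i12 i3, integral_sub i1 i2, integral_const_mul, integral_el_el_div,
    integral_el_el_div, integral_el_el_div]
  simp only [Pi.zero_apply, zero_sub]
  congr 3
  · congr 1; funext i; ring
  · funext i; ring

/-- Constant for the scalar channel. -/
def Csc (K : ℝ) : ℝ := 9 * K ^ 2 * Real.exp (4 * K ^ 2) + 1

lemma Csc_ge (K : ℝ) : 1 ≤ Csc K := by unfold Csc; have : 0 ≤ 9 * K ^ 2 * Real.exp (4 * K ^ 2) := by positivity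
                                       linarith

lemma ov_small {p : S → ℝ} (hp : IsP p) (σ f : S → ℝ) {K δ : ℝ} (hσ : ∀ s, |σ s| ≤ K) (hδ : 0 ≤ δ) (hδ1 : δ ≤ 1) :
    ov p (sc δ (fun s (_ : Unit) => σ s)) f ≤ pm p f ^ 2
      + Csc K * δ * (pm p (fun s => f s ^ 2) - pm p f ^ 2) := by
  set c := sc δ (fun s (_ : Unit) => σ s) with hc
  set m := pm p f with hm
  set V := pm p (fun s => (f s - m) ^ 2) with hV
  have hVe : V = pm p (fun s => f s ^ 2) - m ^ 2 := by
    have := cov_eq hp f f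
    unfold cov at this
    rw [hV]
    convert this using 2
    · funext s; ring
    · congr 1; funext s; ring
    · rw [sq]
  have hV0 : 0 ≤ V := pm_nonneg hp fun s => sq_nonneg _
  have h1 := ov_sub_const hp c f m
  have h2 : ov p c (fun x => f x - m) ≤ Csc K * δ * V := by
    have hI : Integrable (fun Y => V * ∑ x, ∑ y, p x * p y * ((el (c x) Y - 1) ^ 2 * (el (c y) Y)⁻¹)) (gam Unit) := by
      refine Integrable.const_mul ?_ _
      refine integrable_finsetSum _ fun x _ => integrable_finsetSum _ fun y _ => Integrable.const_mul ?_ _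
      exact (((tame_el (c x)).sub (tame_const 1)).pow 2 |>.mul (tame_inv_el (c y))).integrable
    have hle : ov p c (fun x => f x - m)
        ≤ ∫ Y, V * ∑ x, ∑ y, p x * p y * ((el (c x) Y - 1) ^ 2 * (el (c y) Y)⁻¹) ∂(gam Unit) := by
      unfold ov
      refine integral_mono (tame_ovI hp c _).integrable hI fun Y => ?_
      have hN : Nc p c (fun x => f x - m) Y = ∑ x, p x * ((f x - m) * (el (c x) Y - 1)) := by
        have : ∑ x, p x * (f x - m) = 0 := by
          have : pm p (fun x => f x - m) = 0 := by rw [pm_sub, pm_const hp]; ring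
          simpa [pm] using this
        unfold Nc
        rw [← sub_eq_zero, ← Finset.sum_sub_distrib, ← this]
        exact Finset.sum_congr rfl fun x _ => by ring
      have hcs : Nc p c (fun x => f x - m) Y ^ 2 ≤ V * ∑ x, p x * (el (c x) Y - 1) ^ 2 := by
        rw [hN]
        have := Finset.sum_sq_le_sum_mul_sum_of_sq_le_mul Finset.univ (r := fun x => p x * ((f x - m) * (el (c x) Y - 1)))
          (f := fun x => p x * (f x - m) ^ 2) (g := fun x => p x * (el (c x) Y - 1) ^ 2)
          (fun x _ => mul_nonneg (hp.1 x) (sq_nonneg _)) (fun x _ => mul_nonneg (hp.1 x) (sq_nonneg _))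
          (fun x _ => le_of_eq (by ring))
        simpa [pm, hV] using this
      have hZ := inv_Zc_le hp c Y
      have hZp := Zc_pos hp c Y
      have hs0 : 0 ≤ ∑ x, p x * (el (c x) Y - 1) ^ 2 :=
        Finset.sum_nonneg fun x _ => mul_nonneg (hp.1 x) (sq_nonneg _)
      calc Nc p c (fun x => f x - m) Y ^ 2 / Zc p c Y
          = Nc p c (fun x => f x - m) Y ^ 2 * (Zc p c Y)⁻¹ := div_eq_mul_inv _ _
        _ ≤ (V * ∑ x, p x * (el (c x) Y - 1) ^ 2) * ∑ y, p y * (el (c y) Y)⁻¹ := by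
            refine mul_le_mul hcs hZ (inv_nonneg.2 hZp.le) (mul_nonneg hV0 hs0)
        _ = _ := by
            rw [mul_assoc, Finset.sum_mul_sum]
            congr 1
            exact Finset.sum_congr rfl fun x _ => Finset.sum_congr rfl fun y _ => by ring
    refine hle.trans ?_
    rw [integral_const_mul]
    have hxy : ∀ x y, ∫ Y, (el (c x) Y - 1) ^ 2 * (el (c y) Y)⁻¹ ∂(gam Unit) ≤ Csc K * δ := by
      intro x y
      rw [int_sq_div]
      simp only [Finset.univ_unique, Finset.sum_singleton]
      have e1 : ∀ u v : S, c u default * c v default = δ * (σ u * σ v) := by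
        intro u v; simp only [hc, sc]; linear_combination (σ u * σ v) * Real.mul_self_sqrt hδ
      have k1 : ∀ u v : S, |σ u * σ v| ≤ K ^ 2 := fun u v => by
        rw [abs_mul, sq]; exact mul_le_mul (hσ u) (hσ v) (abs_nonneg _) ((abs_nonneg _).trans (hσ u))
      have k2 : ∀ u v : S, |c u default * c v default| ≤ δ * K ^ 2 := fun u v => by
        rw [e1, abs_mul, abs_of_nonneg hδ]; exact mul_le_mul_of_nonneg_left (k1 u v) hδ
      have hxx := abs_le.1 (k2 x x)
      have hyy := abs_le.1 (k2 y y)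
      have hxy' := abs_le.1 (k2 x y)
      set a := c x default
      set b := c y default
      have hKd : δ * K ^ 2 ≤ K ^ 2 := by nlinarith [sq_nonneg K]
      have hKd0 : 0 ≤ δ * K ^ 2 := by positivity
      have a1 : |(a - b) ^ 2| ≤ 4 * (δ * K ^ 2) := by rw [abs_le]; constructor <;> nlinarith
      have a2 : |(a - b) * (-b)| ≤ 2 * (δ * K ^ 2) := by rw [abs_le]; constructor <;> nlinarith
      have a3 : |b ^ 2| ≤ δ * K ^ 2 := by rw [abs_le]; constructor <;> nlinarith
      have E : ∀ t r : ℝ, |t| ≤ r → r ≤ 4 * K ^ 2 → |Real.exp t - 1| ≤ Real.exp (4 * K ^ 2) * r := by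
        intro t r ht hr
        have := exp_diff_le (a := t) (b := 0) (B := 4 * K ^ 2) ((le_abs_self t).trans (ht.trans hr)) (by positivity)
        rw [Real.exp_zero, sub_zero] at this
        exact this.trans (mul_le_mul_of_nonneg_left ht (Real.exp_pos _).le)
      have b1 := (abs_le.1 (E _ _ a1 (by linarith))).2
      have b2 := (abs_le.1 (E _ _ a2 (by nlinarith [sq_nonneg K]))).1
      have b3 := (abs_le.1 (E _ _ a3 (by nlinarith [sq_nonneg K]))).2
      unfold Csc
      nlinarith
    have hfin : ∫ Y, ∑ x, ∑ y, p x * p y * ((el (c x) Y - 1) ^ 2 * (el (c y) Y)⁻¹) ∂(gam Unit) ≤ Csc K * δ := by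
      have hInt : ∀ x y, Integrable (fun Y => p x * p y * ((el (c x) Y - 1) ^ 2 * (el (c y) Y)⁻¹)) (gam Unit) :=
        fun x y => ((((tame_el (c x)).sub (tame_const 1)).pow 2 |>.mul (tame_inv_el (c y))).integrable).const_mul _
      rw [integral_finsetSum _ fun x _ => integrable_finsetSum _ fun y _ => hInt x y]
      have : ∀ x, ∫ Y, ∑ y, p x * p y * ((el (c x) Y - 1) ^ 2 * (el (c y) Y)⁻¹) ∂(gam Unit)
          ≤ ∑ y, p x * p y * (Csc K * δ) := by
        intro x
        rw [integral_finsetSum _ fun y _ => hInt x y]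
        refine Finset.sum_le_sum fun y _ => ?_
        rw [integral_const_mul]
        exact mul_le_mul_of_nonneg_left (hxy x y) (mul_nonneg (hp.1 x) (hp.1 y))
      refine (Finset.sum_le_sum fun x _ => this x).trans ?_
      simp_rw [← Finset.sum_mul, ← Finset.mul_sum, hp.2]
      simp [hp.2]
    nlinarith
  rw [← hVe]
  have : ov p c f = ov p c (fun x => f x - m) + m ^ 2 := by rw [h1, ← hm]; ring
  linarith
end BM
end

noncomputable section
set_option linter.unusedSectionVars false
set_option linter.unusedVariables false
namespace BM
variable {Ω A B J S : Type} [Fintype Ω] [Fintype A] [Fintype B] [Fintype J] [Fintype S]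

/-- The scalar channel. -/
def uch (σ : S → ℝ) (s : S) (_ : Unit) : ℝ := σ s

lemma Fw_eq (w σ : S → ℝ) (γ : ℝ) : Fw w σ γ = ov w (sc γ (uch σ)) σ := rfl

lemma sc_add_gram {a b : ℝ} (ha : 0 ≤ a) (hb : 0 ≤ b) (d : Ω → B → ℝ) (x y : Ω) :
    ∑ i, cd (sc a d) (sc b d) x i * cd (sc a d) (sc b d) y i = ∑ i, sc (a + b) d x i * sc (a + b) d y i := by
  rw [cd_gram, sc_gram ha, sc_gram hb, sc_gram (add_nonneg ha hb)]; ring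

lemma Fw_nonneg {w : S → ℝ} (hw : IsP w) (σ : S → ℝ) (γ : ℝ) : 0 ≤ Fw w σ γ := ov_nonneg hw _ _

lemma Fw_le {w : S → ℝ} (hw : IsP w) (σ : S → ℝ) (γ : ℝ) : Fw w σ γ ≤ pm w (fun s => σ s ^ 2) := ov_le hw _ _

lemma Fw_ge {w : S → ℝ} (hw : IsP w) (σ : S → ℝ) (γ : ℝ) : pm w σ ^ 2 ≤ Fw w σ γ := sq_le_ov hw _ _

lemma Fw_mono {w : S → ℝ} (hw : IsP w) (σ : S → ℝ) {a b : ℝ} (ha : 0 ≤ a) (hab : a ≤ b) :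
    Fw w σ a ≤ Fw w σ b := ov_sc_mono hw (uch σ) σ ha hab

lemma integral_Z_sq {p : Ω → ℝ} (hp : IsP p) (c : Ω → A → ℝ) (f : Ω → ℝ) :
    ∫ Y, Zc p c Y * pm (post p c Y) f ^ 2 ∂(gam A) = ov p c f := by
  unfold ov
  exact integral_congr_ae (Filter.Eventually.of_forall fun Y => (ovI_eq hp c Y f).symm)

lemma integral_Z_pm {p : Ω → ℝ} (hp : IsP p) (c : Ω → A → ℝ) (f : Ω → ℝ) :
    ∫ Y, Zc p c Y * pm (post p c Y) f ∂(gam A) = pm p f := by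
  rw [← integral_Nc p c f]
  exact integral_congr_ae (Filter.Eventually.of_forall fun Y => (Z_mul_pm_post hp c Y f))

lemma tame_Z_sq {p : Ω → ℝ} (hp : IsP p) (c : Ω → A → ℝ) (f : Ω → ℝ) :
    Tame (fun Y => Zc p c Y * pm (post p c Y) f ^ 2) := by
  have := tame_ovI hp c f
  convert this using 2 with Y
  exact (ovI_eq hp c Y f).symm

lemma tame_Z_pm {p : Ω → ℝ} (hp : IsP p) (c : Ω → A → ℝ) (f : Ω → ℝ) :
    Tame (fun Y => Zc p c Y * pm (post p c Y) f) := by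
  have := tame_Nc p c f
  convert this using 2 with Y
  exact (Z_mul_pm_post hp c Y f)

lemma Fw_lip1 {w : S → ℝ} (hw : IsP w) (σ : S → ℝ) {K γ δ : ℝ} (hσ : ∀ s, |σ s| ≤ K) (hγ : 0 ≤ γ) (hδ : 0 ≤ δ) :
    Fw w σ (γ + δ) - Fw w σ γ ≤ Csc K * δ * (pm w (fun s => σ s ^ 2) - Fw w σ γ) := by
  have hρ := Fw_le hw σ γ
  rcases le_or_gt δ 1 with h1 | h1
  · have e1 : Fw w σ (γ + δ) = ∫ Y, Zc w (sc γ (uch σ)) Y * ov (post w (sc γ (uch σ)) Y) (sc δ (uch σ)) σ ∂(gam Unit) := by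
      rw [← ov_chain hw, Fw_eq]
      exact (ov_gram w _ _ (fun x y => sc_add_gram hγ hδ _ x y) σ).symm
    set c := sc γ (uch σ) with hc
    have i1 : Integrable (fun Y => (1 - Csc K * δ) * (Zc w c Y * pm (post w c Y) σ ^ 2)) (gam Unit) :=
      ((tame_Z_sq hw c σ).integrable).const_mul _
    have i2 : Integrable (fun Y => Csc K * δ * (Zc w c Y * pm (post w c Y) (fun s => σ s ^ 2))) (gam Unit) :=
      ((tame_Z_pm hw c (fun s => σ s ^ 2)).integrable).const_mul _
    have e2 : Fw w σ (γ + δ) ≤ ∫ Y, ((1 - Csc K * δ) * (Zc w c Y * pm (post w c Y) σ ^ 2)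
        + Csc K * δ * (Zc w c Y * pm (post w c Y) (fun s => σ s ^ 2))) ∂(gam Unit) := by
      rw [e1]
      refine integral_mono (tame_Z_ov_post hw c _ σ).integrable (i1.add i2) fun Y => ?_
      have := mul_le_mul_of_nonneg_left (ov_small (isP_post hw c Y) σ σ hσ hδ h1) (Zc_pos hw c Y).le
      refine this.trans (le_of_eq ?_)
      ring
    rw [integral_add i1 i2, integral_const_mul, integral_const_mul, integral_Z_sq hw, integral_Z_pm hw] at e2
    rw [Fw_eq w σ γ]
    linarith
  · have h2 := Fw_le hw σ (γ + δ)
    have h3 : 1 ≤ Csc K * δ := by nlinarith [Csc_ge K]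
    nlinarith

lemma Fw_lip {w : S → ℝ} (hw : IsP w) (σ : S → ℝ) {K a b m : ℝ} (hσ : ∀ s, |σ s| ≤ K) (hm : 0 ≤ m) (ha : m ≤ a) (hb : m ≤ b) :
    |Fw w σ a - Fw w σ b| ≤ Csc K * (pm w (fun s => σ s ^ 2) - Fw w σ m) * |a - b| := by
  wlog hab : b ≤ a generalizing a b
  · rw [abs_sub_comm, abs_sub_comm a b]; exact this hb ha (le_of_not_ge hab)
  have h1 := Fw_lip1 hw σ hσ (hm.trans hb) (sub_nonneg.2 hab)
  have h2 := Fw_mono hw σ (hm.trans hb) hab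
  have h3 := Fw_mono hw σ hm hb
  rw [add_sub_cancel] at h1
  rw [abs_of_nonneg (sub_nonneg.2 h2), abs_of_nonneg (sub_nonneg.2 hab)]
  refine h1.trans ?_
  have : 0 ≤ Csc K * (a - b) := mul_nonneg (by linarith [Csc_ge K]) (sub_nonneg.2 hab)
  nlinarith

lemma pm_sq_le_K {w : S → ℝ} (hw : IsP w) {σ : S → ℝ} {K : ℝ} (hσ : ∀ s, |σ s| ≤ K) : pm w (fun s => σ s ^ 2) ≤ K ^ 2 := by
  refine (pm_le hw (g := fun _ => K ^ 2) fun s => ?_).trans (le_of_eq (pm_const hw _))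
  exact sq_le_sq' (abs_le.1 (hσ s)).1 (abs_le.1 (hσ s)).2

lemma Fw_lip0 {w : S → ℝ} (hw : IsP w) (σ : S → ℝ) {K a b : ℝ} (hσ : ∀ s, |σ s| ≤ K) (ha : 0 ≤ a) (hb : 0 ≤ b) :
    |Fw w σ a - Fw w σ b| ≤ Csc K * K ^ 2 * |a - b| := by
  refine (Fw_lip hw σ hσ le_rfl ha hb).trans ?_
  have := pm_sq_le_K hw hσ
  have := Fw_nonneg hw σ 0
  have := Csc_ge K
  gcongr
  linarith

lemma Fw_zero {w : S → ℝ} (hw : IsP w) (σ : S → ℝ) : Fw w σ 0 = pm w σ ^ 2 := by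
  obtain ⟨K, hK, hb⟩ := bounded_of_fin (uch σ)
  refine le_antisymm ?_ (Fw_ge hw σ 0)
  have := ov_small hw σ σ (K := K) (δ := 0) (fun s => hb s ()) le_rfl zero_le_one
  rw [Fw_eq]
  simp only [mul_zero, zero_mul, add_zero] at this
  exact this

/-- `γ · mmse(γ) → 0` for a finitely supported prior. -/
lemma Fw_decay {w : S → ℝ} (hw : IsP w) (σ : S → ℝ) {ε : ℝ} (hε : 0 < ε) :
    ∃ G : ℝ, 0 < G ∧ ∀ γ, G ≤ γ → γ * (pm w (fun s => σ s ^ 2) - Fw w σ γ) ≤ ε := by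
  set ρ := pm w (fun s => σ s ^ 2) with hρ
  set I : ℝ → ℝ := fun γ => ρ * γ / 2 - Phi w (sc γ (uch σ)) with hI
  have hstep : ∀ γ δ, 0 ≤ γ → 0 ≤ δ → δ / 2 * (ρ - Fw w σ (γ + δ)) ≤ I (γ + δ) - I γ := by
    intro γ δ hγ hδ
    have h1 := Phi_cd_le hw (sc γ (uch σ)) (sc δ (uch σ))
    have h2 : Phi w (cd (sc γ (uch σ)) (sc δ (uch σ))) = Phi w (sc (γ + δ) (uch σ)) :=
      Phi_gram w _ _ fun x y => sc_add_gram hγ hδ _ x y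
    have h3 : ov w (cd (sc γ (uch σ)) (sc δ (uch σ))) (fun x => sc δ (uch σ) x ()) = δ * Fw w σ (γ + δ) := by
      rw [ov_gram w _ _ (fun x y => sc_add_gram hγ hδ _ x y), Fw_eq]
      have e : ∀ Y, Nc w (sc (γ + δ) (uch σ)) (fun x => sc δ (uch σ) x ()) Y = √δ * Nc w (sc (γ + δ) (uch σ)) σ Y := by
        intro Y; unfold Nc; rw [Finset.mul_sum]
        exact Finset.sum_congr rfl fun s _ => by simp only [sc, uch]; ring
      unfold ov
      rw [← integral_const_mul]
      congr 1; funext Y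
      rw [e, mul_pow, Real.sq_sqrt hδ]; ring
    simp only [Finset.univ_unique, Finset.sum_singleton] at h1
    have h3' : ov w (cd (sc γ (uch σ)) (sc δ (uch σ))) (fun x => sc δ (uch σ) x default) = δ * Fw w σ (γ + δ) := h3
    rw [h2, h3'] at h1
    simp only [hI]
    linarith
  have hmono : ∀ a b, 0 ≤ a → a ≤ b → I a ≤ I b := by
    intro a b ha hab
    have h := hstep a (b - a) ha (sub_nonneg.2 hab)
    rw [add_sub_cancel] at h
    have h' : 0 ≤ (b - a) / 2 * (ρ - Fw w σ b) := mul_nonneg (by linarith) (sub_nonneg.2 (Fw_le hw σ b))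
    linarith
  have hbd : ∀ γ, 0 ≤ γ → I γ ≤ - ∑ s, w s * Real.log (w s) := by
    intro γ hγ
    have h := Phi_ge_entropy hw (sc γ (uch σ))
    have e : pm w (fun x => ∑ a, sc γ (uch σ) x a ^ 2) = γ * ρ := by
      rw [hρ, ← pm_smul]; congr 1; funext s
      simp only [Finset.univ_unique, Finset.sum_singleton, sc, uch]
      rw [mul_pow, Real.sq_sqrt hγ]
    rw [e] at h
    simp only [hI]; linarith
  set T : Set ℝ := I '' Set.Ici 0 with hT
  have hTb : BddAbove T := ⟨_, by rintro _ ⟨γ, hγ, rfl⟩; exact hbd γ hγ⟩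
  have hTn : T.Nonempty := ⟨I 0, 0, by simp, rfl⟩
  obtain ⟨_, ⟨g, hg, rfl⟩, hlt⟩ := exists_lt_of_lt_csSup hTn (show sSup T - ε / 4 < sSup T by linarith)
  simp only [Set.mem_Ici] at hg
  refine ⟨2 * g + 1, by linarith, fun γ hγ => ?_⟩
  have h1 := hstep (γ / 2) (γ / 2) (by linarith) (by linarith)
  rw [add_halves] at h1
  have h2 : I γ ≤ sSup T := le_csSup hTb ⟨γ, by simp only [Set.mem_Ici]; linarith, rfl⟩
  have h3 := hmono g (γ / 2) hg (by linarith)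
  linarith
end BM
end

noncomputable section
set_option linter.unusedSectionVars false
set_option linter.unusedVariables false
namespace BM
variable {Ω A B I J S : Type} [Fintype Ω] [Fintype A] [Fintype B] [Fintype I] [Fintype J] [Fintype S]

/-- Bounded measurable functions. -/
def BM' (g : (A → ℝ) → ℝ) : Prop := Measurable g ∧ ∃ C : ℝ, ∀ Y, |g Y| ≤ C

lemma BM'.add {f g : (A → ℝ) → ℝ} (hf : BM' f) (hg : BM' g) : BM' (fun Y => f Y + g Y) := by
  obtain ⟨h1, C, hC⟩ := hf
  obtain ⟨h2, D, hD⟩ := hg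
  exact ⟨h1.add h2, C + D, fun Y => (abs_add_le _ _).trans (add_le_add (hC Y) (hD Y))⟩

lemma BM'.mul {f g : (A → ℝ) → ℝ} (hf : BM' f) (hg : BM' g) : BM' (fun Y => f Y * g Y) := by
  obtain ⟨h1, C, hC⟩ := hf
  obtain ⟨h2, D, hD⟩ := hg
  refine ⟨h1.mul h2, C * D, fun Y => ?_⟩
  rw [abs_mul]
  exact mul_le_mul (hC Y) (hD Y) (abs_nonneg _) ((abs_nonneg _).trans (hC Y))

lemma BM'.const (r : ℝ) : BM' (fun _ : A → ℝ => r) := ⟨measurable_const, |r|, fun _ => le_rfl⟩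

lemma BM'.sub {f g : (A → ℝ) → ℝ} (hf : BM' f) (hg : BM' g) : BM' (fun Y => f Y - g Y) := by
  have := hf.add ((BM'.const (-1)).mul hg)
  simpa [sub_eq_add_neg] using this

lemma BM'.sq {f : (A → ℝ) → ℝ} (hf : BM' f) : BM' (fun Y => f Y ^ 2) := by
  simpa [pow_two] using hf.mul hf

lemma BM'.abs {f : (A → ℝ) → ℝ} (hf : BM' f) : BM' (fun Y => |f Y|) := by
  obtain ⟨h1, C, hC⟩ := hf
  exact ⟨h1.abs, C, fun Y => by rw [abs_abs]; exact hC Y⟩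

lemma BM'.sum {ι : Type} (s : Finset ι) {f : ι → (A → ℝ) → ℝ} (hf : ∀ i, BM' (f i)) :
    BM' (fun Y => ∑ i ∈ s, f i Y) := by
  classical
  induction s using Finset.induction_on with
  | empty => simpa using BM'.const (A := A) 0
  | insert a s ha ih => simp_rw [Finset.sum_insert ha]; exact (hf a).add ih

lemma bm_pm {p : Ω → ℝ} (hp : IsP p) (c : Ω → A → ℝ) (f : Ω → ℝ) : BM' (fun Y => pm (post p c Y) f) := by
  obtain ⟨K, hK, hb⟩ := bounded_of_fin (fun x (_ : Unit) => f x)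
  refine ⟨?_, K, fun Y => pm_abs_le (isP_post hp c Y) fun x => hb x ()⟩
  simp_rw [pm_post]
  exact (tame_Nc p c f).meas.div (tame_Zc p c).meas

lemma bm_trC {p : Ω → ℝ} (hp : IsP p) (c : Ω → A → ℝ) (v : Ω → J → ℝ) : BM' (fun Y => trC (post p c Y) v) := by
  unfold trC
  refine BM'.sum _ fun i => BM'.sum _ fun j => BM'.sq ?_
  simp_rw [fun Y => cov_eq (isP_post hp c Y)]
  exact (bm_pm hp c _).sub ((bm_pm hp c _).mul (bm_pm hp c _))

/-- Average over the planted law. -/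
def av (p : Ω → ℝ) (c : Ω → A → ℝ) (g : (A → ℝ) → ℝ) : ℝ := ∫ Y, Zc p c Y * g Y ∂(gam A)

lemma tame_av (p : Ω → ℝ) (c : Ω → A → ℝ) {g : (A → ℝ) → ℝ} (hg : BM' g) :
    Tame (fun Y => Zc p c Y * g Y) := by
  obtain ⟨h1, C, hC⟩ := hg
  refine ((tame_Zc p c).mul_const C).of_le ((tame_Zc p c).meas.mul h1) fun Y => ?_
  rw [abs_mul, abs_mul]
  exact mul_le_mul_of_nonneg_left ((hC Y).trans (le_abs_self _)) (abs_nonneg _)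

lemma av_add (p : Ω → ℝ) (c : Ω → A → ℝ) {f g : (A → ℝ) → ℝ} (hf : BM' f) (hg : BM' g) :
    av p c (fun Y => f Y + g Y) = av p c f + av p c g := by
  unfold av
  rw [← integral_add (tame_av p c hf).integrable (tame_av p c hg).integrable]
  congr 1; funext Y; ring

lemma av_smul (p : Ω → ℝ) (c : Ω → A → ℝ) (r : ℝ) (f : (A → ℝ) → ℝ) :
    av p c (fun Y => r * f Y) = r * av p c f := by
  unfold av
  rw [← integral_const_mul]
  congr 1; funext Y; ring

lemma av_const {p : Ω → ℝ} (hp : IsP p) (c : Ω → A → ℝ) (r : ℝ) : av p c (fun _ => r) = r := by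
  unfold av
  rw [integral_mul_const, integral_Zc hp, one_mul]

lemma av_mono {p : Ω → ℝ} (hp : IsP p) (c : Ω → A → ℝ) {f g : (A → ℝ) → ℝ} (hf : BM' f) (hg : BM' g)
    (h : ∀ Y, f Y ≤ g Y) : av p c f ≤ av p c g :=
  integral_mono (tame_av p c hf).integrable (tame_av p c hg).integrable
    fun Y => mul_le_mul_of_nonneg_left (h Y) (Zc_pos hp c Y).le

lemma av_sub (p : Ω → ℝ) (c : Ω → A → ℝ) {f g : (A → ℝ) → ℝ} (hf : BM' f) (hg : BM' g) :
    av p c (fun Y => f Y - g Y) = av p c f - av p c g := by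
  unfold av
  rw [← integral_sub (tame_av p c hf).integrable (tame_av p c hg).integrable]
  congr 1; funext Y; ring

lemma av_abs {p : Ω → ℝ} (hp : IsP p) (c : Ω → A → ℝ) {f : (A → ℝ) → ℝ} (hf : BM' f) :
    |av p c f| ≤ av p c (fun Y => |f Y|) := by
  unfold av
  refine (abs_integral_le_integral_abs).trans (le_of_eq ?_)
  congr 1; funext Y
  rw [abs_mul, abs_of_pos (Zc_pos hp c Y)]

lemma av_sum (p : Ω → ℝ) (c : Ω → A → ℝ) {ι : Type} (s : Finset ι) {f : ι → (A → ℝ) → ℝ} (hf : ∀ i, BM' (f i)) :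
    av p c (fun Y => ∑ i ∈ s, f i Y) = ∑ i ∈ s, av p c (f i) := by
  unfold av
  simp_rw [Finset.mul_sum]
  exact integral_finsetSum _ fun i _ => (tame_av p c (hf i)).integrable

lemma av_sq {p : Ω → ℝ} (hp : IsP p) (c : Ω → A → ℝ) (f : Ω → ℝ) :
    av p c (fun Y => pm (post p c Y) f ^ 2) = ov p c f := integral_Z_sq hp c f

lemma bm_ov {p : Ω → ℝ} (hp : IsP p) (c : Ω → A → ℝ) (d : Ω → B → ℝ) (f : Ω → ℝ) :
    BM' (fun Y => ov (post p c Y) d f) := by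
  obtain ⟨K, hK, hb⟩ := bounded_of_fin (fun x (_ : Unit) => f x)
  refine ⟨?_, K ^ 2, fun Y => ?_⟩
  · have h1 := (tame_Z_ov_post hp c d f).meas.div (tame_Zc p c).meas
    have : (fun Y => ov (post p c Y) d f) = fun Y => Zc p c Y * ov (post p c Y) d f / Zc p c Y := by
      funext Y; field_simp [(Zc_pos hp c Y).ne']
    rw [this]; exact h1
  · rw [abs_of_nonneg (ov_nonneg (isP_post hp c Y) _ _)]
    exact ov_le_sq (isP_post hp c Y) d fun x => hb x ()

lemma av_ov {p : Ω → ℝ} (hp : IsP p) (c : Ω → A → ℝ) (d : Ω → B → ℝ) (f : Ω → ℝ) :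
    av p c (fun Y => ov (post p c Y) d f) = ov p (cd c d) f := (ov_chain hp c d f).symm

/-- Thermal concentration, averaged. -/
lemma thermal_av {p : Ω → ℝ} (hp : IsP p) (c : Ω → A → ℝ) (X : Ω → I → ℝ) {K δ : ℝ} (hδ : 0 ≤ δ)
    (hK : ∀ x i, |X x i| ≤ K) :
    δ * av p c (fun Y => trC (post p c Y) X) ≤ (1 + δ * (Fintype.card I * K ^ 2))
      * (∑ i, ov p (cd c (sc δ X)) (fun x => X x i) - ∑ i, ov p c (fun x => X x i)) := by
  have h1 : ∀ i : I, BM' (fun Y => ov (post p c Y) (sc δ X) (fun x => X x i)) := fun i => bm_ov hp c _ _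
  have h2 : ∀ i : I, BM' (fun Y => pm (post p c Y) (fun x => X x i) ^ 2) := fun i => (bm_pm hp c _).sq
  have := av_mono hp c (f := fun Y => δ * trC (post p c Y) X)
    (g := fun Y => (1 + δ * (Fintype.card I * K ^ 2)) * ∑ i, (ov (post p c Y) (sc δ X) (fun x => X x i)
      - pm (post p c Y) (fun x => X x i) ^ 2)) ((BM'.const δ).mul (bm_trC hp c X))
      ((BM'.const _).mul (BM'.sum _ fun i => (h1 i).sub (h2 i))) (fun Y => thermal (isP_post hp c Y) X hδ hK)
  rw [av_smul, av_smul, av_sum p c _ (fun i => (h1 i).sub (h2 i))] at this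
  refine this.trans (le_of_eq ?_)
  rw [← Finset.sum_sub_distrib]
  congr 1
  refine Finset.sum_congr rfl fun i _ => ?_
  rw [av_sub p c (h1 i) (h2 i), av_ov hp, av_sq hp]

lemma ov_mul_const (p : Ω → ℝ) (c : Ω → A → ℝ) (f : Ω → ℝ) (r : ℝ) : ov p c (fun x => r * f x) = r ^ 2 * ov p c f := by
  have e : ∀ Y, Nc p c (fun x => r * f x) Y = r * Nc p c f Y := by
    intro Y; unfold Nc; rw [Finset.mul_sum]
    exact Finset.sum_congr rfl fun s _ => by ring
  unfold ov
  rw [← integral_const_mul]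
  congr 1; funext Y
  rw [e, mul_pow]; ring

lemma ov_sc (p : Ω → ℝ) (c : Ω → A → ℝ) (d : Ω → B → ℝ) {δ : ℝ} (hδ : 0 ≤ δ) (b : B) :
    ov p c (fun x => sc δ d x b) = δ * ov p c (fun x => d x b) := by
  unfold sc
  rw [ov_mul_const, Real.sq_sqrt hδ]

/-- Quenched concentration with strength `δ`. -/
lemma quenched_av {p : Ω → ℝ} (hp : IsP p) (c : Ω → A → ℝ) (d : Ω → B → ℝ) {δ : ℝ} (hδ : 0 < δ) :
    av p c (fun Y => |∑ b, pm (post p c Y) (fun x => d x b) ^ 2 - ∑ b, ov p c (fun x => d x b)|)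
      ≤ 2 * (fl p c + fl p (cd c (sc δ d))) / δ
        + 2 * (∑ b, ov p (cd c (sc δ d)) (fun x => d x b) - ∑ b, ov p c (fun x => d x b)) := by
  have h := quenched hp c (sc δ d)
  simp_rw [ov_sc p _ d hδ.le, ← Finset.mul_sum] at h
  have e : ∀ Y, |∑ b, pm (post p c Y) (fun x => sc δ d x b) ^ 2 - δ * ∑ b, ov p c (fun x => d x b)|
      = δ * |∑ b, pm (post p c Y) (fun x => d x b) ^ 2 - ∑ b, ov p c (fun x => d x b)| := by
    intro Y
    have : ∀ b, pm (post p c Y) (fun x => sc δ d x b) ^ 2 = δ * pm (post p c Y) (fun x => d x b) ^ 2 := by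
      intro b; unfold sc; rw [pm_smul, mul_pow, Real.sq_sqrt hδ.le]
    simp_rw [this]
    rw [← Finset.mul_sum, ← mul_sub, abs_mul, abs_of_pos hδ]
  simp_rw [e] at h
  have h' : δ * av p c (fun Y => |∑ b, pm (post p c Y) (fun x => d x b) ^ 2 - ∑ b, ov p c (fun x => d x b)|)
      ≤ 2 * (fl p c + fl p (cd c (sc δ d))) + 2 * (δ * ∑ b, ov p (cd c (sc δ d)) (fun x => d x b)
        - δ * ∑ b, ov p c (fun x => d x b)) := by
    rw [← av_smul]; exact h
  rw [div_add' _ _ _ hδ.ne', le_div_iff₀ hδ]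
  linarith
end BM
end

noncomputable section
set_option linter.unusedSectionVars false
set_option linter.unusedVariables false
namespace BM
variable {Ω A B I J R C S : Type} [Fintype Ω] [Fintype A] [Fintype B] [Fintype I] [Fintype J] [Fintype S]
  [Fintype R] [Fintype C]

lemma Nc_fst (p : Ω → ℝ) {w : S → ℝ} (hw : IsP w) (c : Ω → A → ℝ) (f : Ω → ℝ) (Y : A → ℝ) :
    Nc (pp p w) (fun z => c z.1) (fun z => f z.1) Y = Nc p c f Y := by
  simp only [Nc, pp, Fintype.sum_prod_type]
  refine Finset.sum_congr rfl fun x _ => ?_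
  have : ∀ s, p x * w s * f x * el (c x) Y = p x * f x * el (c x) Y * w s := fun s => by ring
  simp_rw [this]
  rw [← Finset.mul_sum, hw.2, mul_one]

lemma Zc_fst (p : Ω → ℝ) {w : S → ℝ} (hw : IsP w) (c : Ω → A → ℝ) (Y : A → ℝ) :
    Zc (pp p w) (fun z => c z.1) Y = Zc p c Y := by
  have := Nc_fst p hw c (fun _ => 1) Y
  simpa [Nc, Zc] using this

lemma ov_fst (p : Ω → ℝ) {w : S → ℝ} (hw : IsP w) (c : Ω → A → ℝ) (f : Ω → ℝ) :
    ov (pp p w) (fun z => c z.1) (fun z => f z.1) = ov p c f := by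
  unfold ov; simp_rw [Nc_fst p hw, Zc_fst p hw]

lemma Phi_fst (p : Ω → ℝ) {w : S → ℝ} (hw : IsP w) (c : Ω → A → ℝ) :
    Phi (pp p w) (fun z => c z.1) = Phi p c := by
  unfold Phi; simp_rw [Zc_fst p hw]

lemma post_fst (p : Ω → ℝ) {w : S → ℝ} (hw : IsP w) (c : Ω → A → ℝ) (Y : A → ℝ) :
    post (pp p w) (fun z => c z.1) Y = pp (post p c Y) w := by
  funext z
  simp only [post, Zc_fst p hw, pp]; ring

/-- Extended channel. -/
def ext (c : Ω → A → ℝ) (d : Ω × S → B → ℝ) : Ω × S → A ⊕ B → ℝ := cd (fun z => c z.1) d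

lemma ov_ext_ge {p : Ω → ℝ} {w : S → ℝ} (hp : IsP p) (hw : IsP w) (c : Ω → A → ℝ) (d : Ω × S → B → ℝ) (f : Ω → ℝ) :
    ov p c f ≤ ov (pp p w) (ext c d) (fun z => f z.1) := by
  rw [← ov_fst p hw]; exact ov_le_cd (isP_pp hp hw) _ _ _

lemma Phi_ext_ge {p : Ω → ℝ} {w : S → ℝ} (hp : IsP p) (hw : IsP w) (c : Ω → A → ℝ) (d : Ω × S → B → ℝ) :
    Phi p c ≤ Phi (pp p w) (ext c d) := by
  have := Phi_cd_ge (isP_pp hp hw) (fun z => c z.1) d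
  rw [Phi_fst p hw] at this
  refine le_trans ?_ this
  have : 0 ≤ (∑ b, ov (pp p w) (fun z => c z.1) (fun x => d x b)) :=
    Finset.sum_nonneg fun b _ => ov_nonneg (isP_pp hp hw) _ _
  linarith

lemma Phi_ext_le {p : Ω → ℝ} {w : S → ℝ} (hp : IsP p) (hw : IsP w) (c : Ω → A → ℝ) (d : Ω × S → B → ℝ) {D : ℝ}
    (hD : ∀ z, ∑ b, d z b ^ 2 ≤ D) :
    Phi (pp p w) (ext c d) ≤ Phi p c + D / 2 := by
  have hpp := isP_pp hp hw
  have := Phi_cd_le hpp (fun z => c z.1) d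
  rw [Phi_fst p hw] at this
  have h2 : ∑ b, ov (pp p w) (cd (fun z => c z.1) d) (fun x => d x b) ≤ D := by
    refine (Finset.sum_le_sum fun b _ => ov_le hpp _ _).trans ?_
    rw [← pm_sum]
    exact (pm_le hpp hD).trans (le_of_eq (pm_const hpp D))
  exact this.trans (by linarith)

/-- Adding a coordinate does not change the overlaps much. -/
lemma ext_diff {p : Ω → ℝ} {w : S → ℝ} (hp : IsP p) (hw : IsP w) (c : Ω → A → ℝ) (d : Ω × S → B → ℝ) {D δ : ℝ}
    (hD : ∀ z, ∑ b, d z b ^ 2 ≤ D) (hδ : 0 < δ) (X : Ω → I → ℝ) :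
    ∑ i, ov (pp p w) (ext c d) (fun z => X z.1 i) ≤ ∑ i, ov p (cd c (sc δ X)) (fun x => X x i) + D / δ := by
  have hpp := isP_pp hp hw
  have h1 := Phi_cd_ge hpp (ext c d) (fun z => sc δ X z.1)
  have h2 := Phi_cd_le hp c (sc δ X)
  have h3 := Phi_ext_le hp hw (cd c (sc δ X)) d hD
  have h4 := Phi_ext_ge hp hw c d
  have h5 : Phi (pp p w) (cd (ext c d) (fun z => sc δ X z.1)) = Phi (pp p w) (ext (cd c (sc δ X)) d) := by
    refine Phi_gram _ _ _ fun x y => ?_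
    unfold ext
    rw [cd_gram, cd_gram, cd_gram, cd_gram]; ring
  have e1 : ∀ i, ov (pp p w) (ext c d) (fun z => sc δ X z.1 i) = δ * ov (pp p w) (ext c d) (fun z => X z.1 i) :=
    fun i => ov_sc (pp p w) (ext c d) (fun z => X z.1) hδ.le i
  simp_rw [e1, ← Finset.mul_sum] at h1
  simp_rw [ov_sc p _ X hδ.le, ← Finset.mul_sum] at h2
  rw [h5] at h1
  rw [← sub_le_iff_le_add', le_div_iff₀ hδ]
  linarith

lemma BM'.comp_lip {g : (A → ℝ) → ℝ} (hg : BM' g) {F : ℝ → ℝ} (hF : Continuous F) : BM' (fun Y => F (g Y)) := by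
  obtain ⟨h1, C, hC⟩ := hg
  refine ⟨hF.measurable.comp h1, ?_⟩
  obtain ⟨M, hM⟩ := (isCompact_Icc (a := -C) (b := C)).exists_bound_of_continuousOn hF.continuousOn
  exact ⟨M, fun Y => hM _ (abs_le.1 (hC Y))⟩

/-- The cavity equation. -/
lemma cav_eq {p : Ω → ℝ} {w : S → ℝ} (hp : IsP p) (hw : IsP w) (c : Ω → A → ℝ) (v : Ω → J → ℝ) (σ : S → ℝ)
    {K Λ τ h ε N : ℝ} (hv : ∀ x j, |v x j| ≤ K) (hσ : ∀ s, |σ s| ≤ K) (hK : 0 ≤ K) (hτ : 0 ≤ τ)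
    (hN : 0 < N) (hJ : (Fintype.card J : ℝ) = N)
    (hΛ : τ * N ≤ Λ) (hh : 0 ≤ h) (hh1 : h ≤ 1) (hε : 0 < ε) (hε1 : ε ≤ 1) :
    |ov (pp p w) (ext c (dcav τ h v σ)) (fun z => σ z.2) - Fw w σ (h + τ * ∑ j, ov p c (fun x => v x j))|
      ≤ Ccav K Λ * (av p c (fun Y => trC (post p c Y) v) / N ^ 2 / ε ^ 7 + ε)
        + Csc K * K ^ 2 * τ * av p c (fun Y => |∑ j, pm (post p c Y) (fun x => v x j) ^ 2 - ∑ j, ov p c (fun x => v x j)|) := by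
  have hpp := isP_pp hp hw
  set q := ∑ j, ov p c (fun x => v x j) with hq
  have hq0 : 0 ≤ q := Finset.sum_nonneg fun j _ => ov_nonneg hp _ _
  have e1 : ov (pp p w) (ext c (dcav τ h v σ)) (fun z => σ z.2)
      = av p c (fun Y => ov (pp (post p c Y) w) (dcav τ h v σ) (fun z => σ z.2)) := by
    unfold ext
    rw [← av_ov hpp]
    unfold av
    simp_rw [Zc_fst p hw, post_fst p hw]
  have b1 : BM' (fun Y => ov (pp (post p c Y) w) (dcav τ h v σ) (fun z => σ z.2)) := by
    have := bm_ov hpp (fun z => c z.1) (dcav τ h v σ) (fun z => σ z.2)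
    simp_rw [post_fst p hw] at this
    exact this
  have b2 : BM' (fun Y => |∑ j, pm (post p c Y) (fun x => v x j) ^ 2 - q|) :=
    ((BM'.sum _ fun j => (bm_pm hp c _).sq).sub (BM'.const q)).abs
  have b3 := bm_trC hp c v
  set f0 := Fw w σ (h + τ * q) with hf0
  have e2 : ov (pp p w) (ext c (dcav τ h v σ)) (fun z => σ z.2) - f0
      = av p c (fun Y => ov (pp (post p c Y) w) (dcav τ h v σ) (fun z => σ z.2) - f0) := by
    rw [av_sub p c b1 (BM'.const f0), av_const hp, e1]
  rw [e2]
  refine (av_abs hp c (b1.sub (BM'.const f0))).trans ?_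
  have b4 : BM' (fun Y => Ccav K Λ / N ^ 2 / ε ^ 7 * trC (post p c Y) v) := (BM'.const _).mul b3
  have b5 : BM' (fun Y => Csc K * K ^ 2 * τ * |∑ j, pm (post p c Y) (fun x => v x j) ^ 2 - q|) := (BM'.const _).mul b2
  have := av_mono hp c ((b1.sub (BM'.const f0)).abs) ((b4.add (BM'.const (Ccav K Λ * ε))).add b5) (fun Y => by
    have h1 := cavity (isP_post hp c Y) hw v σ hv hσ hK hτ hN hJ hΛ hh hh1 hε hε1
    have h2 := Fw_lip0 hw σ hσ (a := h + τ * ∑ j, pm (post p c Y) (fun x => v x j) ^ 2) (b := h + τ * q)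
      (by positivity) (by positivity)
    have h3 : |h + τ * ∑ j, pm (post p c Y) (fun x => v x j) ^ 2 - (h + τ * q)|
        = τ * |∑ j, pm (post p c Y) (fun x => v x j) ^ 2 - q| := by
      rw [add_sub_add_left_eq_sub, ← mul_sub, abs_mul, abs_of_nonneg hτ]
    rw [h3] at h2
    have h4 := abs_sub_le (ov (pp (post p c Y) w) (dcav τ h v σ) (fun z => σ z.2))
      (Fw w σ (h + τ * ∑ j, pm (post p c Y) (fun x => v x j) ^ 2)) f0
    refine h4.trans ((add_le_add h1 h2).trans (le_of_eq ?_))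
    ring)
  refine this.trans (le_of_eq ?_)
  rw [av_add p c (b4.add (BM'.const (Ccav K Λ * ε))) b5, av_add p c b4 (BM'.const (Ccav K Λ * ε)), av_smul p c (Ccav K Λ / N ^ 2 / ε ^ 7), av_smul p c (Csc K * K ^ 2 * τ), av_const hp]
  ring

/-- Decoupling of products. -/
lemma pair_eq {p : Ω → ℝ} (hp : IsP p) (c : Ω → A → ℝ) (X : Ω → R ⊕ C → ℝ) {K N θ : ℝ}
    (hX : ∀ x k, |X x k| ≤ K) (hK : 0 ≤ K) (hR : (Fintype.card R : ℝ) = N) (hC : (Fintype.card C : ℝ) = N) (hθ : 0 < θ) :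
    |∑ i, ∑ j, ov p c (fun x => X x (Sum.inl i) * X x (Sum.inr j))
        - (∑ i, ov p c (fun x => X x (Sum.inl i))) * (∑ j, ov p c (fun x => X x (Sum.inr j)))|
      ≤ av p c (fun Y => trC (post p c Y) X) * (1 + 1 / θ) + θ * (N ^ 2 * K ^ 4)
        + N * K ^ 2 * av p c (fun Y => |∑ i, pm (post p c Y) (fun x => X x (Sum.inl i)) ^ 2 - ∑ i, ov p c (fun x => X x (Sum.inl i))|)
        + N * K ^ 2 * av p c (fun Y => |∑ j, pm (post p c Y) (fun x => X x (Sum.inr j)) ^ 2 - ∑ j, ov p c (fun x => X x (Sum.inr j))|) := by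
  set qu := ∑ i, ov p c (fun x => X x (Sum.inl i)) with hqu
  set qv := ∑ j, ov p c (fun x => X x (Sum.inr j)) with hqv
  have b0 : ∀ i j, BM' (fun Y => pm (post p c Y) (fun x => X x (Sum.inl i) * X x (Sum.inr j)) ^ 2) :=
    fun i j => (bm_pm hp c _).sq
  have e1 : ∑ i, ∑ j, ov p c (fun x => X x (Sum.inl i) * X x (Sum.inr j)) - qu * qv
      = av p c (fun Y => ∑ i, ∑ j, pm (post p c Y) (fun x => X x (Sum.inl i) * X x (Sum.inr j)) ^ 2 - qu * qv) := by
    rw [av_sub p c (BM'.sum _ fun i => BM'.sum _ fun j => b0 i j) (BM'.const _), av_const hp,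
      av_sum p c _ (fun i => BM'.sum _ fun j => b0 i j)]
    congr 1
    refine Finset.sum_congr rfl fun i _ => ?_
    rw [av_sum p c _ (fun j => b0 i j)]
    exact Finset.sum_congr rfl fun j _ => (av_sq hp c _).symm
  rw [e1]
  have bu : BM' (fun Y => |∑ i, pm (post p c Y) (fun x => X x (Sum.inl i)) ^ 2 - qu|) :=
    ((BM'.sum _ fun j => (bm_pm hp c _).sq).sub (BM'.const qu)).abs
  have bv : BM' (fun Y => |∑ j, pm (post p c Y) (fun x => X x (Sum.inr j)) ^ 2 - qv|) :=
    ((BM'.sum _ fun j => (bm_pm hp c _).sq).sub (BM'.const qv)).abs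
  have b1 : BM' (fun Y => ∑ i, ∑ j, pm (post p c Y) (fun x => X x (Sum.inl i) * X x (Sum.inr j)) ^ 2 - qu * qv) :=
    (BM'.sum _ fun i => BM'.sum _ fun j => b0 i j).sub (BM'.const _)
  refine (av_abs hp c b1).trans ?_
  have b2 : BM' (fun Y => (1 + 1 / θ) * trC (post p c Y) X) := (BM'.const _).mul (bm_trC hp c X)
  have b3 : BM' (fun Y => N * K ^ 2 * |∑ i, pm (post p c Y) (fun x => X x (Sum.inl i)) ^ 2 - qu|) := (BM'.const _).mul bu
  have b4 : BM' (fun Y => N * K ^ 2 * |∑ j, pm (post p c Y) (fun x => X x (Sum.inr j)) ^ 2 - qv|) := (BM'.const _).mul bv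
  have hqv0 : 0 ≤ qv := Finset.sum_nonneg fun j _ => ov_nonneg hp _ _
  have hqv1 : qv ≤ N * K ^ 2 := by
    refine (Finset.sum_le_sum fun j _ => ov_le_sq hp c fun x => hX x (Sum.inr j)).trans ?_
    simp [hC]
  have key : ∀ Y, |∑ i, ∑ j, pm (post p c Y) (fun x => X x (Sum.inl i) * X x (Sum.inr j)) ^ 2 - qu * qv|
     ≤ (1 + 1 / θ) * trC (post p c Y) X + θ * (N ^ 2 * K ^ 4)
      + N * K ^ 2 * |∑ i, pm (post p c Y) (fun x => X x (Sum.inl i)) ^ 2 - qu|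
      + N * K ^ 2 * |∑ j, pm (post p c Y) (fun x => X x (Sum.inr j)) ^ 2 - qv| := by
    intro Y
    have hP := isP_post hp c Y
    set P := post p c Y
    set mu : R → ℝ := fun i => pm P (fun x => X x (Sum.inl i)) with hmu
    set mv : C → ℝ := fun j => pm P (fun x => X x (Sum.inr j)) with hmv
    have hmuK : ∀ i, |mu i| ≤ K := fun i => pm_abs_le hP fun x => hX x _
    have hmvK : ∀ i, |mv i| ≤ K := fun i => pm_abs_le hP fun x => hX x _
    have hQu0 : 0 ≤ ∑ i, mu i ^ 2 := by positivity
    have hQu1 : ∑ i, mu i ^ 2 ≤ N * K ^ 2 := by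
      refine (Finset.sum_le_sum fun j _ => sq_le_sq' (abs_le.1 (hmuK j)).1 (abs_le.1 (hmuK j)).2).trans ?_
      simp [hR]
    have h1 : |∑ i, ∑ j, pm P (fun x => X x (Sum.inl i) * X x (Sum.inr j)) ^ 2 - (∑ i, mu i ^ 2) * (∑ j, mv j ^ 2)|
        ≤ (1 + 1 / θ) * trC P X + θ * (N ^ 2 * K ^ 4) := by
      rw [Finset.sum_mul_sum]
      simp_rw [← Finset.sum_sub_distrib]
      have hij : ∀ i j, |pm P (fun x => X x (Sum.inl i) * X x (Sum.inr j)) ^ 2 - mu i ^ 2 * mv j ^ 2|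
          ≤ (1 + 1 / θ) * cov P (fun x => X x (Sum.inl i)) (fun x => X x (Sum.inr j)) ^ 2 + θ * K ^ 4 := by
        intro i j
        have := sqdiff_le (cov P (fun x => X x (Sum.inl i)) (fun x => X x (Sum.inr j))) (mu i * mv j) hθ
        have h2 := cov_eq hP (fun x => X x (Sum.inl i)) (fun x => X x (Sum.inr j))
        have h3 : cov P (fun x => X x (Sum.inl i)) (fun x => X x (Sum.inr j)) + mu i * mv j = pm P (fun x => X x (Sum.inl i) * X x (Sum.inr j)) := by
          rw [h2]; ring
        rw [h3] at this
        have h4 : (mu i * mv j) ^ 2 ≤ K ^ 4 := by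
          have h5 : |mu i * mv j| ≤ K * K := by
            rw [abs_mul]; exact mul_le_mul (hmuK i) (hmvK j) (abs_nonneg _) hK
          have := sq_le_sq' (abs_le.1 h5).1 (abs_le.1 h5).2
          calc _ ≤ _ := this
            _ = K ^ 4 := by ring
        rw [← mul_pow]
        have := mul_le_mul_of_nonneg_left h4 hθ.le
        linarith
      have hsum : ∑ i : R, ∑ j : C, cov P (fun x => X x (Sum.inl i)) (fun x => X x (Sum.inr j)) ^ 2 ≤ trC P X := by
        unfold trC
        rw [Fintype.sum_sum_type]
        have : ∀ i : R, ∑ j : C, cov P (fun x => X x (Sum.inl i)) (fun x => X x (Sum.inr j)) ^ 2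
          ≤ ∑ k, cov P (fun x => X x (Sum.inl i)) (fun x => X x k) ^ 2 := by
          intro i; rw [Fintype.sum_sum_type]
          have : 0 ≤ ∑ j : R, cov P (fun x => X x (Sum.inl i)) (fun x => X x (Sum.inl j)) ^ 2 := by positivity
          linarith
        have h2 := Finset.sum_le_sum fun i (_ : i ∈ Finset.univ) => this i
        have : 0 ≤ ∑ i : C, ∑ k, cov P (fun x => X x (Sum.inr i)) (fun x => X x k) ^ 2 := by positivity
        linarith
      refine (Finset.abs_sum_le_sum_abs _ _).trans ((Finset.sum_le_sum fun i _ => (Finset.abs_sum_le_sum_abs _ _).trans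
        (Finset.sum_le_sum fun j _ => hij i j)).trans ?_)
      simp_rw [Finset.sum_add_distrib, ← Finset.mul_sum]
      simp only [Finset.sum_const, Finset.card_univ, nsmul_eq_mul, hR, hC]
      have h9 : 0 ≤ 1 + 1 / θ := by positivity
      have := mul_le_mul_of_nonneg_left hsum h9
      linarith
    have h2 : |(∑ i, mu i ^ 2) * (∑ j, mv j ^ 2) - qu * qv| ≤ N * K ^ 2 * |∑ i, mu i ^ 2 - qu| + N * K ^ 2 * |∑ j, mv j ^ 2 - qv| := by
      have : (∑ i, mu i ^ 2) * (∑ j, mv j ^ 2) - qu * qv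
        = (∑ i, mu i ^ 2 - qu) * qv + (∑ i, mu i ^ 2) * (∑ j, mv j ^ 2 - qv) := by ring
      rw [this]
      refine (abs_add_le _ _).trans ?_
      rw [abs_mul, abs_mul, abs_of_nonneg hqv0, abs_of_nonneg hQu0, mul_comm |_| qv]
      exact add_le_add (mul_le_mul_of_nonneg_right hqv1 (abs_nonneg _)) (mul_le_mul_of_nonneg_right hQu1 (abs_nonneg _))
    have h3 := abs_sub_le (∑ i, ∑ j, pm P (fun x => X x (Sum.inl i) * X x (Sum.inr j)) ^ 2)
      ((∑ i, mu i ^ 2) * (∑ j, mv j ^ 2)) (qu * qv)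
    linarith
  refine (av_mono hp c b1.abs (((b2.add (BM'.const _)).add b3).add b4) key).trans (le_of_eq ?_)
  rw [av_add p c ((b2.add (BM'.const _)).add b3) b4, av_add p c (b2.add (BM'.const _)) b3,
    av_add p c b2 (BM'.const _), av_smul p c (1 + 1 / θ), av_smul p c (N * K ^ 2), av_smul p c (N * K ^ 2), av_const hp]
  ring
end BM
end

noncomputable section
set_option linter.unusedSectionVars false
set_option linter.unusedVariables false
namespace BM
variable {Ω A B I J R C S : Type} [Fintype Ω] [Fintype A] [Fintype B] [Fintype I] [Fintype J] [Fintype S]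
  [Fintype R] [Fintype C]

lemma ov_reindex {Ω' : Type} [Fintype Ω'] (e : Ω ≃ Ω') (p : Ω' → ℝ) (c : Ω' → A → ℝ) (f : Ω' → ℝ) :
    ov (fun x => p (e x)) (fun x => c (e x)) (fun x => f (e x)) = ov p c f := by
  unfold ov
  congr 1; funext Y
  have h1 : Nc (fun x => p (e x)) (fun x => c (e x)) (fun x => f (e x)) Y = Nc p c f Y := by
    unfold Nc; exact Equiv.sum_comp e (fun x => p x * f x * el (c x) Y)
  have h2 : Zc (fun x => p (e x)) (fun x => c (e x)) Y = Zc p c Y := by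
    unfold Zc; exact Equiv.sum_comp e (fun x => p x * el (c x) Y)
  rw [h1, h2]

lemma ov_symm (e : Ω ≃ Ω) (p : Ω → ℝ) (c : Ω → A → ℝ) (f : Ω → ℝ) (hp : ∀ x, p (e x) = p x)
    (hg : ∀ x y, ∑ a, c (e x) a * c (e y) a = ∑ a, c x a * c y a) :
    ov p c (fun x => f (e x)) = ov p c f := by
  rw [← ov_reindex e p c f]
  simp_rw [hp]
  exact ov_gram p _ _ (fun x y => (hg x y).symm) _

/-- Swap of a coordinate with the added one. -/
def sw [DecidableEq J] (k : J) : ((J → S) × S) ≃ ((J → S) × S) where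
  toFun z := (Function.update z.1 k z.2, z.1 k)
  invFun z := (Function.update z.1 k z.2, z.1 k)
  left_inv z := by simp
  right_inv z := by simp

lemma pw_sw [DecidableEq J] (w : J → S → ℝ) (k : J) (z : (J → S) × S) :
    pp (pw w) (w k) (sw k z) = pp (pw w) (w k) z := by
  simp only [pp, pw, sw, Equiv.coe_fn_mk]
  rw [← Finset.mul_prod_erase _ _ (Finset.mem_univ k), ← Finset.mul_prod_erase _ (fun i => w i (z.1 i)) (Finset.mem_univ k)]
  have : ∏ x ∈ Finset.univ.erase k, w x (Function.update z.1 k z.2 x) = ∏ x ∈ Finset.univ.erase k, w x (z.1 x) := by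
    refine Finset.prod_congr rfl fun x hx => ?_
    rw [Function.update_of_ne (Finset.ne_of_mem_erase hx)]
  rw [this]; simp only [Function.update_self]; ring

lemma sum_upd [DecidableEq J] [DecidableEq R] {e : R → J} (he : Function.Injective e) (i0 : R) (σ : S → ℝ) (x y : J → S) (s t : S) :
    ∑ i, σ (Function.update x (e i0) s (e i)) * σ (Function.update y (e i0) t (e i)) + σ (x (e i0)) * σ (y (e i0))
      = ∑ i, σ (x (e i)) * σ (y (e i)) + σ s * σ t := by
  rw [← Finset.add_sum_erase _ _ (Finset.mem_univ i0), ← Finset.add_sum_erase _ (fun i => σ (x (e i)) * σ (y (e i))) (Finset.mem_univ i0)]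
  have : ∑ i ∈ Finset.univ.erase i0, σ (Function.update x (e i0) s (e i)) * σ (Function.update y (e i0) t (e i))
      = ∑ i ∈ Finset.univ.erase i0, σ (x (e i)) * σ (y (e i)) := by
    refine Finset.sum_congr rfl fun i hi => ?_
    have : e i ≠ e i0 := fun h => Finset.ne_of_mem_erase hi (he h)
    rw [Function.update_of_ne this, Function.update_of_ne this]
  rw [this]; simp only [Function.update_self]; ring

lemma ext_symm [DecidableEq J] [DecidableEq R] {e : R → J} (he : Function.Injective e) {f : C → J} (hef : ∀ i j, f j ≠ e i)
    (w : J → S → ℝ) (σ : S → ℝ) {τ h : ℝ} (hτ : 0 ≤ τ) (hh : 0 ≤ h) (c : (J → S) → A → ℝ)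
    (hc : ∀ x y, ∑ a, c x a * c y a = τ * ((∑ i, σ (x (e i)) * σ (y (e i))) * (∑ j, σ (x (f j)) * σ (y (f j))))
      + h * (∑ i, σ (x (e i)) * σ (y (e i)) + ∑ j, σ (x (f j)) * σ (y (f j)))) (i0 : R) :
    ov (pp (pw w) (w (e i0))) (ext c (dcav τ h (fun x j => σ (x (f j))) σ)) (fun z => σ (z.1 (e i0)))
      = ov (pp (pw w) (w (e i0))) (ext c (dcav τ h (fun x j => σ (x (f j))) σ)) (fun z => σ z.2) := by
  refine ov_symm (sw (e i0)) _ _ (fun z => σ z.2) (pw_sw w (e i0)) ?_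
  intro z z'
  unfold ext
  rw [cd_gram, cd_gram, hc, hc]
  unfold dcav
  rw [elim_gram hτ hh, elim_gram hτ hh]
  simp only [sw, Equiv.coe_fn_mk]
  have h1 := sum_upd he i0 σ z.1 z'.1 z.2 z'.2
  have h2 : ∀ j, Function.update z.1 (e i0) z.2 (f j) = z.1 (f j) := fun j => Function.update_of_ne (hef i0 j) _ _
  have h3 : ∀ j, Function.update z'.1 (e i0) z'.2 (f j) = z'.1 (f j) := fun j => Function.update_of_ne (hef i0 j) _ _
  simp_rw [h2, h3]
  set V := ∑ j, σ (z.1 (f j)) * σ (z'.1 (f j))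
  linear_combination (τ * V + h) * h1

lemma sum_inj_le {e : R → J} (he : Function.Injective e) {g : J → ℝ} (hg : ∀ k, 0 ≤ g k) : ∑ i, g (e i) ≤ ∑ k, g k := by
  have := Finset.sum_map Finset.univ ⟨e, he⟩ g
  simp only [Function.Embedding.coeFn_mk] at this
  rw [← this]
  exact Finset.sum_le_univ_sum_of_nonneg hg

lemma trC_inj_le {e : R → J} (he : Function.Injective e) (q : Ω → ℝ) (v : Ω → J → ℝ) :
    trC q (fun x i => v x (e i)) ≤ trC q v := by
  unfold trC
  refine (Finset.sum_le_sum fun i _ => sum_inj_le he (g := fun k => cov q (fun x => v x (e i)) (fun x => v x k) ^ 2)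
    fun k => sq_nonneg _).trans ?_
  exact sum_inj_le he (g := fun i => ∑ k, cov q (fun x => v x i) (fun x => v x k) ^ 2)
    fun k => Finset.sum_nonneg fun _ _ => sq_nonneg _

/-- Coordinates. -/
def crd (σ : S → ℝ) (x : J → S) (k : J) : ℝ := σ (x k)

lemma Ccav_nonneg {K Λ : ℝ} (hΛ : 0 ≤ Λ) : 0 ≤ Ccav K Λ := by unfold Ccav; positivity

/-- State evolution equation for the row overlap, with explicit errors. -/
lemma row_eq [DecidableEq J] [DecidableEq R] {e : R → J} (he : Function.Injective e) {f : C → J} (hf : Function.Injective f)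
    (hef : ∀ i j, f j ≠ e i)
    {w : J → S → ℝ} (hw : ∀ k, IsP (w k)) {wu : S → ℝ} (hwu : ∀ i, w (e i) = wu) (σ : S → ℝ) {K Λ τ h ε N δ : ℝ}
    (hσ : ∀ s, |σ s| ≤ K) (hK : 0 ≤ K) (hτ : 0 ≤ τ) (hN : 0 < N) (hR : (Fintype.card R : ℝ) = N) (hC : (Fintype.card C : ℝ) = N)
    (hΛ : τ * N ≤ Λ) (hh : 0 ≤ h) (hh1 : h ≤ 1) (hε : 0 < ε) (hε1 : ε ≤ 1) (hδ : 0 < δ)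
    (c : (J → S) → A → ℝ)
    (hc : ∀ x y, ∑ a, c x a * c y a = τ * ((∑ i, σ (x (e i)) * σ (y (e i))) * (∑ j, σ (x (f j)) * σ (y (f j))))
      + h * (∑ i, σ (x (e i)) * σ (y (e i)) + ∑ j, σ (x (f j)) * σ (y (f j)))) :
    |(∑ i, ov (pw w) c (fun x => σ (x (e i)))) / N - Fw wu σ (h + τ * ∑ j, ov (pw w) c (fun x => σ (x (f j))))|
      ≤ ((∑ k, ov (pw w) (cd c (sc δ (crd σ))) (fun x => crd σ x k) - ∑ k, ov (pw w) c (fun x => crd σ x k))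
          + K ^ 2 * (Λ * K ^ 2 + 1) / δ) / N
        + Ccav K Λ * (av (pw w) c (fun Y => trC (post (pw w) c Y) (crd σ)) / N ^ 2 / ε ^ 7 + ε)
        + Csc K * K ^ 2 * τ * av (pw w) c (fun Y => |∑ j, pm (post (pw w) c Y) (fun x => σ (x (f j))) ^ 2
            - ∑ j, ov (pw w) c (fun x => σ (x (f j)))|) := by
  have hΛ0 : 0 ≤ Λ := le_trans (by positivity) hΛ
  have hp := isP_pw hw
  have hne : Nonempty R := by
    rw [← Fintype.card_pos_iff]; rw [← hR] at hN; exact_mod_cast hN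
  have hwuP : IsP wu := by rw [← hwu hne.some]; exact hw _
  set dd := dcav τ h (fun (x : J → S) j => σ (x (f j))) σ with hdd
  set a := ov (pp (pw w) wu) (ext c dd) (fun z => σ z.2) with ha
  have hsym : ∀ i, ov (pp (pw w) wu) (ext c dd) (fun z => σ (z.1 (e i))) = a := by
    intro i
    have := ext_symm he hef w σ hτ hh c hc i
    rw [hwu] at this
    exact this
  have hD : ∀ z, ∑ b, dd z b ^ 2 ≤ K ^ 2 * (Λ * K ^ 2 + 1) := by
    intro z
    have h1 := elim_gram (J := C) hτ hh (σ z.2) (σ z.2) (fun j => σ (z.1 (f j))) (fun j => σ (z.1 (f j)))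
    have h2 : ∑ b, dd z b ^ 2 = σ z.2 * σ z.2 * (τ * ∑ j, σ (z.1 (f j)) * σ (z.1 (f j)) + h) := by
      rw [← h1]; exact Finset.sum_congr rfl fun b _ => by rw [sq]; rfl
    rw [h2]
    have h3 : σ z.2 * σ z.2 ≤ K ^ 2 := by rw [← sq]; exact sq_le_sq' (abs_le.1 (hσ _)).1 (abs_le.1 (hσ _)).2
    have h4 : |∑ j, σ (z.1 (f j)) * σ (z.1 (f j))| ≤ N * K ^ 2 := by
      rw [← hC]; exact dot_abs_le _ _ (fun j => hσ _) (fun j => hσ _)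
    have h5 := (abs_le.1 h4).2
    have h6 : 0 ≤ ∑ j, σ (z.1 (f j)) * σ (z.1 (f j)) := Finset.sum_nonneg fun j _ => mul_self_nonneg _
    have h7 : τ * ∑ j, σ (z.1 (f j)) * σ (z.1 (f j)) ≤ Λ * K ^ 2 := by
      calc _ ≤ τ * (N * K ^ 2) := mul_le_mul_of_nonneg_left h5 hτ
        _ = (τ * N) * K ^ 2 := by ring
        _ ≤ _ := mul_le_mul_of_nonneg_right hΛ (sq_nonneg _)
    refine mul_le_mul h3 (by linarith) (by positivity) (sq_nonneg _)
  have hdiff := ext_diff hp hwuP c dd hD hδ (crd σ)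
  have hge : ∀ k, ov (pw w) c (fun x => crd σ x k) ≤ ov (pp (pw w) wu) (ext c dd) (fun z => crd σ z.1 k) :=
    fun k => ov_ext_ge hp hwuP c dd _
  have hsub := sum_inj_le he (g := fun k => ov (pp (pw w) wu) (ext c dd) (fun z => crd σ z.1 k) - ov (pw w) c (fun x => crd σ x k))
    (fun k => sub_nonneg.2 (hge k))
  have hpos : 0 ≤ ∑ i, (ov (pp (pw w) wu) (ext c dd) (fun z => crd σ z.1 (e i)) - ov (pw w) c (fun x => crd σ x (e i))) :=
    Finset.sum_nonneg fun i _ => sub_nonneg.2 (hge (e i))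
  have hsum : ∑ i, (ov (pp (pw w) wu) (ext c dd) (fun z => crd σ z.1 (e i)) - ov (pw w) c (fun x => crd σ x (e i)))
      = N * a - ∑ i, ov (pw w) c (fun x => σ (x (e i))) := by
    rw [Finset.sum_sub_distrib]
    congr 1
    simp only [crd]
    simp_rw [hsym]
    simp [hR]
  rw [hsum] at hsub hpos
  rw [Finset.sum_sub_distrib] at hsub
  have h1 : |(∑ i, ov (pw w) c (fun x => σ (x (e i)))) / N - a|
      ≤ ((∑ k, ov (pw w) (cd c (sc δ (crd σ))) (fun x => crd σ x k) - ∑ k, ov (pw w) c (fun x => crd σ x k))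
          + K ^ 2 * (Λ * K ^ 2 + 1) / δ) / N := by
    rw [div_sub' hN.ne', abs_div, abs_of_pos hN]
    refine div_le_div_of_nonneg_right ?_ hN.le
    rw [abs_sub_comm, abs_of_nonneg hpos]
    linarith
  have h2 := cav_eq hp hwuP c (fun (x : J → S) j => σ (x (f j))) σ (fun x j => hσ _) hσ hK hτ hN hC hΛ hh hh1 hε hε1
  have h3 : av (pw w) c (fun Y => trC (post (pw w) c Y) (fun (x : J → S) j => σ (x (f j))))
      ≤ av (pw w) c (fun Y => trC (post (pw w) c Y) (crd σ)) :=
    av_mono hp c (bm_trC hp c _) (bm_trC hp c _) fun Y => trC_inj_le hf _ (crd σ)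
  have h4 : Ccav K Λ * (av (pw w) c (fun Y => trC (post (pw w) c Y) (fun (x : J → S) j => σ (x (f j)))) / N ^ 2 / ε ^ 7 + ε)
      ≤ Ccav K Λ * (av (pw w) c (fun Y => trC (post (pw w) c Y) (crd σ)) / N ^ 2 / ε ^ 7 + ε) := by
    have := Ccav_nonneg (K := K) hΛ0
    gcongr
  have h5 := abs_sub_le ((∑ i, ov (pw w) c (fun x => σ (x (e i)))) / N) a
    (Fw wu σ (h + τ * ∑ j, ov (pw w) c (fun x => σ (x (f j)))))
  linarith
end BM
end

noncomputable section
set_option linter.unusedSectionVars false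
set_option linter.unusedVariables false
namespace BM
variable {Ω A B I J R C S : Type} [Fintype Ω] [Fintype A] [Fintype B] [Fintype I] [Fintype J] [Fintype S]
  [Fintype R] [Fintype C]

/-- Channel with controlled sensitivity. -/
def Bd (c : (J → S) → A → ℝ) (s D : ℝ) : Prop :=
  ∃ l : A → ℝ, (∀ x a, |c x a| ≤ l a) ∧ 4 * ∑ a, l a ^ 2 ≤ s ∧
    ∀ i X Y, (∀ j, j ≠ i → X j = Y j) → ∑ a, l a * |c X a - c Y a| ≤ D

lemma Bd.cd {c : (J → S) → A → ℝ} {d : (J → S) → B → ℝ} {s D s' D' : ℝ} (h : Bd c s D) (h' : Bd d s' D') :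
    Bd (cd c d) (s + s') (D + D') := by
  obtain ⟨l, h1, h2, h3⟩ := h
  obtain ⟨l', h1', h2', h3'⟩ := h'
  refine ⟨Sum.elim l l', ?_, ?_, ?_⟩
  · rintro x (a | b)
    · exact h1 x a
    · exact h1' x b
  · rw [Fintype.sum_sum_type]; simp only [Sum.elim_inl, Sum.elim_inr]; linarith
  · intro i X Y hXY
    rw [Fintype.sum_sum_type]; simp only [Sum.elim_inl, Sum.elim_inr, BM.cd]
    exact add_le_add (h3 i X Y hXY) (h3' i X Y hXY)

lemma Bd.mono {c : (J → S) → A → ℝ} {s D s' D' : ℝ} (h : Bd c s D) (hs : s ≤ s') (hD : D ≤ D') : Bd c s' D' := by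
  obtain ⟨l, h1, h2, h3⟩ := h
  exact ⟨l, h1, h2.trans hs, fun i X Y hXY => (h3 i X Y hXY).trans hD⟩

lemma bd_crd [DecidableEq J] {e : I → J} (he : Function.Injective e) (σ : S → ℝ) {K δ : ℝ} (hσ : ∀ s, |σ s| ≤ K)
    (hK : 0 ≤ K) (hδ : 0 ≤ δ) :
    Bd (sc δ (fun (x : J → S) (i : I) => σ (x (e i)))) (4 * (Fintype.card I * (δ * K ^ 2))) (2 * (δ * K ^ 2)) := by
  refine ⟨fun _ => Real.sqrt δ * K, ?_, ?_, ?_⟩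
  · intro x a; simp only [sc]
    rw [abs_mul, abs_of_nonneg (Real.sqrt_nonneg _)]
    exact mul_le_mul_of_nonneg_left (hσ _) (Real.sqrt_nonneg _)
  · simp only [mul_pow, Real.sq_sqrt hδ]; simp
  · intro k X Y hXY
    have : ∀ a, Real.sqrt δ * K * |sc δ (fun (x : J → S) (i : I) => σ (x (e i))) X a - sc δ (fun (x : J → S) (i : I) => σ (x (e i))) Y a|
        ≤ if e a = k then 2 * (δ * K ^ 2) else 0 := by
      intro a
      split_ifs with hk
      · simp only [sc]
        rw [← mul_sub, abs_mul, abs_of_nonneg (Real.sqrt_nonneg _)]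
        have h1 : |σ (X (e a)) - σ (Y (e a))| ≤ 2 * K := by
          refine (abs_sub _ _).trans ?_
          linarith [hσ (X (e a)), hσ (Y (e a))]
        calc Real.sqrt δ * K * (Real.sqrt δ * |σ (X (e a)) - σ (Y (e a))|)
            = (Real.sqrt δ * Real.sqrt δ) * K * |σ (X (e a)) - σ (Y (e a))| := by ring
          _ = δ * K * |σ (X (e a)) - σ (Y (e a))| := by rw [Real.mul_self_sqrt hδ]
          _ ≤ δ * K * (2 * K) := mul_le_mul_of_nonneg_left h1 (by positivity)
          _ = _ := by ring
      · simp only [sc]; rw [hXY _ hk]; simp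
    refine (Finset.sum_le_sum fun a _ => this a).trans ?_
    rw [← Finset.sum_filter, Finset.sum_const, nsmul_eq_mul]
    have hc : (Finset.univ.filter fun a => e a = k).card ≤ 1 := by
      rw [Finset.card_le_one]
      intro a ha b hb
      simp only [Finset.mem_filter, Finset.mem_univ, true_and] at ha hb
      exact he (ha.trans hb.symm)
    have hc' : ((Finset.univ.filter fun a => e a = k).card : ℝ) ≤ 1 := by exact_mod_cast hc
    have : 0 ≤ 2 * (δ * K ^ 2) := by positivity
    nlinarith

/-- Product channel. -/
def prodc (σ : S → ℝ) (x : R ⊕ C → S) (a : R × C) : ℝ := σ (x (Sum.inl a.1)) * σ (x (Sum.inr a.2))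

lemma bd_prod [DecidableEq R] [DecidableEq C] (σ : S → ℝ) {K τ N : ℝ} (hσ : ∀ s, |σ s| ≤ K)
    (hK : 0 ≤ K) (hτ : 0 ≤ τ) (hR : (Fintype.card R : ℝ) = N) (hC : (Fintype.card C : ℝ) = N) :
    Bd (sc τ (prodc (R := R) (C := C) σ)) (4 * (N * (τ * N) * K ^ 4)) (2 * (τ * N) * K ^ 4) := by
  have hP : ∀ (x : R ⊕ C → S) a, |prodc σ x a| ≤ K ^ 2 := by
    intro x a; unfold prodc; rw [abs_mul, sq]; exact mul_le_mul (hσ _) (hσ _) (abs_nonneg _) hK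
  refine ⟨fun _ => Real.sqrt τ * K ^ 2, ?_, ?_, ?_⟩
  · intro x a; simp only [sc]
    rw [abs_mul, abs_of_nonneg (Real.sqrt_nonneg _)]
    exact mul_le_mul_of_nonneg_left (hP x a) (Real.sqrt_nonneg _)
  · simp only [mul_pow, Real.sq_sqrt hτ]
    simp only [Finset.sum_const, Finset.card_univ, Fintype.card_prod, nsmul_eq_mul, Nat.cast_mul, hR, hC]
    apply le_of_eq; ring
  · intro k X Y hXY
    have : ∀ a : R × C, Real.sqrt τ * K ^ 2 * |sc τ (prodc σ) X a - sc τ (prodc σ) Y a|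
        ≤ if (Sum.inl a.1 = k ∨ Sum.inr a.2 = k) then 2 * τ * K ^ 4 else 0 := by
      intro a
      split_ifs with hk
      · simp only [sc]
        rw [← mul_sub, abs_mul, abs_of_nonneg (Real.sqrt_nonneg _)]
        have h1 : |prodc σ X a - prodc σ Y a| ≤ 2 * K ^ 2 := by
          refine (abs_sub _ _).trans ?_
          linarith [hP X a, hP Y a]
        calc Real.sqrt τ * K ^ 2 * (Real.sqrt τ * |prodc σ X a - prodc σ Y a|)
            = (Real.sqrt τ * Real.sqrt τ) * K ^ 2 * |prodc σ X a - prodc σ Y a| := by ring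
          _ = τ * K ^ 2 * |prodc σ X a - prodc σ Y a| := by rw [Real.mul_self_sqrt hτ]
          _ ≤ τ * K ^ 2 * (2 * K ^ 2) := mul_le_mul_of_nonneg_left h1 (by positivity)
          _ = _ := by ring
      · push Not at hk
        simp only [sc, prodc]; rw [hXY _ hk.1, hXY _ hk.2]; simp
    refine (Finset.sum_le_sum fun a _ => this a).trans ?_
    rw [Fintype.sum_prod_type]
    rcases k with r | q
    · simp only [Sum.inl.injEq, reduceCtorEq, or_false, Finset.sum_const, Finset.card_univ, nsmul_eq_mul, hC]
      rw [← Finset.mul_sum, Finset.sum_ite_eq']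
      simp only [Finset.mem_univ, if_true]
      apply le_of_eq; ring
    · simp only [Sum.inr.injEq, reduceCtorEq, false_or, Finset.sum_ite_eq', Finset.mem_univ, if_true,
        Finset.sum_const, Finset.card_univ, nsmul_eq_mul, hR]
      apply le_of_eq; ring

lemma fl_bd [DecidableEq J] {w : J → S → ℝ} (hw : ∀ i, IsP (w i)) {c : (J → S) → A → ℝ} {s D N : ℝ} (hN : 0 < N)
    (hs : 0 ≤ s) (hD : 0 ≤ D) (h : Bd c (N * s) D) (hJ : (Fintype.card J : ℝ) = 2 * N) :
    fl (pw w) c ≤ Real.sqrt N * (s + 1 + 2 * (D + 1)) := by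
  obtain ⟨l, h1, h2, h3⟩ := h
  have hsN := Real.sqrt_pos.2 hN
  have hsq := Real.sq_sqrt hN.le
  have := fl_le hw c h1 (D := fun _ => D) (fun _ => hD) h3 (s := Real.sqrt N * (s + 1)) (t := Real.sqrt N * (2 * (D + 1)))
    (by positivity) (by positivity) (by
      refine h2.trans ?_
      rw [mul_pow, hsq]
      exact mul_le_mul_of_nonneg_left (by nlinarith) hN.le) (by
      simp only [Finset.sum_const, Finset.card_univ, nsmul_eq_mul, hJ]
      rw [mul_pow, hsq]
      have : 2 * D ^ 2 ≤ (2 * (D + 1)) ^ 2 := by nlinarith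
      nlinarith)
  linarith

/-- The system channel. -/
def sysc (τ h : ℝ) (σ : S → ℝ) : (R ⊕ C → S) → (R × C) ⊕ (R ⊕ C) → ℝ := cd (sc τ (prodc σ)) (sc h (crd σ))

/-- The weights. -/
def wts (R C : Type) (wu wv : S → ℝ) : R ⊕ C → S → ℝ := Sum.elim (fun _ => wu) (fun _ => wv)

lemma isP_wts {wu wv : S → ℝ} (hu : IsP wu) (hv : IsP wv) (k : R ⊕ C) : IsP (wts R C wu wv k) := by
  rcases k with r | q
  · exact hu
  · exact hv

lemma crd_gram (σ : S → ℝ) (x y : R ⊕ C → S) : ∑ k, crd σ x k * crd σ y k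
    = ∑ i : R, σ (x (Sum.inl i)) * σ (y (Sum.inl i)) + ∑ j : C, σ (x (Sum.inr j)) * σ (y (Sum.inr j)) := by
  rw [Fintype.sum_sum_type]; rfl

lemma sysc_gram [DecidableEq R] [DecidableEq C] {τ h : ℝ} (hτ : 0 ≤ τ) (hh : 0 ≤ h) (σ : S → ℝ) (x y : R ⊕ C → S) :
    ∑ a, sysc τ h σ x a * sysc τ h σ y a = τ * ((∑ i : R, σ (x (Sum.inl i)) * σ (y (Sum.inl i)))
      * (∑ j : C, σ (x (Sum.inr j)) * σ (y (Sum.inr j))))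
      + h * (∑ i : R, σ (x (Sum.inl i)) * σ (y (Sum.inl i)) + ∑ j : C, σ (x (Sum.inr j)) * σ (y (Sum.inr j))) := by
  unfold sysc
  rw [cd_gram, sc_gram hτ, sc_gram hh, crd_gram, Finset.sum_mul_sum, Fintype.sum_prod_type]
  congr 2
  refine Finset.sum_congr rfl fun i _ => Finset.sum_congr rfl fun j _ => ?_
  unfold prodc; ring

lemma sysc_add_gram [DecidableEq R] [DecidableEq C] {τ h δ : ℝ} (hτ : 0 ≤ τ) (hh : 0 ≤ h) (hδ : 0 ≤ δ) (σ : S → ℝ) (x y : R ⊕ C → S) :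
    ∑ a, cd (sysc τ h σ) (sc δ (crd σ)) x a * cd (sysc τ h σ) (sc δ (crd σ)) y a
      = ∑ a, sysc τ (h + δ) σ x a * sysc τ (h + δ) σ y a := by
  rw [cd_gram, sysc_gram hτ hh, sysc_gram hτ (add_nonneg hh hδ), sc_gram hδ, crd_gram]; ring

/-- Fluctuation constant. -/
def Cfl (K Λ : ℝ) : ℝ := (4 * (Λ * K ^ 4) + 16 * K ^ 2) + 1 + 2 * ((2 * (Λ * K ^ 4) + 4 * K ^ 2) + 1)

lemma bd_sysc [DecidableEq R] [DecidableEq C] (σ : S → ℝ) {K τ N h Λ : ℝ} (hσ : ∀ s, |σ s| ≤ K)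
    (hK : 0 ≤ K) (hτ : 0 ≤ τ) (hN : 0 < N) (hR : (Fintype.card R : ℝ) = N) (hC : (Fintype.card C : ℝ) = N)
    (hΛ : τ * N ≤ Λ) (hh : 0 ≤ h) (hh1 : h ≤ 1) :
    Bd (sysc (R := R) (C := C) τ h σ) (N * (4 * (Λ * K ^ 4) + 8 * K ^ 2)) (2 * (Λ * K ^ 4) + 2 * K ^ 2) := by
  have h1 := bd_prod (R := R) (C := C) σ hσ hK hτ hR hC
  have h2 := bd_crd (J := R ⊕ C) (e := id) Function.injective_id σ hσ hK hh
  have hK4 : 0 ≤ K ^ 4 := by positivity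
  have a1 : τ * N * K ^ 4 ≤ Λ * K ^ 4 := mul_le_mul_of_nonneg_right hΛ hK4
  have a2 : h * K ^ 2 ≤ K ^ 2 := by nlinarith [sq_nonneg K]
  have a3 : N * (τ * N * K ^ 4) ≤ N * (Λ * K ^ 4) := mul_le_mul_of_nonneg_left a1 hN.le
  have a4 : N * (h * K ^ 2) ≤ N * K ^ 2 := mul_le_mul_of_nonneg_left a2 hN.le
  refine (h1.cd h2).mono ?_ ?_
  · simp only [Fintype.card_sum, Nat.cast_add, hR, hC]; linarith
  · linarith

lemma fl_sysc [DecidableEq R] [DecidableEq C] {wu wv : S → ℝ} (hu : IsP wu) (hv : IsP wv)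
    (σ : S → ℝ) {K τ N h Λ : ℝ} (hσ : ∀ s, |σ s| ≤ K)
    (hK : 0 ≤ K) (hτ : 0 ≤ τ) (hN : 0 < N) (hR : (Fintype.card R : ℝ) = N) (hC : (Fintype.card C : ℝ) = N)
    (hΛ : τ * N ≤ Λ) (hh : 0 ≤ h) (hh1 : h ≤ 1) :
    fl (pw (wts R C wu wv)) (sysc (R := R) (C := C) τ h σ) ≤ Real.sqrt N * Cfl K Λ := by
  have hΛ0 : 0 ≤ Λ := le_trans (by positivity) hΛ
  have h1 := bd_sysc (R := R) (C := C) σ hσ hK hτ hN hR hC hΛ hh hh1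
  have hK4 : 0 ≤ Λ * K ^ 4 := by positivity
  have hK2 : 0 ≤ K ^ 2 := by positivity
  refine (fl_bd (isP_wts hu hv) hN (s := 4 * (Λ * K ^ 4) + 8 * K ^ 2) (by positivity) (by positivity) h1
    (by simp only [Fintype.card_sum, Nat.cast_add, hR, hC]; ring)).trans ?_
  refine mul_le_mul_of_nonneg_left ?_ (Real.sqrt_nonneg _)
  unfold Cfl; linarith

lemma fl_sysc_cd [DecidableEq R] [DecidableEq C] {wu wv : S → ℝ} (hu : IsP wu) (hv : IsP wv)
    (σ : S → ℝ) {K τ N h Λ δ : ℝ} (hσ : ∀ s, |σ s| ≤ K)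
    (hK : 0 ≤ K) (hτ : 0 ≤ τ) (hN : 0 < N) (hR : (Fintype.card R : ℝ) = N) (hC : (Fintype.card C : ℝ) = N)
    (hΛ : τ * N ≤ Λ) (hh : 0 ≤ h) (hh1 : h ≤ 1) (hδ : 0 ≤ δ) (hδ1 : δ ≤ 1) {e : I → R ⊕ C} (he : Function.Injective e)
    (hI : (Fintype.card I : ℝ) ≤ 2 * N) :
    fl (pw (wts R C wu wv)) (cd (sysc (R := R) (C := C) τ h σ) (sc δ (fun (x : R ⊕ C → S) (i : I) => σ (x (e i)))))
      ≤ Real.sqrt N * Cfl K Λ := by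
  have hΛ0 : 0 ≤ Λ := le_trans (by positivity) hΛ
  have h1 := bd_sysc (R := R) (C := C) σ hσ hK hτ hN hR hC hΛ hh hh1
  have h2 := bd_crd he σ hσ hK hδ
  have hK4 : 0 ≤ Λ * K ^ 4 := by positivity
  have hK2 : 0 ≤ K ^ 2 := by positivity
  have a2 : δ * K ^ 2 ≤ K ^ 2 := by nlinarith
  have a3 : Fintype.card I * (δ * K ^ 2) ≤ 2 * N * K ^ 2 := mul_le_mul hI a2 (by positivity) (by positivity)
  have h3 : Bd (cd (sysc (R := R) (C := C) τ h σ) (sc δ (fun (x : R ⊕ C → S) (i : I) => σ (x (e i)))))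
    (N * (4 * (Λ * K ^ 4) + 16 * K ^ 2)) (2 * (Λ * K ^ 4) + 4 * K ^ 2) := by
    refine (h1.cd h2).mono ?_ ?_ <;> linarith
  refine (fl_bd (isP_wts hu hv) hN (s := 4 * (Λ * K ^ 4) + 16 * K ^ 2) (by positivity) (by positivity) h3
    (by simp only [Fintype.card_sum, Nat.cast_add, hR, hC]; ring)).trans ?_
  refine mul_le_mul_of_nonneg_left ?_ (Real.sqrt_nonneg _)
  unfold Cfl; linarith
end BM
end

noncomputable section
set_option linter.unusedSectionVars false
set_option linter.unusedVariables false
namespace BM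
variable {Ω A B I J R C S : Type} [Fintype Ω] [Fintype A] [Fintype B] [Fintype I] [Fintype J] [Fintype S]
  [Fintype R] [Fintype C]

/-- Total overlap. -/
def Tov (R C : Type) [Fintype R] [Fintype C] [DecidableEq R] [DecidableEq C] (wu wv σ : S → ℝ) (τ h : ℝ) : ℝ :=
  ∑ k : R ⊕ C, ov (pw (wts R C wu wv)) (sysc (R := R) (C := C) τ h σ) (fun x => crd σ x k)

lemma part_diff [DecidableEq R] [DecidableEq C] {p : (R ⊕ C → S) → ℝ} (hp : IsP p) (c : (R ⊕ C → S) → A → ℝ) (σ : S → ℝ)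
    {e : I → R ⊕ C} {f : J → R ⊕ C} (hef : ∀ g : R ⊕ C → ℝ, ∑ k, g k = ∑ i, g (e i) + ∑ j, g (f j)) {δ : ℝ} (hδ : 0 ≤ δ) :
    ∑ i, ov p (cd c (sc δ (fun x i => σ (x (e i))))) (fun x => σ (x (e i))) - ∑ i, ov p c (fun x => σ (x (e i)))
      ≤ ∑ k, ov p (cd c (sc δ (crd σ))) (fun x => crd σ x k) - ∑ k, ov p c (fun x => crd σ x k) := by
  have h1 : ∀ g, ov p (cd c (sc δ (fun x i => σ (x (e i))))) g ≤ ov p (cd c (sc δ (crd σ))) g := by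
    intro g
    refine (ov_le_cd hp _ (sc δ (fun x j => σ (x (f j)))) g).trans (le_of_eq ?_)
    refine ov_gram _ _ _ (fun x y => ?_) g
    rw [cd_gram, cd_gram, cd_gram, sc_gram hδ, sc_gram hδ, sc_gram hδ, hef fun k => crd σ x k * crd σ y k]
    simp only [crd]; ring
  have h2 : ∀ g, ov p c g ≤ ov p (cd c (sc δ (crd σ))) g := fun g => ov_le_cd hp _ _ g
  rw [hef fun k => ov p (cd c (sc δ (crd σ))) (fun x => crd σ x k), hef fun k => ov p c (fun x => crd σ x k)]
  have a1 := Finset.sum_le_sum fun i (_ : i ∈ (Finset.univ : Finset I)) => h1 (fun x => σ (x (e i)))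
  have a2 := Finset.sum_le_sum fun i (_ : i ∈ (Finset.univ : Finset J)) => h2 (fun x => σ (x (f i)))
  simp only [crd] at a1 a2 ⊢
  linarith

lemma quench_sys [DecidableEq R] [DecidableEq C] {wu wv : S → ℝ} (hu : IsP wu) (hv : IsP wv)
    (σ : S → ℝ) {K τ N h Λ δ : ℝ} (hσ : ∀ s, |σ s| ≤ K)
    (hK : 0 ≤ K) (hτ : 0 ≤ τ) (hN : 0 < N) (hR : (Fintype.card R : ℝ) = N) (hC : (Fintype.card C : ℝ) = N)
    (hΛ : τ * N ≤ Λ) (hh : 0 ≤ h) (hh1 : h ≤ 1) (hδ : 0 < δ) (hδ1 : δ ≤ 1) {e : I → R ⊕ C} (he : Function.Injective e)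
    (hI : (Fintype.card I : ℝ) ≤ 2 * N) {f : J → R ⊕ C}
    (hef : ∀ g : R ⊕ C → ℝ, ∑ k, g k = ∑ i, g (e i) + ∑ j, g (f j)) :
    av (pw (wts R C wu wv)) (sysc (R := R) (C := C) τ h σ) (fun Y =>
      |∑ i, pm (post (pw (wts R C wu wv)) (sysc (R := R) (C := C) τ h σ) Y) (fun x => σ (x (e i))) ^ 2
        - ∑ i, ov (pw (wts R C wu wv)) (sysc (R := R) (C := C) τ h σ) (fun x => σ (x (e i)))|)
      ≤ 4 * (Real.sqrt N * Cfl K Λ) / δ + 2 * (Tov R C wu wv σ τ (h + δ) - Tov R C wu wv σ τ h) := by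
  have hp := isP_pw (isP_wts (R := R) (C := C) hu hv)
  have q := quenched_av hp (sysc (R := R) (C := C) τ h σ) (fun (x : R ⊕ C → S) i => σ (x (e i))) hδ
  have d := part_diff hp (sysc (R := R) (C := C) τ h σ) σ hef hδ.le
  have f1 := fl_sysc hu hv σ hσ hK hτ hN hR hC hΛ hh hh1
  have f2 := fl_sysc_cd hu hv σ hσ hK hτ hN hR hC hΛ hh hh1 hδ.le hδ1 he hI
  refine q.trans (add_le_add ?_ ?_)
  · apply div_le_div_of_nonneg_right _ hδ.le
    linarith
  · refine mul_le_mul_of_nonneg_left (d.trans (le_of_eq ?_)) (by norm_num)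
    unfold Tov
    congr 1
    exact Finset.sum_congr rfl fun k _ => ov_gram _ _ _ (sysc_add_gram hτ hh hδ.le σ) _

lemma thermal_sys [DecidableEq R] [DecidableEq C] {wu wv : S → ℝ} (hu : IsP wu) (hv : IsP wv)
    (σ : S → ℝ) {K τ N h δ Δ : ℝ} (hσ : ∀ s, |σ s| ≤ K)
    (hτ : 0 ≤ τ) (hN : 0 < N) (hR : (Fintype.card R : ℝ) = N) (hC : (Fintype.card C : ℝ) = N)
    (hh : 0 ≤ h) (hδ : 0 < δ) (hT : Tov R C wu wv σ τ (h + δ) - Tov R C wu wv σ τ h ≤ N * Δ) :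
    av (pw (wts R C wu wv)) (sysc (R := R) (C := C) τ h σ) (fun Y =>
      trC (post (pw (wts R C wu wv)) (sysc (R := R) (C := C) τ h σ) Y) (crd σ)) / N ^ 2
      ≤ (1 / (δ * N) + 2 * K ^ 2) * Δ := by
  have hp := isP_pw (isP_wts (R := R) (C := C) hu hv)
  have q := thermal_av hp (sysc (R := R) (C := C) τ h σ) (crd σ) hδ.le (K := K) (fun x k => hσ _)
  have e : ∑ k, ov (pw (wts R C wu wv)) (cd (sysc (R := R) (C := C) τ h σ) (sc δ (crd σ))) (fun x => crd σ x k)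
      = Tov R C wu wv σ τ (h + δ) := 
    Finset.sum_congr rfl fun k _ => ov_gram _ _ _ (sysc_add_gram hτ hh hδ.le σ) _
  rw [e] at q
  simp only [Fintype.card_sum, Nat.cast_add, hR, hC] at q
  have : (1 + δ * ((N + N) * K ^ 2)) * (Tov R C wu wv σ τ (h + δ) - Tov R C wu wv σ τ h) ≤
    (1 + δ * ((N + N) * K ^ 2)) * (N * Δ) := mul_le_mul_of_nonneg_left hT (by positivity)
  have q2 := q.trans this
  rw [div_le_iff₀ (by positivity)]
  have e2 : (1 / (δ * N) + 2 * K ^ 2) * Δ * N ^ 2 = (1 + δ * ((N + N) * K ^ 2)) * (N * Δ) / δ := by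
    field_simp; ring
  rw [e2, le_div_iff₀ hδ, mul_comm]; exact q2

lemma main_row [DecidableEq R] [DecidableEq C] {wu wv : S → ℝ} (hu : IsP wu) (hv : IsP wv)
    (σ : S → ℝ) {K τ N h Λ δ Δ ε : ℝ} (hσ : ∀ s, |σ s| ≤ K)
    (hK : 0 ≤ K) (hτ : 0 ≤ τ) (hN : 0 < N) (hR : (Fintype.card R : ℝ) = N) (hC : (Fintype.card C : ℝ) = N)
    (hΛ : τ * N ≤ Λ) (hh : 0 ≤ h) (hh1 : h ≤ 1) (hδ : 0 < δ) (hδ1 : δ ≤ 1) (hε : 0 < ε) (hε1 : ε ≤ 1)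
    (hT : Tov R C wu wv σ τ (h + δ) - Tov R C wu wv σ τ h ≤ N * Δ)
    [DecidableEq I] {e : I → R ⊕ C} (he : Function.Injective e) {f : J → R ⊕ C} (hf : Function.Injective f)
    (hI : (Fintype.card I : ℝ) = N) (hJ : (Fintype.card J : ℝ) = N) (hne : ∀ i j, f j ≠ e i)
    (hef : ∀ g : R ⊕ C → ℝ, ∑ k, g k = ∑ i, g (e i) + ∑ j, g (f j)) {w : S → ℝ} (hw : ∀ i, wts R C wu wv (e i) = w)
    (hc : ∀ x y : R ⊕ C → S, ∑ a, sysc (R := R) (C := C) τ h σ x a * sysc (R := R) (C := C) τ h σ y a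
      = τ * ((∑ i, σ (x (e i)) * σ (y (e i))) * (∑ j, σ (x (f j)) * σ (y (f j))))
      + h * (∑ i, σ (x (e i)) * σ (y (e i)) + ∑ j, σ (x (f j)) * σ (y (f j)))) :
    |(∑ i, ov (pw (wts R C wu wv)) (sysc (R := R) (C := C) τ h σ) (fun x => σ (x (e i)))) / N
      - Fw w σ (h + τ * ∑ j, ov (pw (wts R C wu wv)) (sysc (R := R) (C := C) τ h σ) (fun x => σ (x (f j))))|
     ≤ Δ + K ^ 2 * (Λ * K ^ 2 + 1) * (1 / (δ * N)) + Ccav K Λ * ((1 / (δ * N) + 2 * K ^ 2) * Δ / ε ^ 7 + ε)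
      + Csc K * K ^ 2 * Λ * (4 * Cfl K Λ * (Real.sqrt N / (δ * N)) + 2 * Δ) := by
  have hΛ0 : 0 ≤ Λ := le_trans (by positivity) hΛ
  have r := row_eq he hf hne (isP_wts hu hv) hw σ hσ hK hτ hN hI hJ hΛ hh hh1 hε hε1 hδ _ hc
  have t := thermal_sys hu hv σ hσ hτ hN hR hC hh hδ hT
  have q := quench_sys hu hv σ hσ hK hτ hN hR hC hΛ hh hh1 hδ hδ1 hf (by linarith) (f := e) (fun g => by rw [hef g, add_comm])
  have e : ∑ k, ov (pw (wts R C wu wv)) (cd (sysc (R := R) (C := C) τ h σ) (sc δ (crd σ))) (fun x => crd σ x k)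
      = Tov R C wu wv σ τ (h + δ) := 
    Finset.sum_congr rfl fun k _ => ov_gram _ _ _ (sysc_add_gram hτ hh hδ.le σ) _
  rw [e] at r
  refine r.trans (add_le_add (add_le_add ?_ ?_) ?_)
  · have : (Tov R C wu wv σ τ (h + δ) - Tov R C wu wv σ τ h + K ^ 2 * (Λ * K ^ 2 + 1) / δ) / N
      ≤ (N * Δ + K ^ 2 * (Λ * K ^ 2 + 1) / δ) / N := by
      apply div_le_div_of_nonneg_right _ hN.le; linarith
    refine this.trans (le_of_eq ?_)
    field_simp
  · refine mul_le_mul_of_nonneg_left ?_ (Ccav_nonneg hΛ0)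
    gcongr
  · have hc0 : 0 ≤ Csc K := by linarith [Csc_ge K]
    have h1 : 4 * (Real.sqrt N * Cfl K Λ) / δ + 2 * (Tov R C wu wv σ τ (h + δ) - Tov R C wu wv σ τ h)
      ≤ N * (4 * Cfl K Λ * (Real.sqrt N / (δ * N)) + 2 * Δ) := by
      have : N * (4 * Cfl K Λ * (Real.sqrt N / (δ * N)) + 2 * Δ) = 4 * (Real.sqrt N * Cfl K Λ) / δ + 2 * (N * Δ) := by
        field_simp
      rw [this]; linarith
    have h2 := q.trans h1
    have h3 := mul_le_mul_of_nonneg_left h2 (show 0 ≤ Csc K * K ^ 2 * τ by positivity)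
    have h0 : 0 ≤ N * (4 * Cfl K Λ * (Real.sqrt N / (δ * N)) + 2 * Δ) := by
      refine le_trans ?_ h2
      exact integral_nonneg fun Y => mul_nonneg (Zc_pos (isP_pw (isP_wts hu hv)) _ Y).le (abs_nonneg _)
    have h0' : 0 ≤ 4 * Cfl K Λ * (Real.sqrt N / (δ * N)) + 2 * Δ := nonneg_of_mul_nonneg_right h0 hN
    refine h3.trans ?_
    calc Csc K * K ^ 2 * τ * (N * (4 * Cfl K Λ * (Real.sqrt N / (δ * N)) + 2 * Δ))
        = Csc K * K ^ 2 * (τ * N) * (4 * Cfl K Λ * (Real.sqrt N / (δ * N)) + 2 * Δ) := by ring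
      _ ≤ _ := by gcongr

lemma main_pair [DecidableEq R] [DecidableEq C] {wu wv : S → ℝ} (hu : IsP wu) (hv : IsP wv)
    (σ : S → ℝ) {K τ N h Λ δ Δ ε : ℝ} (hσ : ∀ s, |σ s| ≤ K)
    (hK : 0 ≤ K) (hτ : 0 ≤ τ) (hN : 0 < N) (hR : (Fintype.card R : ℝ) = N) (hC : (Fintype.card C : ℝ) = N)
    (hΛ : τ * N ≤ Λ) (hh : 0 ≤ h) (hh1 : h ≤ 1) (hδ : 0 < δ) (hδ1 : δ ≤ 1) (hε : 0 < ε)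
    (hT : Tov R C wu wv σ τ (h + δ) - Tov R C wu wv σ τ h ≤ N * Δ) :
    |(∑ i : R, ∑ j : C, ov (pw (wts R C wu wv)) (sysc (R := R) (C := C) τ h σ) (fun x => σ (x (Sum.inl i)) * σ (x (Sum.inr j)))) / N ^ 2
      - ((∑ i : R, ov (pw (wts R C wu wv)) (sysc (R := R) (C := C) τ h σ) (fun x => σ (x (Sum.inl i)))) / N)
       * ((∑ i : C, ov (pw (wts R C wu wv)) (sysc (R := R) (C := C) τ h σ) (fun x => σ (x (Sum.inr i)))) / N)|
     ≤ (1 / (δ * N) + 2 * K ^ 2) * Δ * (1 + 1 / ε) + ε * K ^ 4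
      + 2 * K ^ 2 * (4 * Cfl K Λ * (Real.sqrt N / (δ * N)) + 2 * Δ) := by
  have hp := isP_pw (isP_wts (R := R) (C := C) hu hv)
  have r := pair_eq hp (sysc (R := R) (C := C) τ h σ) (crd σ) (K := K) (fun x k => hσ _) hK hR hC hε
  have t := thermal_sys hu hv σ hσ hτ hN hR hC hh hδ hT
  have qu := quench_sys hu hv σ hσ hK hτ hN hR hC hΛ hh hh1 hδ hδ1 (e := Sum.inl) Sum.inl_injective (by linarith) (f := Sum.inr)
    (fun g => Fintype.sum_sum_type g)
  have qv := quench_sys hu hv σ hσ hK hτ hN hR hC hΛ hh hh1 hδ hδ1 (e := Sum.inr) Sum.inr_injective (by linarith) (f := Sum.inl)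
    (fun g => by rw [Fintype.sum_sum_type g, add_comm])
  have h1 : 4 * (Real.sqrt N * Cfl K Λ) / δ + 2 * (Tov R C wu wv σ τ (h + δ) - Tov R C wu wv σ τ h)
      ≤ N * (4 * Cfl K Λ * (Real.sqrt N / (δ * N)) + 2 * Δ) := by
    have : N * (4 * Cfl K Λ * (Real.sqrt N / (δ * N)) + 2 * Δ) = 4 * (Real.sqrt N * Cfl K Λ) / δ + 2 * (N * Δ) := by
      field_simp
    rw [this]; linarith
  have qu' := qu.trans h1
  have qv' := qv.trans h1
  rw [div_le_iff₀ (by positivity)] at t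
  have hNK : 0 ≤ N * K ^ 2 := by positivity
  have m1 := mul_le_mul_of_nonneg_left qu' hNK
  have m2 := mul_le_mul_of_nonneg_left qv' hNK
  have m3 := mul_le_mul_of_nonneg_right t (show 0 ≤ 1 + 1 / ε by positivity)
  simp only [crd] at r
  change _ ≤ av _ _ (fun Y => trC _ (crd σ)) * _ + _ + _ + _ at r
  have e : ∀ a b d : ℝ, a / N ^ 2 - b / N * (d / N) = (a - b * d) / N ^ 2 := by intro a b d; field_simp
  rw [e, abs_div, abs_of_pos (show 0 < N ^ 2 by positivity), div_le_iff₀ (by positivity)]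
  refine r.trans ?_
  refine (add_le_add (add_le_add (add_le_add m3 le_rfl) m1) m2).trans (le_of_eq ?_)
  ring
end BM
end

noncomputable section
set_option linter.unusedSectionVars false
set_option linter.unusedVariables false
namespace BM
variable {Ω A B I J R C S : Type} [Fintype Ω] [Fintype A] [Fintype B] [Fintype I] [Fintype J] [Fintype S]
  [Fintype R] [Fintype C]

lemma pigeon {T : ℝ → ℝ} {X δ : ℝ} {M : ℕ} (hM : 0 < M) (h0 : 0 ≤ T 0) (h1 : T (M * δ) ≤ X) :
    ∃ k : ℕ, k < M ∧ T (k * δ + δ) - T (k * δ) ≤ X / M := by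
  have hM' : (0 : ℝ) < M := by exact_mod_cast hM
  have hs : ∑ k ∈ Finset.range M, (T (k * δ + δ) - T (k * δ)) ≤ ∑ k ∈ Finset.range M, X / M := by
    have e : ∑ k ∈ Finset.range M, (T (k * δ + δ) - T (k * δ)) = T (M * δ) - T 0 := by
      have := Finset.sum_range_sub (fun k : ℕ => T (k * δ)) M
      simp only [Nat.cast_zero, zero_mul] at this
      rw [← this]
      refine Finset.sum_congr rfl fun k _ => ?_
      congr 2; push_cast; ring
    rw [e, Finset.sum_const, Finset.card_range, nsmul_eq_mul, mul_div_cancel₀ _ hM'.ne']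
    linarith
  obtain ⟨k, hk, hle⟩ := Finset.exists_le_of_sum_le (Finset.nonempty_range_iff.2 hM.ne') hs
  exact ⟨k, Finset.mem_range.1 hk, hle⟩

/-- Pair overlap. -/
def EE (wu wv σ : S → ℝ) (n : ℕ) (lam h : ℝ) : ℝ :=
  (∑ i : Fin n, ∑ j : Fin n, ov (pw (wts (Fin n) (Fin n) wu wv)) (sysc (lam / n) h σ)
    (fun x => σ (x (Sum.inl i)) * σ (x (Sum.inr j)))) / (n : ℝ) ^ 2

lemma pm_pw_eval [DecidableEq J] {w : J → S → ℝ} (hw : ∀ i, IsP (w i)) (k : J) (g : S → ℝ) :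
    pm (pw w) (fun x => g (x k)) = pm (w k) g := by
  unfold pm pw
  have e : ∀ x : J → S, (∏ i, w i (x i)) * g (x k) = ∏ i, (w i (x i) * if i = k then g (x i) else 1) := by
    intro x
    rw [Finset.prod_mul_distrib, Finset.prod_ite_eq']; simp
  simp_rw [e]
  rw [← Fintype.piFinset_univ, Finset.sum_prod_piFinset Finset.univ (fun i s => w i s * if i = k then g s else 1)]
  rw [Finset.prod_eq_single k]
  · simp
  · intro i _ hi; simp [hi, (hw i).2]
  · simp

lemma mean_bd [DecidableEq R] [DecidableEq C] {wu wv : S → ℝ} (hu : IsP wu) (hv : IsP wv) (σ : S → ℝ)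
    (c : (R ⊕ C → S) → A → ℝ) {e : I → R ⊕ C} {w : S → ℝ} (hw : ∀ i, wts R C wu wv (e i) = w) {N : ℝ} (hN : 0 < N)
    (hI : (Fintype.card I : ℝ) = N) :
    0 ≤ (∑ i, ov (pw (wts R C wu wv)) c (fun x => σ (x (e i)))) / N ∧
    (∑ i, ov (pw (wts R C wu wv)) c (fun x => σ (x (e i)))) / N ≤ pm w (fun s => σ s ^ 2) := by
  have hp := isP_pw (isP_wts (R := R) (C := C) hu hv)
  constructor
  · exact div_nonneg (Finset.sum_nonneg fun i _ => ov_nonneg hp _ _) hN.le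
  · rw [div_le_iff₀ hN]
    have : ∀ i, ov (pw (wts R C wu wv)) c (fun x => σ (x (e i))) ≤ pm w (fun s => σ s ^ 2) := by
      intro i
      refine (ov_le hp _ _).trans (le_of_eq ?_)
      rw [pm_pw_eval (isP_wts hu hv) (e i) (fun s => σ s ^ 2), hw]
    refine (Finset.sum_le_sum fun i _ => this i).trans ?_
    simp only [Finset.sum_const, Finset.card_univ, nsmul_eq_mul, hI]; linarith

set_option maxHeartbeats 1000000 in
/-- Existence of approximate solutions. -/
theorem approx {wu wv : S → ℝ} (hu : IsP wu) (hv : IsP wv) (σ : S → ℝ) {K Λ η : ℝ} (hσ : ∀ s, |σ s| ≤ K)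
    (hK : 0 ≤ K) (hΛ : 0 ≤ Λ) (hη : 0 < η) : ∃ n0 : ℕ, ∀ n : ℕ, n0 ≤ n → 0 < n ∧ ∀ lam : ℝ, 0 ≤ lam → lam ≤ Λ →
    ∃ h a b : ℝ, 0 ≤ h ∧ h ≤ η ∧ 0 ≤ a ∧ a ≤ pm wu (fun s => σ s ^ 2) ∧ 0 ≤ b ∧ b ≤ pm wv (fun s => σ s ^ 2) ∧
      |a - Fw wu σ (h + lam * b)| ≤ η ∧ |b - Fw wv σ (h + lam * a)| ≤ η ∧ |EE wu wv σ n lam h - a * b| ≤ η := by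
  have hCc := Ccav_nonneg (K := K) hΛ
  have hCs : 0 ≤ Csc K := by linarith [Csc_ge K]
  have hCf : 0 ≤ Cfl K Λ := by unfold Cfl; positivity
  obtain ⟨ε, hε⟩ : ∃ ε, ε = min 1 (η / (2 * (Ccav K Λ + K ^ 4 + 1))) := ⟨_, rfl⟩
  have hε0 : 0 < ε := by rw [hε]; positivity
  have hε1 : ε ≤ 1 := by rw [hε]; exact min_le_left _ _
  have hε2 : ε * (Ccav K Λ + K ^ 4 + 1) ≤ η / 2 := by
    have : ε ≤ η / (2 * (Ccav K Λ + K ^ 4 + 1)) := by rw [hε]; exact min_le_right _ _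
    rw [le_div_iff₀ (by positivity)] at this; linarith
  obtain ⟨G, hG⟩ : ∃ G, G = 1 + K ^ 2 * (Λ * K ^ 2 + 1) + Ccav K Λ * ((1 + 2 * K ^ 2) / ε ^ 7)
    + Csc K * K ^ 2 * Λ * (4 * Cfl K Λ + 2) := ⟨_, rfl⟩
  obtain ⟨H, hH⟩ : ∃ H, H = (1 + 2 * K ^ 2) * (1 + 1 / ε) + 2 * K ^ 2 * (4 * Cfl K Λ + 2) := ⟨_, rfl⟩
  have hG0 : 0 ≤ G := by rw [hG]; positivity
  have hH0 : 0 ≤ H := by rw [hH]; positivity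
  obtain ⟨Δ, hΔ⟩ : ∃ Δ, Δ = min 1 (η / (2 * (G + H + 1))) := ⟨_, rfl⟩
  have hΔ0 : 0 < Δ := by rw [hΔ]; positivity
  have hΔ1 : Δ ≤ 1 := by rw [hΔ]; exact min_le_left _ _
  have hΔ2 : Δ * (G + H + 1) ≤ η / 2 := by
    have : Δ ≤ η / (2 * (G + H + 1)) := by rw [hΔ]; exact min_le_right _ _
    rw [le_div_iff₀ (by positivity)] at this; linarith
  obtain ⟨M, hM⟩ := exists_nat_ge (2 * K ^ 2 / Δ + 1)
  have hM0 : (0 : ℝ) < M := lt_of_lt_of_le (by positivity) hM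
  have hM1 : (1 : ℝ) ≤ M := le_trans (by linarith [show 0 ≤ 2 * K ^ 2 / Δ by positivity]) hM
  have hM2 : 2 * K ^ 2 ≤ Δ * M := by
    have : 2 * K ^ 2 / Δ ≤ M := by linarith
    rw [div_le_iff₀ hΔ0] at this; linarith
  obtain ⟨δ, hδ⟩ : ∃ δ, δ = min η 1 / M := ⟨_, rfl⟩
  have hδ0 : 0 < δ := by rw [hδ]; positivity
  have hMδ : M * δ = min η 1 := by rw [hδ]; field_simp
  have hδ1 : δ ≤ 1 := by
    have : min η 1 ≤ 1 := min_le_right _ _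
    nlinarith
  obtain ⟨n0, hn0⟩ := exists_nat_ge ((1 / (δ * Δ)) ^ 2 + 1)
  refine ⟨n0, fun n hn => ?_⟩
  have hnn : (1 / (δ * Δ)) ^ 2 + 1 ≤ (n : ℝ) := hn0.trans (by exact_mod_cast hn)
  have hN1 : (1 : ℝ) ≤ n := le_trans (by linarith [sq_nonneg (1 / (δ * Δ))]) hnn
  have hN : (0 : ℝ) < n := by linarith
  refine ⟨by exact_mod_cast hN, fun lam hl0 hl1 => ?_⟩
  have hsq : 1 / (δ * Δ) ≤ Real.sqrt n := Real.le_sqrt_of_sq_le (by linarith)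
  have hs1 : 1 ≤ Real.sqrt n := Real.one_le_sqrt.2 hN1
  have hss : Real.sqrt n * Real.sqrt n = n := Real.mul_self_sqrt hN.le
  have hy : Real.sqrt n / (δ * n) ≤ Δ := by
    rw [div_le_iff₀ (by positivity)] at hsq
    rw [div_le_iff₀ (by positivity)]
    calc Real.sqrt n = Real.sqrt n * 1 := by ring
      _ ≤ Real.sqrt n * (Real.sqrt n * (δ * Δ)) := by gcongr
      _ = (Real.sqrt n * Real.sqrt n) * (δ * Δ) := by ring
      _ = Δ * (δ * n) := by rw [hss]; ring
  have hx : 1 / (δ * n) ≤ Δ := le_trans (by gcongr) hy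
  have hx0 : 0 ≤ 1 / (δ * n) := by positivity
  have hy0 : 0 ≤ Real.sqrt n / (δ * n) := by positivity
  have hτ : 0 ≤ lam / n := by positivity
  have hτN : lam / n * n ≤ Λ := by rw [div_mul_cancel₀ _ hN.ne']; exact hl1
  have hcard : (Fintype.card (Fin n) : ℝ) = n := by simp
  have hp := isP_pw (isP_wts (R := Fin n) (C := Fin n) hu hv)
  obtain ⟨k, hk, hT⟩ := pigeon (T := Tov (Fin n) (Fin n) wu wv σ (lam / n)) (X := n * (2 * K ^ 2)) (δ := δ)
    (M := M) (by exact_mod_cast hM0) (Finset.sum_nonneg fun i _ => ov_nonneg hp _ _) (by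
      unfold Tov
      refine (Finset.sum_le_sum fun k _ => ov_le_sq hp _ (K := K) (fun x => hσ _)).trans ?_
      simp; apply le_of_eq; ring)
  have hT' : Tov (Fin n) (Fin n) wu wv σ (lam / n) (k * δ + δ) - Tov (Fin n) (Fin n) wu wv σ (lam / n) (k * δ) ≤ n * Δ := by
    refine hT.trans ?_
    rw [div_le_iff₀ hM0]
    calc (n : ℝ) * (2 * K ^ 2) ≤ n * (Δ * M) := by gcongr
      _ = _ := by ring
  obtain ⟨h, hh⟩ : ∃ h, h = k * δ := ⟨_, rfl⟩
  rw [← hh] at hT'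
  have hh0 : 0 ≤ h := by rw [hh]; positivity
  have hhm : h ≤ min η 1 := by
    rw [hh, ← hMδ]
    have : (k : ℝ) ≤ M := by exact_mod_cast hk.le
    gcongr
  have hh1 := hhm.trans (min_le_right _ _)
  have hbu := mean_bd hu hv σ (sysc (R := Fin n) (C := Fin n) (lam / n) h σ) (e := Sum.inl) (w := wu) (fun i => rfl) hN hcard
  have hbv := mean_bd hu hv σ (sysc (R := Fin n) (C := Fin n) (lam / n) h σ) (e := Sum.inr) (w := wv) (fun i => rfl) hN hcard
  have ru := main_row hu hv σ hσ hK hτ hN hcard hcard hτN hh0 hh1 hδ0 hδ1 hε0 hε1 hT' (e := Sum.inl) (f := Sum.inr)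
    Sum.inl_injective Sum.inr_injective hcard hcard (fun i j => by simp) (fun g => Fintype.sum_sum_type g) (w := wu) (fun i => rfl)
    (fun x y => sysc_gram hτ hh0 σ x y)
  have rv := main_row hu hv σ hσ hK hτ hN hcard hcard hτN hh0 hh1 hδ0 hδ1 hε0 hε1 hT' (e := Sum.inr) (f := Sum.inl)
    Sum.inr_injective Sum.inl_injective hcard hcard (fun i j => by simp) (fun g => by rw [Fintype.sum_sum_type g, add_comm])
    (w := wv) (fun i => rfl)
    (fun x y => by rw [sysc_gram hτ hh0 σ x y]; ring)
  have rp := main_pair hu hv σ hσ hK hτ hN hcard hcard hτN hh0 hh1 hδ0 hδ1 hε0 hT'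
  have errR : Δ + K ^ 2 * (Λ * K ^ 2 + 1) * (1 / (δ * n)) + Ccav K Λ * ((1 / (δ * n) + 2 * K ^ 2) * Δ / ε ^ 7 + ε)
      + Csc K * K ^ 2 * Λ * (4 * Cfl K Λ * (Real.sqrt n / (δ * n)) + 2 * Δ) ≤ η := by
    have : Δ + K ^ 2 * (Λ * K ^ 2 + 1) * (1 / (δ * n)) + Ccav K Λ * ((1 / (δ * n) + 2 * K ^ 2) * Δ / ε ^ 7 + ε)
      + Csc K * K ^ 2 * Λ * (4 * Cfl K Λ * (Real.sqrt n / (δ * n)) + 2 * Δ)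
      ≤ Δ + K ^ 2 * (Λ * K ^ 2 + 1) * Δ + Ccav K Λ * ((1 + 2 * K ^ 2) * Δ / ε ^ 7 + ε)
      + Csc K * K ^ 2 * Λ * (4 * Cfl K Λ * Δ + 2 * Δ) := by
      have := hx.trans hΔ1
      gcongr
    refine this.trans ?_
    have e : Δ + K ^ 2 * (Λ * K ^ 2 + 1) * Δ + Ccav K Λ * ((1 + 2 * K ^ 2) * Δ / ε ^ 7 + ε)
      + Csc K * K ^ 2 * Λ * (4 * Cfl K Λ * Δ + 2 * Δ) = Δ * G + ε * Ccav K Λ := by rw [hG]; ring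
    rw [e]
    linarith [mul_nonneg hΔ0.le hH0, mul_nonneg hε0.le (show 0 ≤ K ^ 4 by positivity)]
  have errP : (1 / (δ * n) + 2 * K ^ 2) * Δ * (1 + 1 / ε) + ε * K ^ 4
      + 2 * K ^ 2 * (4 * Cfl K Λ * (Real.sqrt n / (δ * n)) + 2 * Δ) ≤ η := by
    have : (1 / (δ * n) + 2 * K ^ 2) * Δ * (1 + 1 / ε) + ε * K ^ 4
      + 2 * K ^ 2 * (4 * Cfl K Λ * (Real.sqrt n / (δ * n)) + 2 * Δ)
      ≤ (1 + 2 * K ^ 2) * Δ * (1 + 1 / ε) + ε * K ^ 4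
      + 2 * K ^ 2 * (4 * Cfl K Λ * Δ + 2 * Δ) := by
      have := hx.trans hΔ1
      gcongr
    refine this.trans ?_
    have e : (1 + 2 * K ^ 2) * Δ * (1 + 1 / ε) + ε * K ^ 4
      + 2 * K ^ 2 * (4 * Cfl K Λ * Δ + 2 * Δ) = Δ * H + ε * K ^ 4 := by rw [hH]; ring
    rw [e]
    linarith [mul_nonneg hΔ0.le hG0, mul_nonneg hε0.le hCc]
  have el : ∀ s : ℝ, lam / n * s = lam * (s / n) := fun s => by ring
  rw [el] at ru rv
  exact ⟨h, _, _, hh0, hhm.trans (min_le_left _ _), hbu.1, hbu.2, hbv.1, hbv.2, ru.trans errR, rv.trans errR, rp.trans errP⟩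
end BM
end

noncomputable section
set_option linter.unusedSectionVars false
set_option linter.unusedVariables false
namespace BM
variable {Ω A B I J R C S : Type} [Fintype Ω] [Fintype A] [Fintype B] [Fintype I] [Fintype J] [Fintype S]
  [Fintype R] [Fintype C]

lemma EE_mono {wu wv : S → ℝ} (hu : IsP wu) (hv : IsP wv) (σ : S → ℝ) (n : ℕ) {lam h : ℝ} (hl : 0 ≤ lam) (hh : 0 ≤ h) :
    EE wu wv σ n lam 0 ≤ EE wu wv σ n lam h := by
  have hp := isP_pw (isP_wts (R := Fin n) (C := Fin n) hu hv)
  unfold EE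
  apply div_le_div_of_nonneg_right _ (by positivity)
  refine Finset.sum_le_sum fun i _ => Finset.sum_le_sum fun j _ => ?_
  refine (ov_le_cd hp _ (sc h (crd σ)) _).trans (le_of_eq ?_)
  have := ov_gram (pw (wts (Fin n) (Fin n) wu wv)) _ _ (sysc_add_gram (R := Fin n) (C := Fin n) (τ := lam / n) (h := 0) (δ := h)
    (by positivity) le_rfl hh σ) (fun x => σ (x (Sum.inl i)) * σ (x (Sum.inr j)))
  rw [this, zero_add]

lemma sysc_lam_gram [DecidableEq R] [DecidableEq C] {τ τ' h : ℝ} (hτ : 0 ≤ τ) (hτ' : 0 ≤ τ') (hh : 0 ≤ h) (σ : S → ℝ) (x y : R ⊕ C → S) :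
    ∑ a, cd (sysc τ h σ) (sc τ' (prodc σ)) x a * cd (sysc τ h σ) (sc τ' (prodc σ)) y a
      = ∑ a, sysc (τ + τ') h σ x a * sysc (τ + τ') h σ y a := by
  unfold sysc
  rw [cd_gram, cd_gram, cd_gram, sc_gram hτ, sc_gram hτ', sc_gram hh, sc_gram (add_nonneg hτ hτ')]; ring

/-- free entropy -/
def PP (wu wv σ : S → ℝ) (n : ℕ) (lam h : ℝ) : ℝ := Phi (pw (wts (Fin n) (Fin n) wu wv)) (sysc (lam / n) h σ)

lemma sum_prodc_ov {n : ℕ} (p : (Fin n ⊕ Fin n → S) → ℝ) (c : (Fin n ⊕ Fin n → S) → A → ℝ) (σ : S → ℝ) {τ : ℝ} (hτ : 0 ≤ τ) :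
    ∑ b, ov p c (fun x => sc τ (prodc σ) x b) = τ * ∑ i, ∑ j, ov p c (fun x => σ (x (Sum.inl i)) * σ (x (Sum.inr j))) := by
  simp only [ov_sc p c _ hτ]
  rw [← Finset.mul_sum, Fintype.sum_prod_type]; rfl

lemma PP_lam {wu wv : S → ℝ} (hu : IsP wu) (hv : IsP wv) (σ : S → ℝ) {n : ℕ} (hn : 0 < n) {lam t h : ℝ} (hl : 0 ≤ lam) (ht : 0 ≤ t)
    (hh : 0 ≤ h) : PP wu wv σ n lam h + t * n * EE wu wv σ n lam h / 2 ≤ PP wu wv σ n (lam + t) h ∧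
     PP wu wv σ n (lam + t) h ≤ PP wu wv σ n lam h + t * n * EE wu wv σ n (lam + t) h / 2 := by
  have hp := isP_pw (isP_wts (R := Fin n) (C := Fin n) hu hv)
  have hn' : (0 : ℝ) < n := by exact_mod_cast hn
  have g := sysc_lam_gram (R := Fin n) (C := Fin n) (τ := lam / n) (τ' := t / n) (h := h)
    (by positivity) (by positivity) hh σ
  rw [← add_div] at g
  have a1 := Phi_cd_ge hp (sysc (R := Fin n) (C := Fin n) (lam / n) h σ) (sc (t / n) (prodc σ))
  have a2 := Phi_cd_le hp (sysc (R := Fin n) (C := Fin n) (lam / n) h σ) (sc (t / n) (prodc σ))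
  rw [Phi_gram _ _ _ g, sum_prodc_ov _ _ _ (by positivity)] at a1 a2
  simp only [ov_gram _ _ _ g] at a2
  have e : ∀ l, t * n * EE wu wv σ n l h = t / n * ∑ i : Fin n, ∑ j : Fin n, ov (pw (wts (Fin n) (Fin n) wu wv)) (sysc (l / n) h σ)
    (fun x => σ (x (Sum.inl i)) * σ (x (Sum.inr j))) := by
    intro l; unfold EE; field_simp
  rw [e, e]
  exact ⟨a1, a2⟩

lemma PP_h {wu wv : S → ℝ} (hu : IsP wu) (hv : IsP wv) (σ : S → ℝ) {K : ℝ} (hσ : ∀ s, |σ s| ≤ K) (n : ℕ)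
    {lam h : ℝ} (hl : 0 ≤ lam) (hh : 0 ≤ h) :
    PP wu wv σ n lam 0 ≤ PP wu wv σ n lam h ∧ PP wu wv σ n lam h ≤ PP wu wv σ n lam 0 + h * n * K ^ 2 := by
  have hp := isP_pw (isP_wts (R := Fin n) (C := Fin n) hu hv)
  have g := sysc_add_gram (R := Fin n) (C := Fin n) (τ := lam / n) (h := 0) (δ := h)
    (by positivity) le_rfl hh σ
  rw [zero_add] at g
  have a1 := Phi_cd_ge hp (sysc (R := Fin n) (C := Fin n) (lam / n) 0 σ) (sc h (crd σ))
  have a2 := Phi_cd_le hp (sysc (R := Fin n) (C := Fin n) (lam / n) 0 σ) (sc h (crd σ))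
  rw [Phi_gram _ _ _ g] at a1 a2
  constructor
  · refine le_trans ?_ a1
    have : 0 ≤ ∑ b, ov (pw (wts (Fin n) (Fin n) wu wv)) (sysc (lam / n) 0 σ) (fun x => sc h (crd σ) x b) :=
      Finset.sum_nonneg fun _ _ => ov_nonneg hp _ _
    unfold PP; linarith
  · refine a2.trans ?_
    simp only [ov_sc _ _ _ hh]
    rw [← Finset.mul_sum]
    have : ∑ k, ov (pw (wts (Fin n) (Fin n) wu wv)) (cd (sysc (lam / n) 0 σ) (sc h (crd σ))) (fun x => crd σ x k) ≤ 2 * n * K ^ 2 := by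
      refine (Finset.sum_le_sum fun k _ => ov_le_sq hp _ (K := K) (fun x => hσ _)).trans ?_
      simp; apply le_of_eq; ring
    have := mul_le_mul_of_nonneg_left this hh
    unfold PP; linarith

lemma EE_lower {wu wv : S → ℝ} (hu : IsP wu) (hv : IsP wv) (σ : S → ℝ) {K : ℝ} (hσ : ∀ s, |σ s| ≤ K) {n : ℕ} (hn : 0 < n)
    {lam t h : ℝ} (hl : 0 ≤ lam) (ht : 0 < t) (hh : 0 ≤ h) :
    EE wu wv σ n lam h ≤ EE wu wv σ n (lam + t) 0 + 2 * h * K ^ 2 / t := by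
  have hn' : (0 : ℝ) < n := by exact_mod_cast hn
  have a1 := (PP_lam hu hv σ hn hl ht.le hh).1
  have a2 := (PP_lam hu hv σ hn hl ht.le le_rfl).2
  have a3 := (PP_h hu hv σ hσ n hl hh).1
  have a4 := (PP_h hu hv σ hσ n (add_nonneg hl ht.le) hh).2
  have a5 : t * n / 2 * EE wu wv σ n lam h ≤ t * n / 2 * (EE wu wv σ n (lam + t) 0 + 2 * h * K ^ 2 / t) := by
    have : t * n / 2 * (EE wu wv σ n (lam + t) 0 + 2 * h * K ^ 2 / t) = t * n * EE wu wv σ n (lam + t) 0 / 2 + h * n * K ^ 2 := by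
      field_simp
    rw [this]; linarith
  exact le_of_mul_le_mul_left a5 (by positivity)

lemma entropy_ge {p : Ω → ℝ} (hp : IsP p) : - Real.log (Fintype.card Ω) ≤ ∑ x, p x * Real.log (p x) := by
  obtain ⟨x0, _⟩ := hp.exists_pos
  have hc : (0 : ℝ) < Fintype.card Ω := by exact_mod_cast Fintype.card_pos_iff.2 ⟨x0⟩
  have h : ∀ x, p x - 1 / Fintype.card Ω ≤ p x * Real.log (p x) + p x * Real.log (Fintype.card Ω) := by
    intro x
    rcases eq_or_lt_of_le (hp.1 x) with h0 | h0
    · rw [← h0]; simp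
    · rw [← mul_add, ← Real.log_mul h0.ne' hc.ne']
      have := Real.one_sub_inv_le_log_of_pos (mul_pos h0 hc)
      have := mul_le_mul_of_nonneg_left this h0.le
      refine le_trans (le_of_eq ?_) this
      field_simp
  have := Finset.sum_le_sum fun x (_ : x ∈ (Finset.univ : Finset Ω)) => h x
  rw [Finset.sum_sub_distrib, Finset.sum_add_distrib, ← Finset.sum_mul, hp.2] at this
  simp only [Finset.sum_const, Finset.card_univ, nsmul_eq_mul] at this
  rw [mul_one_div_cancel hc.ne'] at this
  linarith

lemma pm_pw_pair [DecidableEq J] {w : J → S → ℝ} (hw : ∀ i, IsP (w i)) {k l : J} (hkl : k ≠ l) (g g' : S → ℝ) :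
    pm (pw w) (fun x => g (x k) * g' (x l)) = pm (w k) g * pm (w l) g' := by
  unfold pm pw
  have e : ∀ x : J → S, (∏ i, w i (x i)) * (g (x k) * g' (x l))
      = ∏ i, (w i (x i) * ((if i = k then g (x i) else 1) * if i = l then g' (x i) else 1)) := by
    intro x
    rw [Finset.prod_mul_distrib, Finset.prod_mul_distrib, Finset.prod_ite_eq', Finset.prod_ite_eq']; simp
  simp_rw [e]
  rw [← Fintype.piFinset_univ, Finset.sum_prod_piFinset Finset.univ
    (fun i s => w i s * ((if i = k then g s else 1) * if i = l then g' s else 1))]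
  rw [Finset.prod_eq_mul k l hkl]
  · simp [hkl, hkl.symm]
  · intro i _ hi; simp [hi.1, hi.2, (hw i).2]
  · simp
  · simp

lemma Phi_zero {p : Ω → ℝ} (hp : IsP p) (c : Ω → A → ℝ) (h : ∀ x y, ∑ a, c x a * c y a = 0) : Phi p c = 0 := by
  rw [Phi_gram p c (fun _ (_ : Empty) => 0) (by simpa using h)]
  unfold Phi Zc
  have : ∀ Y : Empty → ℝ, ∑ x, p x * el (fun _ => 0) Y = 1 := by
    intro Y; simp [el, hp.2]
  simp only [this]; simp

lemma EE_entropy {wu wv : S → ℝ} (hu : IsP wu) (hv : IsP wv) (σ : S → ℝ) {n : ℕ} (hn : 0 < n) {lam : ℝ} (hl : 0 < lam) :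
    pm wu (fun s => σ s ^ 2) * pm wv (fun s => σ s ^ 2) - 4 * Real.log (Fintype.card S) / lam ≤ EE wu wv σ n lam 0 := by
  have hp := isP_pw (isP_wts (R := Fin n) (C := Fin n) hu hv)
  have hn' : (0 : ℝ) < n := by exact_mod_cast hn
  have a1 := (PP_lam hu hv σ hn le_rfl hl.le le_rfl).2
  rw [zero_add] at a1
  have a2 : PP wu wv σ n 0 0 = 0 := by
    refine Phi_zero hp _ fun x y => ?_
    rw [sysc_gram (by simp) le_rfl]; simp
  have a3 := Phi_ge_entropy hp (sysc (R := Fin n) (C := Fin n) (lam / n) 0 σ)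
  have a4 := entropy_ge hp
  have a5 : (Real.log (Fintype.card (Fin n ⊕ Fin n → S)) : ℝ) = 2 * n * Real.log (Fintype.card S) := by
    rw [Fintype.card_fun]; simp [Real.log_pow]; left; ring
  have a6 : pm (pw (wts (Fin n) (Fin n) wu wv)) (fun x => ∑ a, sysc (R := Fin n) (C := Fin n) (lam / n) 0 σ x a ^ 2)
      = lam * n * (pm wu (fun s => σ s ^ 2) * pm wv (fun s => σ s ^ 2)) := by
    have e : ∀ x : Fin n ⊕ Fin n → S, ∑ a, sysc (R := Fin n) (C := Fin n) (lam / n) 0 σ x a ^ 2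
        = lam / n * ∑ i : Fin n, ∑ j : Fin n, σ (x (Sum.inl i)) ^ 2 * σ (x (Sum.inr j)) ^ 2 := by
      intro x
      have := sysc_gram (R := Fin n) (C := Fin n) (τ := lam / n) (h := 0) (by positivity) le_rfl σ x x
      simp only [zero_mul, add_zero, ← sq] at this
      rw [this, Finset.sum_mul_sum]
    simp only [e]
    rw [pm_smul, pm_sum]
    simp only [pm_sum]
    have e2 : ∀ i j : Fin n, pm (pw (wts (Fin n) (Fin n) wu wv)) (fun x => σ (x (Sum.inl i)) ^ 2 * σ (x (Sum.inr j)) ^ 2)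
       = pm wu (fun s => σ s ^ 2) * pm wv (fun s => σ s ^ 2) := fun i j =>
      pm_pw_pair (isP_wts hu hv) (k := Sum.inl i) (l := Sum.inr j) (by simp) (fun s => σ s ^ 2) (fun s => σ s ^ 2)
    simp only [e2]; simp; field_simp
  rw [a6] at a3
  rw [a5] at a4
  rw [a2] at a1
  unfold PP at a1
  have a7 : lam * n / 2 * (pm wu (fun s => σ s ^ 2) * pm wv (fun s => σ s ^ 2) - 4 * Real.log (Fintype.card S) / lam)
     ≤ lam * n / 2 * EE wu wv σ n lam 0 := by
    have : lam * n / 2 * (pm wu (fun s => σ s ^ 2) * pm wv (fun s => σ s ^ 2) - 4 * Real.log (Fintype.card S) / lam)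
      = lam * n * (pm wu (fun s => σ s ^ 2) * pm wv (fun s => σ s ^ 2)) / 2 - 2 * n * Real.log (Fintype.card S) := by
      field_simp; ring
    rw [this]; linarith
  exact le_of_mul_le_mul_left a7 (by positivity)

lemma EE_le {wu wv : S → ℝ} (hu : IsP wu) (hv : IsP wv) (σ : S → ℝ) {n : ℕ} (hn : 0 < n) (lam h : ℝ) :
    EE wu wv σ n lam h ≤ pm wu (fun s => σ s ^ 2) * pm wv (fun s => σ s ^ 2) := by
  have hp := isP_pw (isP_wts (R := Fin n) (C := Fin n) hu hv)
  have hn' : (0 : ℝ) < n := by exact_mod_cast hn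
  unfold EE
  rw [div_le_iff₀ (by positivity)]
  have : ∀ i j : Fin n, ov (pw (wts (Fin n) (Fin n) wu wv)) (sysc (lam / n) h σ) (fun x => σ (x (Sum.inl i)) * σ (x (Sum.inr j)))
      ≤ pm wu (fun s => σ s ^ 2) * pm wv (fun s => σ s ^ 2) := by
    intro i j
    refine (ov_le hp _ _).trans (le_of_eq ?_)
    simp only [mul_pow]
    exact pm_pw_pair (isP_wts hu hv) (k := Sum.inl i) (l := Sum.inr j) (by simp) (fun s => σ s ^ 2) (fun s => σ s ^ 2)
  refine (Finset.sum_le_sum fun i _ => Finset.sum_le_sum fun j _ => this i j).trans (le_of_eq ?_)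
  simp; ring
end BM
end

noncomputable section
set_option linter.unusedSectionVars false
set_option linter.unusedVariables false
namespace BM
variable {Ω A B I J R C S : Type} [Fintype Ω] [Fintype A] [Fintype B] [Fintype I] [Fintype J] [Fintype S]
  [Fintype R] [Fintype C]

lemma stab1 {w : S → ℝ} (hw : IsP w) (σ : S → ℝ) {K : ℝ} (hσ : ∀ s, |σ s| ≤ K) {m lam η h h' l l' b b' a a' : ℝ}
    (hm : 0 ≤ m) (hk : Csc K * (pm w (fun s => σ s ^ 2) - Fw w σ m) * lam ≤ 1 / 2)
    (hh : 0 ≤ h) (hhη : h ≤ η) (hh' : 0 ≤ h') (hhη' : h' ≤ η) (hl : 0 ≤ l) (hl1 : l ≤ lam)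
    (hb' : 0 ≤ b') (hb2 : b' ≤ K ^ 2) (h1 : m ≤ h + l * b) (h2 : m ≤ h' + l' * b')
    (ha : |a - Fw w σ (h + l * b)| ≤ η) (ha' : |a' - Fw w σ (h' + l' * b')| ≤ η) :
    |a - a'| ≤ 2 * η + Csc K * K ^ 2 * (η + K ^ 2 * |l - l'|) + |b - b'| / 2 := by
  have hCs : 0 ≤ Csc K := by linarith [Csc_ge K]
  obtain ⟨κ, hκ⟩ : ∃ κ, κ = Csc K * (pm w (fun s => σ s ^ 2) - Fw w σ m) := ⟨_, rfl⟩
  have L := Fw_lip hw σ hσ hm h1 h2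
  rw [← hκ] at L hk
  have hκ0 : 0 ≤ κ := by rw [hκ]; exact mul_nonneg hCs (sub_nonneg.2 (Fw_le hw σ m))
  have hκ1 : κ ≤ Csc K * K ^ 2 := by
    rw [hκ]; refine mul_le_mul_of_nonneg_left ?_ hCs
    have := pm_sq_le_K hw hσ
    linarith [Fw_nonneg hw σ m]
  have e1 : |h + l * b - (h' + l' * b')| ≤ η + l * |b - b'| + K ^ 2 * |l - l'| := by
    have : h + l * b - (h' + l' * b') = (h - h') + l * (b - b') + (l - l') * b' := by ring
    rw [this]
    refine (abs_add_three _ _ _).trans ?_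
    rw [abs_mul, abs_mul, abs_of_nonneg hl, abs_of_nonneg hb']
    have : |h - h'| ≤ η := abs_le.2 ⟨by linarith, by linarith⟩
    have : |l - l'| * b' ≤ K ^ 2 * |l - l'| := by rw [mul_comm]; exact mul_le_mul_of_nonneg_right hb2 (abs_nonneg _)
    linarith
  have e2 : κ * |h + l * b - (h' + l' * b')| ≤ Csc K * K ^ 2 * (η + K ^ 2 * |l - l'|) + |b - b'| / 2 := by
    refine (mul_le_mul_of_nonneg_left e1 hκ0).trans ?_
    have x1 : κ * l ≤ 1 / 2 := (mul_le_mul_of_nonneg_left hl1 hκ0).trans hk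
    have x2 := mul_le_mul_of_nonneg_right x1 (abs_nonneg (b - b'))
    have x3 := mul_le_mul_of_nonneg_right hκ1 (show 0 ≤ η + K ^ 2 * |l - l'| by
      have := abs_nonneg (l - l'); have := sq_nonneg K; have : 0 ≤ η := hh.trans hhη; positivity)
    linarith
  have e3 : a - a' = (a - Fw w σ (h + l * b)) + (Fw w σ (h + l * b) - Fw w σ (h' + l' * b')) - (a' - Fw w σ (h' + l' * b')) := by ring
  rw [e3]
  refine (abs_sub _ _).trans ?_
  have := abs_add_le (a - Fw w σ (h + l * b)) (Fw w σ (h + l * b) - Fw w σ (h' + l' * b'))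
  linarith

lemma cauchy_of_stab {wu wv : S → ℝ} (hu : IsP wu) (hv : IsP wv) (σ : S → ℝ) {K : ℝ} (hσ : ∀ s, |σ s| ≤ K) (hK : 0 ≤ K)
    {lam r mu mv η0 : ℝ} (hl : 0 < lam) (hr : 0 < r) (hr1 : r ≤ lam) (hη0 : 0 < η0) (hmu : 0 ≤ mu) (hmv : 0 ≤ mv)
    (ku : Csc K * (pm wu (fun s => σ s ^ 2) - Fw wu σ mu) * lam ≤ 1 / 2)
    (kv : Csc K * (pm wv (fun s => σ s ^ 2) - Fw wv σ mv) * lam ≤ 1 / 2)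
    (hs : ∀ n : ℕ, 0 < n → ∀ l, lam - r ≤ l → l ≤ lam → ∀ h a b, 0 ≤ h → 0 ≤ a → a ≤ pm wu (fun s => σ s ^ 2) →
      0 ≤ b → b ≤ pm wv (fun s => σ s ^ 2) → |EE wu wv σ n l h - a * b| ≤ η0 → mu ≤ h + l * b ∧ mv ≤ h + l * a) :
    ∃ L, Tendsto (fun n => EE wu wv σ n lam 0) atTop (𝓝 L) := by
  have hCs : 0 ≤ Csc K := by linarith [Csc_ge K]
  have hρu := pm_sq_le_K hu hσ
  have hρv := pm_sq_le_K hv hσ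
  have key : ∀ ε > 0, ∃ N : ℕ, ∀ m ≥ N, ∀ n ≥ N, EE wu wv σ n lam 0 - EE wu wv σ m lam 0 < ε := by
    intro ε hε
    obtain ⟨A1, hA1⟩ : ∃ A1, A1 = 8 * K ^ 2 + 4 * K ^ 2 * (Csc K * K ^ 2) + 2 := ⟨_, rfl⟩
    obtain ⟨A2, hA2⟩ : ∃ A2, A2 = 4 * K ^ 2 * (Csc K * K ^ 2) * K ^ 2 := ⟨_, rfl⟩
    have hA10 : 0 ≤ A1 := by rw [hA1]; positivity
    have hA20 : 0 ≤ A2 := by rw [hA2]; positivity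
    obtain ⟨t, ht⟩ : ∃ t, t = min r (ε / (4 * (A2 + 1))) := ⟨_, rfl⟩
    have ht0 : 0 < t := by rw [ht]; positivity
    have ht1 : t ≤ r := by rw [ht]; exact min_le_left _ _
    have ht2 : A2 * t ≤ ε / 4 := by
      have : t ≤ ε / (4 * (A2 + 1)) := by rw [ht]; exact min_le_right _ _
      rw [le_div_iff₀ (by positivity)] at this; nlinarith
    obtain ⟨η, hη⟩ : ∃ η, η = min η0 (min (t * ε / (4 * (2 * K ^ 2 + 1))) (ε / (4 * (A1 + 1)))) := ⟨_, rfl⟩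
    have hη1 : 0 < η := by rw [hη]; positivity
    have hη2 : η ≤ η0 := by rw [hη]; exact min_le_left _ _
    have hη3 : 2 * η * K ^ 2 / t ≤ ε / 4 := by
      have : η ≤ t * ε / (4 * (2 * K ^ 2 + 1)) := by rw [hη]; exact (min_le_right _ _).trans (min_le_left _ _)
      rw [le_div_iff₀ (by positivity)] at this
      rw [div_le_iff₀ ht0]; nlinarith
    have hη4 : A1 * η ≤ ε / 4 := by
      have : η ≤ ε / (4 * (A1 + 1)) := by rw [hη]; exact (min_le_right _ _).trans (min_le_right _ _)
      rw [le_div_iff₀ (by positivity)] at this; nlinarith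
    obtain ⟨N, hN⟩ := approx hu hv σ hσ hK hl.le hη1
    refine ⟨N, fun m hm n hn => ?_⟩
    obtain ⟨hn0, hn'⟩ := hN n hn
    obtain ⟨hm0, hm'⟩ := hN m hm
    obtain ⟨h, a, b, h1, h2, a1, a2, b1, b2, E1, E2, E3⟩ := hn' lam hl.le le_rfl
    obtain ⟨h', a', b', h1', h2', a1', a2', b1', b2', E1', E2', E3'⟩ := hm' (lam - t) (by linarith) (by linarith)
    obtain ⟨s1, s2⟩ := hs n hn0 lam (by linarith) le_rfl h a b h1 a1 a2 b1 b2 (E3.trans hη2)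
    obtain ⟨s1', s2'⟩ := hs m hm0 (lam - t) (by linarith) (by linarith) h' a' b' h1' a1' a2' b1' b2' (E3'.trans hη2)
    have q1 := stab1 hu σ hσ hmu ku h1 h2 h1' h2' hl.le le_rfl b1' (b2'.trans hρv) s1 s1' E1 E1'
    have q2 := stab1 hv σ hσ hmv kv h1 h2 h1' h2' hl.le le_rfl a1' (a2'.trans hρu) s2 s2' E2 E2'
    have et : |lam - (lam - t)| = t := by rw [sub_sub_cancel, abs_of_pos ht0]
    rw [et] at q1 q2
    have up := EE_mono hu hv σ n hl.le h1
    have lo := EE_lower hu hv σ hσ hm0 (lam := lam - t) (t := t) (h := h') (by linarith) ht0 h1'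
    rw [sub_add_cancel] at lo
    have lo2 : 2 * h' * K ^ 2 / t ≤ 2 * η * K ^ 2 / t := by gcongr
    have pr : a * b - a' * b' ≤ K ^ 2 * (|a - a'| + |b - b'|) := by
      have : a * b - a' * b' = a * (b - b') + b' * (a - a') := by ring
      rw [this]
      have x1 : a * (b - b') ≤ K ^ 2 * |b - b'| := by
          calc a * (b - b') ≤ a * |b - b'| := mul_le_mul_of_nonneg_left (le_abs_self _) a1
            _ ≤ _ := mul_le_mul_of_nonneg_right (a2.trans hρu) (abs_nonneg _)
      have x2 : b' * (a - a') ≤ K ^ 2 * |a - a'| := by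
          calc b' * (a - a') ≤ b' * |a - a'| := mul_le_mul_of_nonneg_left (le_abs_self _) b1'
            _ ≤ _ := mul_le_mul_of_nonneg_right (b2'.trans hρv) (abs_nonneg _)
      linarith
    have sm : |a - a'| + |b - b'| ≤ 4 * (2 * η + Csc K * K ^ 2 * (η + K ^ 2 * t)) := by linarith
    have pr2 := pr.trans (mul_le_mul_of_nonneg_left sm (sq_nonneg K))
    have f1 := (abs_le.1 E3).2
    have f2 := (abs_le.1 E3').1
    have fin : K ^ 2 * (4 * (2 * η + Csc K * K ^ 2 * (η + K ^ 2 * t))) + 2 * η = A1 * η + A2 * t := by rw [hA1, hA2]; ring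
    linarith
  have : CauchySeq (fun n => EE wu wv σ n lam 0) := by
    rw [Metric.cauchySeq_iff]
    intro ε hε
    obtain ⟨N, hN⟩ := key ε hε
    refine ⟨N, fun m hm n hn => ?_⟩
    rw [Real.dist_eq, abs_lt]
    have := hN m hm n hn
    have := hN n hn m hm
    constructor <;> linarith
  exact cauchySeq_tendsto_of_complete this
end BM
end

noncomputable section
set_option linter.unusedSectionVars false
set_option linter.unusedVariables false
namespace BM
variable {Ω A B I J R C S : Type} [Fintype Ω] [Fintype A] [Fintype B] [Fintype I] [Fintype J] [Fintype S]
  [Fintype R] [Fintype C]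

lemma EE_ge {wu wv : S → ℝ} (hu : IsP wu) (hv : IsP wv) (σ : S → ℝ) {n : ℕ} (hn : 0 < n) (lam h : ℝ) :
    pm wu σ ^ 2 * pm wv σ ^ 2 ≤ EE wu wv σ n lam h := by
  have hp := isP_pw (isP_wts (R := Fin n) (C := Fin n) hu hv)
  have hn' : (0 : ℝ) < n := by exact_mod_cast hn
  unfold EE
  rw [le_div_iff₀ (by positivity)]
  have : ∀ i j : Fin n, pm wu σ ^ 2 * pm wv σ ^ 2 ≤
      ov (pw (wts (Fin n) (Fin n) wu wv)) (sysc (lam / n) h σ) (fun x => σ (x (Sum.inl i)) * σ (x (Sum.inr j))) := by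
    intro i j
    refine le_trans (le_of_eq ?_) (sq_le_ov hp _ _)
    rw [pm_pw_pair (isP_wts hu hv) (k := Sum.inl i) (l := Sum.inr j) (by simp) σ σ, mul_pow]; rfl
  refine le_trans (le_of_eq ?_) (Finset.sum_le_sum fun i _ => Finset.sum_le_sum fun j _ => this i j)
  simp; ring

theorem low_lim {wu wv : S → ℝ} (hu : IsP wu) (hv : IsP wv) (σ : S → ℝ) {K : ℝ} (hσ : ∀ s, |σ s| ≤ K) (hK : 0 ≤ K)
    {ε : ℝ} (hε : 0 < ε) : ∃ δ > 0, ∀ lam : ℝ, 0 < lam → lam < δ →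
      ∃ L, Tendsto (fun n => EE wu wv σ n lam 0) atTop (𝓝 L) ∧ |L - pm wu σ ^ 2 * pm wv σ ^ 2| < ε := by
  have hCs : 0 ≤ Csc K := by linarith [Csc_ge K]
  obtain ⟨C0, hC0⟩ : ∃ C0, C0 = Csc K * K ^ 2 := ⟨_, rfl⟩
  have hC00 : 0 ≤ C0 := by rw [hC0]; positivity
  obtain ⟨C2, hC2⟩ : ∃ C2, C2 = 1 + 2 * K ^ 2 * (1 + C0 * (1 + K ^ 2)) := ⟨_, rfl⟩
  have hC20 : 0 < C2 := by rw [hC2]; positivity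
  have hρu := pm_sq_le_K hu hσ
  have hρv := pm_sq_le_K hv hσ
  refine ⟨min (1 / (2 * (C0 + 1))) (ε / C2), by positivity, fun lam hl hlt => ?_⟩
  have l1 : C0 * lam ≤ 1 / 2 := by
    have : lam < 1 / (2 * (C0 + 1)) := hlt.trans_le (min_le_left _ _)
    rw [lt_div_iff₀ (by positivity)] at this
    nlinarith
  have l2 : C2 * lam < ε := by
    have : lam < ε / C2 := hlt.trans_le (min_le_right _ _)
    rw [lt_div_iff₀ hC20] at this; linarith
  have kk : ∀ {w : S → ℝ}, IsP w → Csc K * (pm w (fun s => σ s ^ 2) - Fw w σ 0) * lam ≤ 1 / 2 := by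
    intro w hw
    refine le_trans (mul_le_mul_of_nonneg_right ?_ hl.le) l1
    rw [hC0]
    refine mul_le_mul_of_nonneg_left ?_ hCs
    linarith [pm_sq_le_K hw hσ, Fw_nonneg hw σ 0]
  obtain ⟨L, hL⟩ := cauchy_of_stab hu hv σ hσ hK (lam := lam) (r := lam) (mu := 0) (mv := 0) (η0 := 1) hl hl le_rfl one_pos
    le_rfl le_rfl (kk hu) (kk hv) (fun n hn l h1 h2 h a b hh ha _ hb _ _ => by
      have : 0 ≤ l := by linarith
      constructor <;> positivity)
  refine ⟨L, hL, ?_⟩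
  obtain ⟨N, hN⟩ := approx hu hv σ hσ hK hl.le hl
  have lo : pm wu σ ^ 2 * pm wv σ ^ 2 ≤ L := ge_of_tendsto hL (by
    filter_upwards [eventually_gt_atTop 0] with n hn
    exact EE_ge hu hv σ hn _ _)
  have up : L ≤ pm wu σ ^ 2 * pm wv σ ^ 2 + C2 * lam := le_of_tendsto hL (by
    filter_upwards [eventually_ge_atTop N] with n hn
    obtain ⟨hn0, hn'⟩ := hN n hn
    obtain ⟨h, a, b, h1, h2, a1, a2, b1, b2, E1, E2, E3⟩ := hn' lam hl.le le_rfl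
    have up := EE_mono hu hv σ n hl.le h1
    have f1 := (abs_le.1 E3).2
    have cl : ∀ {w : S → ℝ}, IsP w → ∀ a b : ℝ, 0 ≤ b → b ≤ K ^ 2 → |a - Fw w σ (h + lam * b)| ≤ lam →
        a ≤ pm w σ ^ 2 + lam * (1 + C0 * (1 + K ^ 2)) := by
      intro w hw a b hb hb2 hE
      have hg : 0 ≤ h + lam * b := by positivity
      have x := Fw_lip0 hw σ hσ hg le_rfl
      rw [Fw_zero hw, sub_zero, abs_of_nonneg hg, ← hC0] at x
      have x2 : C0 * (h + lam * b) ≤ C0 * (lam + lam * K ^ 2) := by gcongr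
      have := (abs_le.1 hE).2
      have := (abs_le.1 x).2
      linarith
    have ca := cl hu a b b1 (b2.trans hρv) E1
    have cb := cl hv b a a1 (a2.trans hρu) E2
    have hB : pm wv σ ^ 2 ≤ K ^ 2 := (pm_sq_le hv σ).trans hρv
    obtain ⟨x, hx⟩ : ∃ x, x = lam * (1 + C0 * (1 + K ^ 2)) := ⟨_, rfl⟩
    rw [← hx] at ca cb
    have hx0 : 0 ≤ x := by rw [hx]; positivity
    have p1 : a * b ≤ a * (pm wv σ ^ 2) + K ^ 2 * x := by
      have := mul_le_mul_of_nonneg_left cb a1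
      have := mul_le_mul_of_nonneg_right (a2.trans hρu) hx0
      linarith
    have p2 : a * (pm wv σ ^ 2) ≤ pm wu σ ^ 2 * pm wv σ ^ 2 + K ^ 2 * x := by
      have := mul_le_mul_of_nonneg_right ca (sq_nonneg (pm wv σ))
      have := mul_le_mul_of_nonneg_right hB hx0
      linarith
    have : C2 * lam = lam + 2 * (K ^ 2 * x) := by rw [hC2, hx]; ring
    linarith)
  rw [abs_of_nonneg (by linarith)]; linarith

theorem high_lim {wu wv : S → ℝ} (hu : IsP wu) (hv : IsP wv) (σ : S → ℝ) {K : ℝ} (hσ : ∀ s, |σ s| ≤ K) (hK : 0 ≤ K)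
    (hpu : 0 < pm wu (fun s => σ s ^ 2)) (hpv : 0 < pm wv (fun s => σ s ^ 2))
    {ε : ℝ} (hε : 0 < ε) : ∃ M : ℝ, ∀ lam : ℝ, 0 < lam → M < lam →
      ∃ L, Tendsto (fun n => EE wu wv σ n lam 0) atTop (𝓝 L) ∧
        |L - pm wu (fun s => σ s ^ 2) * pm wv (fun s => σ s ^ 2)| < ε := by
  have hCs : 0 < Csc K := by linarith [Csc_ge K]
  obtain ⟨ρ, hρ⟩ : ∃ ρ, ρ = pm wu (fun s => σ s ^ 2) := ⟨_, rfl⟩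
  obtain ⟨θ, hθ⟩ : ∃ θ, θ = pm wv (fun s => σ s ^ 2) := ⟨_, rfl⟩
  obtain ⟨Gu, hGu, du⟩ := Fw_decay hu σ (ε := θ / (8 * Csc K)) (by rw [hθ]; positivity)
  obtain ⟨Gv, hGv, dv⟩ := Fw_decay hv σ (ε := ρ / (8 * Csc K)) (by rw [hρ]; positivity)
  rw [← hρ] at hpu
  rw [← hθ] at hpv
  obtain ⟨x0, _⟩ := hu.exists_pos
  have hc : (1 : ℝ) ≤ Fintype.card S := by exact_mod_cast Fintype.card_pos_iff.2 ⟨x0⟩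
  obtain ⟨C, hC⟩ : ∃ C, C = 4 * Real.log (Fintype.card S) := ⟨_, rfl⟩
  have hC0 : 0 ≤ C := by rw [hC]; have := Real.log_nonneg hc; positivity
  have m0 : 0 ≤ 4 * Gu / θ := by positivity
  have m1 : 0 ≤ 4 * Gv / ρ := by positivity
  have m2 : 0 ≤ 8 * C / (ρ * θ) := by positivity
  have m3 : 0 ≤ C / ε := by positivity
  refine ⟨4 * Gu / θ + 4 * Gv / ρ + 8 * C / (ρ * θ) + C / ε, fun lam hl hM => ?_⟩
  have l0 : 4 * Gu ≤ lam * θ := by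
    rw [← div_le_iff₀ hpv]; linarith
  have l1 : 4 * Gv ≤ lam * ρ := by
    rw [← div_le_iff₀ hpu]; linarith
  have l2 : 8 * C ≤ lam * (ρ * θ) := by
    rw [← div_le_iff₀ (by positivity)]; linarith
  have l3 : C < lam * ε := by
    rw [← div_lt_iff₀ hε]; linarith
  have ku : Csc K * (pm wu (fun s => σ s ^ 2) - Fw wu σ (lam * θ / 4)) * lam ≤ 1 / 2 := by
    have := du (lam * θ / 4) (by linarith)
    rw [le_div_iff₀ (by positivity)] at this
    have : θ * (Csc K * (pm wu (fun s => σ s ^ 2) - Fw wu σ (lam * θ / 4)) * lam) ≤ θ * (1 / 2) := by linarith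
    exact le_of_mul_le_mul_left this hpv
  have kv : Csc K * (pm wv (fun s => σ s ^ 2) - Fw wv σ (lam * ρ / 4)) * lam ≤ 1 / 2 := by
    have := dv (lam * ρ / 4) (by linarith)
    rw [le_div_iff₀ (by positivity)] at this
    have : ρ * (Csc K * (pm wv (fun s => σ s ^ 2) - Fw wv σ (lam * ρ / 4)) * lam) ≤ ρ * (1 / 2) := by linarith
    exact le_of_mul_le_mul_left this hpu
  obtain ⟨L, hL⟩ := cauchy_of_stab hu hv σ hσ hK (lam := lam) (r := lam / 2) (mu := lam * θ / 4) (mv := lam * ρ / 4)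
    (η0 := ρ * θ / 4) hl (by positivity) (by linarith) (by positivity) (by positivity) (by positivity) ku kv
    (fun n hn l h1 h2 h a b hh ha ha2 hb hb2 hE => by
      have hl2 : lam / 2 ≤ l := by linarith
      have hlp : 0 < l := by linarith
      rw [← hρ] at ha2
      rw [← hθ] at hb2
      have x1 := EE_entropy hu hv σ hn hlp
      rw [← hC, ← hρ, ← hθ] at x1
      have x2 := EE_mono hu hv σ n hlp.le hh
      have x3 := (abs_le.1 hE).2
      have x4 : C / l ≤ ρ * θ / 4 := by
        rw [div_le_iff₀ hlp]
        have : ρ * θ / 4 * (lam / 2) ≤ ρ * θ / 4 * l := mul_le_mul_of_nonneg_left hl2 (by positivity)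
        linarith
      have x5 : ρ * θ / 2 ≤ a * b := by linarith
      have hb3 : θ / 2 ≤ b := by
        have : ρ * (θ / 2) ≤ ρ * b := by
          have := mul_le_mul_of_nonneg_right ha2 hb
          linarith
        exact le_of_mul_le_mul_left this hpu
      have ha3 : ρ / 2 ≤ a := by
        have : θ * (ρ / 2) ≤ θ * a := by
          have := mul_le_mul_of_nonneg_left hb2 ha
          linarith
        exact le_of_mul_le_mul_left this hpv
      have y1 : lam / 2 * (θ / 2) ≤ l * b := mul_le_mul hl2 hb3 (by positivity) hlp.le
      have y2 : lam / 2 * (ρ / 2) ≤ l * a := mul_le_mul hl2 ha3 (by positivity) hlp.le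
      constructor <;> linarith)
  refine ⟨L, hL, ?_⟩
  rw [← hρ, ← hθ]
  have lo : ρ * θ - C / lam ≤ L := ge_of_tendsto hL (by
    filter_upwards [eventually_gt_atTop 0] with n hn
    have := EE_entropy hu hv σ hn hl
    rwa [← hC, ← hρ, ← hθ] at this)
  have up : L ≤ ρ * θ := le_of_tendsto hL (by
    filter_upwards [eventually_gt_atTop 0] with n hn
    have := EE_le hu hv σ hn lam 0
    rwa [← hρ, ← hθ] at this)
  have : C / lam < ε := by rw [div_lt_iff₀ hl]; linarith
  rw [abs_lt]; constructor <;> linarith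
end BM
end

noncomputable section
set_option linter.unusedSectionVars false
set_option linter.unusedVariables false
namespace BM

/-- The embedding of finite configurations. -/
def Phe (S : Finset ℝ) (n : ℕ) (x : Fin n ⊕ Fin n → {s // s ∈ S}) : (Fin n → ℝ) × (Fin n → ℝ) :=
  (fun i => (x (Sum.inl i)).1, fun j => (x (Sum.inr j)).1)

/-- Point weights of a measure. -/
def ptw (S : Finset ℝ) (P : Measure ℝ) (s : {s // s ∈ S}) : ℝ := P.real {s.1}

/-- Restricted measure on the support. -/
def cm (S : Finset ℝ) (P : Measure ℝ) : Measure {s // s ∈ S} := P.comap Subtype.val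

lemma sval_emb (S : Finset ℝ) : MeasurableEmbedding (Subtype.val : {s // s ∈ S} → ℝ) :=
  MeasurableEmbedding.subtype_coe (s := {s : ℝ | s ∈ S}) S.measurableSet

lemma cm_map (S : Finset ℝ) (P : Measure ℝ) (h : P ((↑S : Set ℝ)ᶜ) = 0) :
    P = (cm S P).map Subtype.val := by
  have hm : MeasurableSet {s : ℝ | s ∈ S} := S.measurableSet
  have := map_comap_subtype_coe hm P
  rw [cm]
  refine Eq.trans ?_ this.symm
  exact (Measure.restrict_eq_self_of_ae_mem (by rw [ae_iff]; exact h)).symm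

lemma cm_real (S : Finset ℝ) (P : Measure ℝ) (s : {s // s ∈ S}) : cm S P {s} = P {s.1} := by
  have hm : MeasurableSet {s : ℝ | s ∈ S} := S.measurableSet
  rw [cm, (sval_emb S).comap_apply]
  simp

lemma cm_prob (S : Finset ℝ) (P : Measure ℝ) [IsProbabilityMeasure P] (h : P ((↑S : Set ℝ)ᶜ) = 0) :
    IsProbabilityMeasure (cm S P) := by
  have e := cm_map S P h
  refine ⟨?_⟩
  have : (cm S P).map Subtype.val Set.univ = 1 := by rw [← e]; exact measure_univ
  rwa [Measure.map_apply measurable_subtype_coe MeasurableSet.univ, Set.preimage_univ] at this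

lemma cm_int (S : Finset ℝ) (P : Measure ℝ) [IsProbabilityMeasure P] (h : P ((↑S : Set ℝ)ᶜ) = 0) (g : ℝ → ℝ) :
    ∫ x, g x ∂P = pm (ptw S P) (fun s => g s.1) := by
  have := cm_prob S P h
  have hm : MeasurableSet {s : ℝ | s ∈ S} := S.measurableSet
  have e : ∫ x, g x ∂P = ∫ x, g x ∂((cm S P).map Subtype.val) := by rw [← cm_map S P h]
  rw [e, (sval_emb S).integral_map]
  rw [integral_fintype Integrable.of_finite]
  refine Finset.sum_congr rfl fun s _ => ?_
  rw [smul_eq_mul, ptw, Measure.real, Measure.real, cm_real]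

lemma ptw_isP (S : Finset ℝ) (P : Measure ℝ) [IsProbabilityMeasure P] (h : P ((↑S : Set ℝ)ᶜ) = 0) :
    IsP (ptw S P) := by
  refine ⟨fun s => measureReal_nonneg, ?_⟩
  have := cm_int S P h (fun _ => 1)
  simp [pm] at this
  exact this.symm

lemma prior_eq (S : Finset ℝ) (PU PV : Measure ℝ) [IsProbabilityMeasure PU] [IsProbabilityMeasure PV]
    (hU : PU ((↑S : Set ℝ)ᶜ) = 0) (hV : PV ((↑S : Set ℝ)ᶜ) = 0) (n : ℕ) :
    prior PU PV n = ∑ x, ENNReal.ofReal (pw (wts (Fin n) (Fin n) (ptw S PU) (ptw S PV)) x) •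
      Measure.dirac (Phe S n x) := by
  have := cm_prob S PU hU
  have := cm_prob S PV hV
  set μ : Measure ((Fin n → {s // s ∈ S}) × (Fin n → {s // s ∈ S})) :=
    (Measure.pi fun _ => cm S PU).prod (Measure.pi fun _ => cm S PV) with hμ
  set φ : (Fin n → {s // s ∈ S}) → (Fin n → ℝ) := fun x i => (x i).1 with hφ
  have hφm : Measurable φ := by fun_prop
  have e0 : ∀ (P : Measure ℝ) [IsProbabilityMeasure P], P ((↑S : Set ℝ)ᶜ) = 0 →
      (Measure.pi fun _ : Fin n => P) = (Measure.pi fun _ : Fin n => cm S P).map φ := by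
    intro P _ h
    have := cm_prob S P h
    have : IsProbabilityMeasure ((cm S P).map Subtype.val) := by rw [← cm_map S P h]; infer_instance
    have := Measure.pi_map_pi (μ := fun _ : Fin n => cm S P) (f := fun _ => (Subtype.val : {s // s ∈ S} → ℝ))
      (fun _ => measurable_subtype_coe.aemeasurable)
    rw [hφ, this, ← cm_map S P h]
  have e1 : prior PU PV n = μ.map (Prod.map φ φ) := by
    rw [prior, e0 PU hU, e0 PV hV, Measure.map_prod_map _ _ hφm hφm]
  have e2 : μ = ∑ q, μ {q} • Measure.dirac q := by
    rw [← Measure.sum_fintype, Measure.sum_smul_dirac]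
  rw [e1, e2, Measure.map_finset_sum (by fun_prop)]
  symm
  refine Fintype.sum_equiv (Equiv.sumArrowEquivProdArrow _ _ _) _ _ fun x => ?_
  rw [Measure.map_smul, Measure.map_dirac' (f := Prod.map φ φ) (hφm.prodMap hφm)]
  congr 1
  rw [hμ, Equiv.sumArrowEquivProdArrow]
  simp only [Equiv.coe_fn_mk]
  rw [← Set.singleton_prod_singleton, Measure.prod_prod, Measure.pi_singleton, Measure.pi_singleton]
  simp only [pw, Fintype.prod_sum_type, wts, Sum.elim_inl, Sum.elim_inr, ptw]
  rw [ENNReal.ofReal_mul (Finset.prod_nonneg fun i _ => measureReal_nonneg),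
    ENNReal.ofReal_prod_of_nonneg fun i _ => measureReal_nonneg,
    ENNReal.ofReal_prod_of_nonneg fun i _ => measureReal_nonneg]
  congr 1 <;>
  · refine Finset.prod_congr rfl fun i _ => ?_
    rw [ofReal_measureReal, cm_real]; rfl

lemma prior_int (S : Finset ℝ) (PU PV : Measure ℝ) [IsProbabilityMeasure PU] [IsProbabilityMeasure PV]
    (hU : PU ((↑S : Set ℝ)ᶜ) = 0) (hV : PV ((↑S : Set ℝ)ᶜ) = 0) (n : ℕ)
    (G : (Fin n → ℝ) × (Fin n → ℝ) → ℝ) :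
    ∫ q, G q ∂(prior PU PV n) =
      ∑ x, pw (wts (Fin n) (Fin n) (ptw S PU) (ptw S PV)) x * G (Phe S n x) := by
  have hp := isP_pw (isP_wts (R := Fin n) (C := Fin n) (ptw_isP S PU hU) (ptw_isP S PV hV))
  rw [prior_eq S PU PV hU hV, integral_finsetSum_measure]
  · refine Finset.sum_congr rfl fun x _ => ?_
    rw [integral_smul_measure, integral_dirac, ENNReal.toReal_ofReal (hp.1 x), smul_eq_mul]
  · intro x _
    exact (integrable_dirac (by simp)).smul_measure ENNReal.ofReal_ne_top

lemma noise_map (n : ℕ) : (noiseM n).map (fun Z (a : Fin n × Fin n) => Z a.1 a.2) = gam (Fin n × Fin n) := by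
  symm
  unfold gam
  refine Measure.pi_eq fun s hs => ?_
  rw [Measure.map_apply (by fun_prop) (MeasurableSet.univ_pi hs)]
  have : (fun Z (a : Fin n × Fin n) => Z a.1 a.2) ⁻¹' (Set.pi Set.univ s)
      = Set.pi Set.univ (fun i : Fin n => Set.pi Set.univ (fun j : Fin n => s (i, j))) := by
    ext Z; simp [Set.mem_pi]
  rw [this, noiseM]
  have : IsProbabilityMeasure stdG := by unfold stdG; infer_instance
  rw [Measure.pi_pi, Fintype.prod_prod_type]
  exact Finset.prod_congr rfl fun i _ => by rw [Measure.pi_pi]; rfl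

lemma sample_int (S : Finset ℝ) (PU PV : Measure ℝ) [IsProbabilityMeasure PU] [IsProbabilityMeasure PV]
    (hU : PU ((↑S : Set ℝ)ᶜ) = 0) (hV : PV ((↑S : Set ℝ)ᶜ) = 0) (n : ℕ)
    (F : ((Fin n → ℝ) × (Fin n → ℝ)) × (Fin n → Fin n → ℝ) → ℝ)
    (G : (Fin n ⊕ Fin n → {s // s ∈ S}) → (Fin n × Fin n → ℝ) → ℝ) (hG : ∀ x, Tame (G x))
    (h : ∀ x Z, F (Phe S n x, Z) = G x (fun a => Z a.1 a.2)) :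
    ∫ ω, F ω ∂(sampleM PU PV n) =
      ∑ x, pw (wts (Fin n) (Fin n) (ptw S PU) (ptw S PV)) x * ∫ Y, G x Y ∂(gam (Fin n × Fin n)) := by
  have hp := isP_pw (isP_wts (R := Fin n) (C := Fin n) (ptw_isP S PU hU) (ptw_isP S PV hV))
  have : IsProbabilityMeasure stdG := by unfold stdG; infer_instance
  have : IsProbabilityMeasure (noiseM n) := by unfold noiseM; infer_instance
  have e : sampleM PU PV n = ∑ x, ENNReal.ofReal (pw (wts (Fin n) (Fin n) (ptw S PU) (ptw S PV)) x) •
      (noiseM n).map (Prod.mk (Phe S n x)) := by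
    rw [sampleM, prior_eq S PU PV hU hV, ← Measure.sum_fintype, Measure.prod_sum_left, Measure.sum_fintype]
    refine Finset.sum_congr rfl fun x _ => ?_
    rw [Measure.prod_smul_left, Measure.dirac_prod]
  have hmu : Measurable (fun (Z : Fin n → Fin n → ℝ) (a : Fin n × Fin n) => Z a.1 a.2) := by fun_prop
  rw [e, integral_finsetSum_measure]
  · refine Finset.sum_congr rfl fun x _ => ?_
    rw [integral_smul_measure, ENNReal.toReal_ofReal (hp.1 x), smul_eq_mul,
      (measurableEmbedding_prodMk_left _).integral_map]
    congr 1
    simp_rw [h]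
    rw [← noise_map, integral_map hmu.aemeasurable]
    exact (hG x).1.aestronglyMeasurable
  · intro x _
    refine Integrable.smul_measure ?_ ENNReal.ofReal_ne_top
    rw [(measurableEmbedding_prodMk_left _).integrable_map_iff]
    have : F ∘ Prod.mk (Phe S n x) = (G x) ∘ (fun Z a => Z a.1 a.2) := by
      funext Z; exact h x Z
    rw [this]
    refine Integrable.comp_measurable ?_ hmu
    rw [noise_map]
    exact (hG x).integrable

lemma Ham_el (S : Finset ℝ) {lam : ℝ} (hl : 0 < lam) {n : ℕ} (x y : Fin n ⊕ Fin n → {s // s ∈ S})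
    (Z : Fin n → Fin n → ℝ) :
    Real.exp (Ham lam n (Phe S n x).1 (Phe S n x).2 Z (Phe S n y).1 (Phe S n y).2)
      = el (sc (lam / n) (prodc (R := Fin n) (C := Fin n) (Subtype.val : {s // s ∈ S} → ℝ)) y)
        ((fun a => Z a.1 a.2) + sc (lam / n) (prodc (R := Fin n) (C := Fin n) (Subtype.val : {s // s ∈ S} → ℝ)) x) := by
  unfold el
  congr 1
  rw [Ham, Fintype.sum_prod_type, Fintype.sum_prod_type, Finset.sum_div, ← Finset.sum_sub_distrib]
  refine Finset.sum_congr rfl fun i _ => ?_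
  rw [Finset.sum_div, ← Finset.sum_sub_distrib]
  refine Finset.sum_congr rfl fun j _ => ?_
  have h0 : 0 ≤ lam / n := by positivity
  have h1 : Real.sqrt (lam / n) * Real.sqrt (lam / n) = lam / n := Real.mul_self_sqrt h0
  have h2 : lam / (2 * n) = (lam / n) / 2 := by rw [div_div, mul_comm]
  simp only [Phe, sc, prodc, Pi.add_apply]
  rw [h2]
  linear_combination (-((y (Sum.inl i)).1 * (y (Sum.inr j)).1 * ((x (Sum.inl i)).1 * (x (Sum.inr j)).1))
    + ((y (Sum.inl i)).1 * (y (Sum.inr j)).1) ^ 2 / 2) * h1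

lemma mmse_ov {Ω A : Type} [Fintype Ω] [Fintype A] {p : Ω → ℝ} (hp : IsP p) (c : Ω → A → ℝ) (f : Ω → ℝ) :
    ∑ x, p x * ∫ Y, (f x - Nc p c f (Y + c x) / Zc p c (Y + c x)) ^ 2 ∂(gam A)
      = pm p (fun x => f x ^ 2) - ov p c f := by
  set H : (A → ℝ) → ℝ := fun Y => Nc p c f Y / Zc p c Y with hH
  have tH : Tame H := by
    have := (tame_Nc p c f).mul (tame_inv_Zc hp c)
    simpa only [hH, div_eq_mul_inv] using this
  have tHs : ∀ x, Tame (fun Y => H (Y + c x)) := fun x => tH.shift (c x)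
  have tHs2 : ∀ x, Tame (fun Y => H (Y + c x) ^ 2) := fun x => (tHs x).pow 2
  have e : ∀ x, ∫ Y, (f x - H (Y + c x)) ^ 2 ∂(gam A)
      = f x ^ 2 - 2 * f x * ∫ Y, H (Y + c x) ∂(gam A) + ∫ Y, H (Y + c x) ^ 2 ∂(gam A) := by
    intro x
    have i1 : Integrable (fun Y => 2 * f x * H (Y + c x)) (gam A) := ((tHs x).const_mul _).integrable
    have i2 : Integrable (fun Y => H (Y + c x) ^ 2) (gam A) := (tHs2 x).integrable
    have i3 : Integrable (fun Y => f x ^ 2 - 2 * f x * H (Y + c x)) (gam A) := (integrable_const _).sub i1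
    have : ∀ Y, (f x - H (Y + c x)) ^ 2 = (f x ^ 2 - 2 * f x * H (Y + c x)) + H (Y + c x) ^ 2 := fun Y => by ring
    simp_rw [this]
    rw [integral_add i3 i2, integral_sub (integrable_const _) i1, integral_const_mul]
    simp
  have a1 := integral_Nc_mul p c f tH
  have a2 := integral_planted p c (tH.pow 2)
  have b1 : ∫ Y, Nc p c f Y * H Y ∂(gam A) = ov p c f := by
    unfold ov
    refine integral_congr_ae (.of_forall fun Y => ?_)
    simp only [hH]; ring
  have b2 : ∫ Y, Zc p c Y * H Y ^ 2 ∂(gam A) = ov p c f := by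
    unfold ov
    refine integral_congr_ae (.of_forall fun Y => ?_)
    have := (Zc_pos hp c Y).ne'
    simp only [hH]; field_simp
  rw [b1] at a1
  rw [b2] at a2
  have : ∑ x, p x * ∫ Y, (f x - H (Y + c x)) ^ 2 ∂(gam A)
      = pm p (fun x => f x ^ 2) - 2 * (∑ x, p x * f x * ∫ Y, H (Y + c x) ∂(gam A))
        + ∑ x, p x * ∫ Y, H (Y + c x) ^ 2 ∂(gam A) := by
    rw [pm, Finset.mul_sum, ← Finset.sum_sub_distrib, ← Finset.sum_add_distrib]
    refine Finset.sum_congr rfl fun x _ => ?_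
    rw [e x]; ring
  rw [this, ← a1, ← a2]; ring

lemma MMSE_eq (S : Finset ℝ) (PU PV : Measure ℝ) [IsProbabilityMeasure PU] [IsProbabilityMeasure PV]
    (hU : PU ((↑S : Set ℝ)ᶜ) = 0) (hV : PV ((↑S : Set ℝ)ᶜ) = 0) {n : ℕ} (hn : 0 < n) {lam : ℝ} (hl : 0 < lam) :
    MMSEn PU PV n lam = pm (ptw S PU) (fun s => s.1 ^ 2) * pm (ptw S PV) (fun s => s.1 ^ 2)
      - EE (ptw S PU) (ptw S PV) Subtype.val n lam 0 := by
  set wu := ptw S PU with hwu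
  set wv := ptw S PV with hwv
  set p := pw (wts (Fin n) (Fin n) wu wv) with hpd
  have hw : ∀ k, IsP (wts (Fin n) (Fin n) wu wv k) := isP_wts (ptw_isP S PU hU) (ptw_isP S PV hV)
  have hp : IsP p := isP_pw hw
  set σ : {s // s ∈ S} → ℝ := Subtype.val with hσ
  set c : (Fin n ⊕ Fin n → {s // s ∈ S}) → Fin n × Fin n → ℝ := sc (lam / n) (prodc σ) with hc
  have h0 : 0 ≤ lam / n := by positivity
  have key : ∀ i j : Fin n, ∫ ω, (ω.1.1 i * ω.1.2 j - gibbs PU PV lam n ω fun uv => uv.1 i * uv.2 j) ^ 2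
      ∂(sampleM PU PV n) = pm wu (fun s => s.1 ^ 2) * pm wv (fun s => s.1 ^ 2)
        - ov p (sysc (lam / n) 0 σ) (fun x => σ (x (Sum.inl i)) * σ (x (Sum.inr j))) := by
    intro i j
    set f : (Fin n ⊕ Fin n → {s // s ∈ S}) → ℝ := fun x => σ (x (Sum.inl i)) * σ (x (Sum.inr j)) with hf
    have tH : Tame (fun Y => Nc p c f Y / Zc p c Y) := by
      have := (tame_Nc p c f).mul (tame_inv_Zc hp c)
      simpa only [div_eq_mul_inv] using this
    have tG : ∀ x, Tame (fun Y => (f x - Nc p c f (Y + c x) / Zc p c (Y + c x)) ^ 2) :=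
      fun x => ((tame_const (f x)).sub (tH.shift (c x))).pow 2
    rw [sample_int S PU PV hU hV n _ (fun x Y => (f x - Nc p c f (Y + c x) / Zc p c (Y + c x)) ^ 2) tG,
      mmse_ov hp c f]
    · congr 1
      · have := pm_pw_pair hw (k := Sum.inl i) (l := Sum.inr j) (by simp) (fun s => s.1 ^ 2) (fun s => s.1 ^ 2)
        rw [show wts (Fin n) (Fin n) wu wv (Sum.inl i) = wu from rfl,
          show wts (Fin n) (Fin n) wu wv (Sum.inr j) = wv from rfl] at this
        rw [← this]
        congr 1
        funext x
        simp only [hf, mul_pow, hσ]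
      · refine ov_gram _ _ _ (fun x y => ?_) _
        rw [sysc, cd_gram, sc_gram (le_refl 0)]; simp [hc]
    · intro x Z
      congr 1
      rw [gibbs, partFun, prior_int S PU PV hU hV, prior_int S PU PV hU hV]
      congr 1
      simp_rw [Ham_el S hl]
      congr 1
      unfold Nc
      refine Finset.sum_congr rfl fun y _ => ?_
      exact (mul_assoc _ _ _).symm
  unfold MMSEn
  simp_rw [key]
  unfold EE
  simp only [Finset.sum_sub_distrib, Finset.sum_const, Finset.card_univ, Fintype.card_fin, nsmul_eq_mul]
  have hn' : (n : ℝ) ≠ 0 := by positivity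
  rw [← hpd]
  field_simp
  rfl

lemma final_thm
    (K₀ : ℝ) (S : Finset ℝ) (hSK : ∀ x ∈ S, |x| ≤ K₀)
    (PU PV : Measure ℝ) [IsProbabilityMeasure PU] [IsProbabilityMeasure PV]
    (hUS : PU ((↑S : Set ℝ)ᶜ) = 0) (hVS : PV ((↑S : Set ℝ)ᶜ) = 0)
    (hUvar : 0 < (∫ x, x ^ 2 ∂PU) - (∫ x, x ∂PU) ^ 2)
    (hVvar : 0 < (∫ x, x ^ 2 ∂PV) - (∫ x, x ∂PV) ^ 2) :
    (∀ ε > (0 : ℝ), ∃ δ > (0 : ℝ), ∀ lam ∈ Dset PU PV, lam < δ →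
        ∃ L : ℝ, Tendsto (fun n => MMSEn PU PV n lam) atTop (𝓝 L)
          ∧ |L - ((∫ x, x ^ 2 ∂PU) * (∫ x, x ^ 2 ∂PV)
                - (∫ x, x ∂PU) ^ 2 * (∫ x, x ∂PV) ^ 2)| < ε)
    ∧ (∀ ε > (0 : ℝ), ∃ M : ℝ, ∀ lam ∈ Dset PU PV, M < lam →
        ∃ L : ℝ, Tendsto (fun n => MMSEn PU PV n lam) atTop (𝓝 L) ∧ |L| < ε) := by
  have hu := ptw_isP S PU hUS
  have hv := ptw_isP S PV hVS
  have hσ : ∀ s : {s // s ∈ S}, |s.1| ≤ |K₀| := fun s => (hSK s.1 s.2).trans (le_abs_self _)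
  have eu2 := cm_int S PU hUS (fun x => x ^ 2)
  have ev2 := cm_int S PV hVS (fun x => x ^ 2)
  have eu1 := cm_int S PU hUS (fun x => x)
  have ev1 := cm_int S PV hVS (fun x => x)
  rw [eu2, eu1] at hUvar
  rw [ev2, ev1] at hVvar
  rw [eu2, ev2, eu1, ev1]
  have hpu : 0 < pm (ptw S PU) (fun s => s.1 ^ 2) := by
    have := sq_nonneg (pm (ptw S PU) (fun s => s.1)); linarith
  have hpv : 0 < pm (ptw S PV) (fun s => s.1 ^ 2) := by
    have := sq_nonneg (pm (ptw S PV) (fun s => s.1)); linarith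
  have tr : ∀ lam, 0 < lam → ∀ L, Tendsto (fun n => EE (ptw S PU) (ptw S PV) Subtype.val n lam 0) atTop (𝓝 L) →
      Tendsto (fun n => MMSEn PU PV n lam) atTop
        (𝓝 (pm (ptw S PU) (fun s => s.1 ^ 2) * pm (ptw S PV) (fun s => s.1 ^ 2) - L)) := by
    intro lam hl L hL
    refine (tendsto_const_nhds.sub hL).congr' ?_
    filter_upwards [eventually_gt_atTop 0] with n hn
    exact (MMSE_eq S PU PV hUS hVS hn hl).symm
  refine ⟨fun ε hε => ?_, fun ε hε => ?_⟩
  · obtain ⟨δ, hδ, H⟩ := low_lim hu hv Subtype.val hσ (abs_nonneg K₀) hε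
    refine ⟨δ, hδ, fun lam hD hlt => ?_⟩
    obtain ⟨L, hL, hb⟩ := H lam hD.1 hlt
    refine ⟨_, tr lam hD.1 L hL, ?_⟩
    rw [abs_sub_comm] at hb
    convert hb using 2
    ring
  · obtain ⟨M, H⟩ := high_lim hu hv Subtype.val hσ (abs_nonneg K₀) hpu hpv hε
    refine ⟨M, fun lam hD hlt => ?_⟩
    obtain ⟨L, hL, hb⟩ := H lam hD.1 hlt
    refine ⟨_, tr lam hD.1 L hL, ?_⟩
    rwa [abs_sub_comm] at hb

end BM
end

/-- **Limits of the asymptotic MMSE in the low- and high-signal regimes**: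
`lim_n MMSE_n(λ) → E[U²]E[V²] − (E[U])²(E[V])²` as `λ → 0` along `D` and
`lim_n MMSE_n(λ) → 0` as `λ → +∞` along `D`. -/
theorem mmse_low_high_signal_limits
    (K₀ : ℝ) (S : Finset ℝ) (hSK : ∀ x ∈ S, |x| ≤ K₀)
    (PU PV : Measure ℝ) [IsProbabilityMeasure PU] [IsProbabilityMeasure PV]
    (hUS : PU ((↑S : Set ℝ)ᶜ) = 0) (hVS : PV ((↑S : Set ℝ)ᶜ) = 0)
    (hUvar : 0 < (∫ x, x ^ 2 ∂PU) - (∫ x, x ∂PU) ^ 2)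
    (hVvar : 0 < (∫ x, x ^ 2 ∂PV) - (∫ x, x ∂PV) ^ 2) :
    (∀ ε > (0 : ℝ), ∃ δ > (0 : ℝ), ∀ lam ∈ Dset PU PV, lam < δ →
        ∃ L : ℝ, Tendsto (fun n => MMSEn PU PV n lam) atTop (𝓝 L)
          ∧ |L - ((∫ x, x ^ 2 ∂PU) * (∫ x, x ^ 2 ∂PV)
                - (∫ x, x ∂PU) ^ 2 * (∫ x, x ∂PV) ^ 2)| < ε)
    ∧ (∀ ε > (0 : ℝ), ∃ M : ℝ, ∀ lam ∈ Dset PU PV, M < lam →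
        ∃ L : ℝ, Tendsto (fun n => MMSEn PU PV n lam) atTop (𝓝 L) ∧ |L| < ε) := by
  exact BM.final_thm K₀ S hSK PU PV hUS hVS hUvar hVvar
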